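/- Let p ∈ (1,∞) and let l, m ≥ 0 be integers with l + m ≥ 1. Then there exists a constant c = c(p, l, m) > 0 such that for all Schwartz functions a, f : ℝ → ℂ, ‖ ∂ₓ^{l} ( 𝓗(a · ∂ₓ^{m} f) − a · 𝓗(∂ₓ^{m} f) ) ‖_{L^p(ℝ)} ≤ c ‖∂ₓ^{l+m} a‖_{L^∞(ℝ)} ‖f‖_{L^p(ℝ)}. -/

import Mathlib

open MeasureTheory

/-- The Fourier transform on `ℝ`: `ĝ(ξ) = ∫ e^{−ixξ} g(x) dx`. -/
noncomputable def FT1 (f : ℝ → ℂ) (ξ : ℝ) : ℂ :=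
  ∫ x : ℝ, Complex.exp (-(Complex.I * (x : ℂ) * (ξ : ℂ))) * f x

/-- The Hilbert transform on `ℝ`, the Fourier multiplier with symbol `−i sgn(ξ)`:
`(𝓗g)^(ξ) = −i sgn(ξ) ĝ(ξ)`; realized by Fourier inversion. -/
noncomputable def Hil (f : ℝ → ℂ) (x : ℝ) : ℂ :=
  ((1 / (2 * Real.pi) : ℝ) : ℂ) *
    ∫ ξ : ℝ, Complex.exp (Complex.I * (x : ℂ) * (ξ : ℂ)) *
      (-Complex.I * ((Real.sign ξ : ℝ) : ℂ)) * FT1 f ξ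

namespace CC
open Set Filter Topology
open scoped ENNReal

lemma ode_bound (m m1 m2 : ℝ → ℝ) (M0 : ℝ) (h0 : ∀ y, 0 < y → 0 ≤ m y)
    (hM : ∀ y, 0 < y → m y ≤ M0) (hd1 : ∀ y, 0 < y → HasDerivAt m (m1 y) y)
    (hd2 : ∀ y, 0 < y → HasDerivAt m1 (m2 y) y) (hpos : ∀ y, 0 < y → 0 ≤ m2 y) :
    ∫⁻ y in Ioi (0:ℝ), ENNReal.ofReal (y * m2 y) ≤ ENNReal.ofReal (3 * M0) := by
  have hmono : MonotoneOn m1 (Ioi 0) := by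
    apply monotoneOn_of_deriv_nonneg (convex_Ioi 0)
    · intro y hy; exact (hd2 y hy).continuousAt.continuousWithinAt
    · intro y hy; rw [interior_Ioi] at hy; exact (hd2 y hy).differentiableAt.differentiableWithinAt
    · intro y hy; rw [interior_Ioi] at hy; rw [(hd2 y hy).deriv]; exact hpos y hy
  have hslope : ∀ a b, 0 < a → a < b → m1 a * (b - a) ≤ m b - m a ∧ m b - m a ≤ m1 b * (b - a) := by
    intro a b ha hab
    obtain ⟨c, hc, hc'⟩ := exists_hasDerivAt_eq_slope m m1 hab
      (fun y hy => (hd1 y (ha.trans_le hy.1)).continuousAt.continuousWithinAt)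
      (fun y hy => hd1 y (ha.trans hy.1))
    have hba : 0 < b - a := by linarith
    have e : m b - m a = m1 c * (b - a) := by rw [hc']; field_simp
    have hc0 : 0 < c := ha.trans hc.1
    rw [e]
    exact ⟨mul_le_mul_of_nonneg_right (hmono ha hc0 hc.1.le) hba.le,
      mul_le_mul_of_nonneg_right (hmono hc0 (hc0.trans hc.2) hc.2.le) hba.le⟩
  have hneg : ∀ y, 0 < y → m1 y ≤ 0 := by
    intro y hy
    by_contra hcon
    push Not at hcon
    have hM0 : 0 ≤ M0 := (h0 y hy).trans (hM y hy)
    have := (hslope y (y + (M0 + 1) / m1 y) hy (by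
      have : 0 < (M0 + 1) / m1 y := by positivity
      linarith)).1
    have h2 : m1 y * (y + (M0 + 1) / m1 y - y) = M0 + 1 := by field_simp; ring
    rw [h2] at this
    have h3 := hM (y + (M0 + 1) / m1 y) (by positivity)
    have h4 := h0 y hy
    linarith
  have key : ∀ n : ℕ, ∫⁻ y in Ioc (1 / ((n:ℝ) + 1)) ((n:ℝ) + 1), ENNReal.ofReal (y * m2 y)
      ≤ ENNReal.ofReal (3 * M0) := by
    intro n
    set a : ℝ := 1 / ((n:ℝ) + 1)
    set b : ℝ := (n:ℝ) + 1
    have hb : 0 < b := by positivity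
    have ha : 0 < a := by positivity
    have hab : a ≤ b := by
      have h1 : (1:ℝ) ≤ b := by simp [b]
      have : a ≤ 1 := by
        simp only [a]; rw [div_le_one hb]; exact h1
      linarith
    have hder : ∀ y, 0 < y → HasDerivAt (fun y => y * m1 y - m y) (y * m2 y) y := by
      intro y hy
      have := ((hasDerivAt_id y).mul (hd2 y hy)).sub (hd1 y hy)
      convert! this using 1
      simp
    have h_intg : IntegrableOn (fun y => y * m2 y) (Ioc a b) := by
      apply intervalIntegral.integrableOn_deriv_of_nonneg (g := fun y => y * m1 y - m y)
      · intro y hy; exact (hder y (ha.trans_le hy.1)).continuousAt.continuousWithinAt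
      · intro y hy; exact hder y (ha.trans hy.1)
      · intro y hy; exact mul_nonneg (ha.trans hy.1).le (hpos y (ha.trans hy.1))
    rw [← ofReal_integral_eq_lintegral_ofReal h_intg]
    · apply ENNReal.ofReal_le_ofReal
      rw [← intervalIntegral.integral_of_le hab]
      rw [intervalIntegral.integral_eq_sub_of_hasDerivAt (f := fun y => y * m1 y - m y)]
      · have e1 := hneg b hb
        have e2 := h0 b hb
        have e3 := hM a ha
        have e4 := (hslope (a/2) a (by positivity) (by linarith)).2
        have e5 := hM (a/2) (by positivity)
        have e6 := h0 a ha
        have e7 : b * m1 b ≤ 0 := by nlinarith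
        linarith
      · intro y hy
        rw [uIcc_of_le hab] at hy
        exact hder y (ha.trans_le hy.1)
      · rw [intervalIntegrable_iff_integrableOn_Ioc_of_le hab]; exact h_intg
    · filter_upwards [ae_restrict_mem measurableSet_Ioc] with y hy
      exact mul_nonneg (ha.trans hy.1).le (hpos y (ha.trans hy.1))
  have hU : Ioi (0:ℝ) = ⋃ n : ℕ, Ioc (1 / ((n:ℝ) + 1)) ((n:ℝ) + 1) := by
    ext y
    simp only [mem_Ioi, mem_iUnion, mem_Ioc]
    constructor
    · intro hy
      obtain ⟨n, hn⟩ := exists_nat_gt (max y (1/y))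
      refine ⟨n, ?_, ?_⟩
      · rw [div_lt_comm₀ (by positivity) hy]
        have := le_max_right y (1/y)
        linarith
      · have := le_max_left y (1/y)
        linarith
    · rintro ⟨n, hn, -⟩
      exact lt_trans (by positivity) hn
  rw [hU, setLIntegral_iUnion_of_directed]
  · exact iSup_le key
  · apply Monotone.directed_le
    intro i j hij
    have : (i:ℝ) ≤ j := by exact_mod_cast hij
    apply Ioc_subset_Ioc
    · apply one_div_le_one_div_of_le <;> linarith [(Nat.cast_nonneg i : (0:ℝ) ≤ i)]
    · linarith
end CC

namespace CC
open Set Filter Topology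
open scoped ENNReal

/-- The upper half plane. -/
def Hp : Set ℂ := {z | 0 < z.im}

lemma isOpen_Hp : IsOpen Hp := isOpen_lt continuous_const Complex.continuous_im

lemma mem_Hp {z : ℂ} : z ∈ Hp ↔ 0 < z.im := Iff.rfl

structure Good (c : ℝ) (Q : ℂ → ℂ) : Prop where
  diff : DifferentiableOn ℂ Q Hp
  pos : ∀ z ∈ Hp, 0 < (Q z).re
  le : ∀ z ∈ Hp, ‖Q z‖ ≤ 2 * (Q z).re
  der : ∀ z ∈ Hp, ‖deriv Q z‖ ≤ c * ‖Q z‖ / z.im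

lemma im_of_near {z w : ℂ} (h : ‖w - z‖ ≤ z.im / 2) : z.im / 2 ≤ w.im ∧ w.im ≤ 3 / 2 * z.im := by
  have h1 : |(w - z).im| ≤ z.im / 2 := (Complex.abs_im_le_norm _).trans h
  rw [Complex.sub_im, abs_le] at h1
  constructor <;> linarith

lemma Good.ne {c : ℝ} {Q : ℂ → ℂ} (hQ : Good c Q) {z : ℂ} (hz : z ∈ Hp) : Q z ≠ 0 := by
  intro h
  have := hQ.pos z hz
  rw [h] at this
  simp at this

lemma Good.norm_pos {c : ℝ} {Q : ℂ → ℂ} (hQ : Good c Q) {z : ℂ} (hz : z ∈ Hp) : 0 < ‖Q z‖ :=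
  norm_pos_iff.2 (hQ.ne hz)

lemma Good.c_nonneg {c : ℝ} {Q : ℂ → ℂ} (hQ : Good c Q) : 0 ≤ c := by
  have h := hQ.der Complex.I (by simp [Hp])
  have h2 := hQ.norm_pos (z := Complex.I) (by simp [Hp])
  simp only [Complex.I_im, div_one] at h
  by_contra hc
  push Not at hc
  nlinarith [norm_nonneg (deriv Q Complex.I)]

lemma Good.harnack_aux {c : ℝ} {Q : ℂ → ℂ} (hQ : Good c Q) {z w : ℂ} (hz : z ∈ Hp)
    (h : ‖w - z‖ ≤ z.im / 2) : |Real.log ‖Q w‖ - Real.log ‖Q z‖| ≤ c := by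
  have hz' : 0 < z.im := hz
  have hc := hQ.c_nonneg
  have hsub : ∀ u ∈ Metric.closedBall z (z.im / 2), u ∈ Hp := by
    intro u hu
    have := im_of_near (z := z) (w := u) (by rwa [Metric.mem_closedBall, dist_eq_norm] at hu)
    rw [mem_Hp]; linarith
  have := (convex_closedBall z (z.im / 2)).norm_image_sub_le_of_norm_hasDerivWithin_le
    (f := fun u => Complex.log (Q u)) (f' := fun u => deriv Q u / Q u) (C := 2 * c / z.im)
    (x := z) (y := w) ?_ ?_ (Metric.mem_closedBall_self (by positivity))
    (by rwa [Metric.mem_closedBall, dist_eq_norm])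
  · have h2 := (Complex.abs_re_le_norm _).trans this
    rw [Complex.sub_re, Complex.log_re, Complex.log_re] at h2
    refine h2.trans ?_
    calc 2 * c / z.im * ‖w - z‖ ≤ 2 * c / z.im * (z.im / 2) := by gcongr
      _ = c := by field_simp
  · intro u hu
    have hu' := hsub u hu
    exact ((hQ.diff.differentiableAt (isOpen_Hp.mem_nhds hu')).hasDerivAt.clog
      (Or.inl (hQ.pos u hu'))).hasDerivWithinAt
  · intro u hu
    have hu' := hsub u hu
    have hn := hQ.norm_pos hu'
    rw [norm_div, div_le_iff₀ hn]
    refine (hQ.der u hu').trans ?_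
    have hi := (im_of_near (z := z) (w := u) (by rwa [Metric.mem_closedBall, dist_eq_norm] at hu)).1
    have hui : 0 < u.im := hu'
    calc c * ‖Q u‖ / u.im ≤ c * ‖Q u‖ / (z.im / 2) := by gcongr
      _ = 2 * c / z.im * ‖Q u‖ := by field_simp

lemma Good.harnack {c : ℝ} {Q : ℂ → ℂ} (hQ : Good c Q) {z w : ℂ} (hz : z ∈ Hp)
    (h : ‖w - z‖ ≤ z.im / 2) : ‖Q w‖ ≤ Real.exp c * ‖Q z‖ ∧ ‖Q z‖ ≤ Real.exp c * ‖Q w‖ := by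
  have hz' : 0 < z.im := hz
  have hw : w ∈ Hp := by
    have := im_of_near h
    rw [mem_Hp]; linarith
  have h1 := abs_le.1 (hQ.harnack_aux hz h)
  have a := hQ.norm_pos hz
  have b := hQ.norm_pos hw
  constructor
  · rw [← Real.log_le_log_iff b (by positivity), Real.log_mul (Real.exp_pos _).ne' a.ne',
      Real.log_exp]
    linarith
  · rw [← Real.log_le_log_iff a (by positivity), Real.log_mul (Real.exp_pos _).ne' b.ne',
      Real.log_exp]
    linarith

lemma Good.cauchy {c : ℝ} {Q : ℂ → ℂ} (hQ : Good c Q) {f : ℂ → ℂ} (hf : DifferentiableOn ℂ f Hp)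
    (e j : ℕ) {B : ℝ} (hb : ∀ w ∈ Hp, ‖f w‖ ≤ B * ‖Q w‖ ^ e / w.im ^ j) {z : ℂ} (hz : z ∈ Hp) :
    ‖deriv f z‖ ≤ (2 * Real.exp c ^ e * 2 ^ j * B) * ‖Q z‖ ^ e / z.im ^ (j + 1) := by
  have hz' : 0 < z.im := hz
  have hB : 0 ≤ B := by
    have h1 := (norm_nonneg _).trans (hb z hz)
    have h2 := hQ.norm_pos hz
    by_contra hc
    push Not at hc
    have : B * ‖Q z‖ ^ e / z.im ^ j < 0 := by
      apply div_neg_of_neg_of_pos _ (by positivity)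
      exact mul_neg_of_neg_of_pos hc (by positivity)
    linarith
  have hsub : ∀ u ∈ Metric.closedBall z (z.im / 2), u ∈ Hp := by
    intro u hu
    have := im_of_near (z := z) (w := u) (by rwa [Metric.mem_closedBall, dist_eq_norm] at hu)
    rw [mem_Hp]; linarith
  have := Complex.norm_deriv_le_of_forall_mem_sphere_norm_le (c := z) (R := z.im / 2)
    (C := B * (Real.exp c * ‖Q z‖) ^ e / (z.im / 2) ^ j) (f := f) (by positivity) ?_ ?_
  · refine this.trans (le_of_eq ?_)
    rw [mul_pow, div_pow]
    field_simp
    ring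
  · apply DifferentiableOn.diffContOnCl
    rw [closure_ball _ (by positivity)]
    exact hf.mono hsub
  · intro u hu
    have hu1 : u ∈ Metric.closedBall z (z.im / 2) := Metric.sphere_subset_closedBall hu
    have hu2 : ‖u - z‖ ≤ z.im / 2 := by rwa [Metric.mem_closedBall, dist_eq_norm] at hu1
    refine (hb u (hsub u hu1)).trans ?_
    have hi := (im_of_near hu2).1
    have hk := (hQ.harnack hz hu2).1
    gcongr

lemma Good.cauchy_iter {c : ℝ} {Q : ℂ → ℂ} (hQ : Good c Q) {f : ℂ → ℂ}
    (hf : DifferentiableOn ℂ f Hp)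
    (e : ℕ) {B : ℝ} (hb : ∀ w ∈ Hp, ‖f w‖ ≤ B * ‖Q w‖ ^ e) (n : ℕ) :
    DifferentiableOn ℂ (iteratedDeriv n f) Hp ∧ ∀ z ∈ Hp,
    ‖iteratedDeriv n f z‖ ≤ ((2 * Real.exp c ^ e * 2 ^ n) ^ n * B) * ‖Q z‖ ^ e / z.im ^ n := by
  have key : ∀ j, j ≤ n → DifferentiableOn ℂ (iteratedDeriv j f) Hp ∧ ∀ z ∈ Hp,
    ‖iteratedDeriv j f z‖ ≤ ((2 * Real.exp c ^ e * 2 ^ n) ^ j * B) * ‖Q z‖ ^ e / z.im ^ j := by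
    intro j
    induction j with
    | zero => intro _; simpa using ⟨hf, hb⟩
    | succ j ih =>
      intro hj
      obtain ⟨h1, h2⟩ := ih (by omega)
      rw [iteratedDeriv_succ]
      refine ⟨h1.deriv isOpen_Hp, fun z hz => ?_⟩
      have hz' : 0 < z.im := hz
      refine (hQ.cauchy h1 e j h2 hz).trans ?_
      have hB : 0 ≤ B := by
        have h3 := (norm_nonneg _).trans (hb z hz)
        have h4 : 0 < ‖Q z‖ ^ e := pow_pos (hQ.norm_pos hz) e
        exact nonneg_of_mul_nonneg_left h3 h4
      rw [pow_succ (2 * Real.exp c ^ e * 2 ^ n) j]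
      have : (2:ℝ) ^ j ≤ 2 ^ n := pow_le_pow_right₀ (by norm_num) (by omega)
      have h5 : 2 * Real.exp c ^ e * 2 ^ j * ((2 * Real.exp c ^ e * 2 ^ n) ^ j * B)
        ≤ (2 * Real.exp c ^ e * 2 ^ n) ^ j * (2 * Real.exp c ^ e * 2 ^ n) * B := by
        calc _ = (2 * Real.exp c ^ e * 2 ^ n) ^ j * (2 * Real.exp c ^ e * 2 ^ j) * B := by ring
          _ ≤ _ := by gcongr
      gcongr
  exact key n le_rfl
end CC

namespace CC
open Set Filter Topology
open scoped ENNReal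

lemma hasDerivAt_mk_x (x y : ℝ) : HasDerivAt (fun x : ℝ => (⟨x, y⟩ : ℂ)) 1 x := by
  have h : (fun x : ℝ => (⟨x, y⟩ : ℂ)) = fun x : ℝ => (x : ℂ) + (y : ℂ) * Complex.I := by
    funext x; apply Complex.ext <;> simp
  rw [h]
  exact (Complex.ofRealCLM.hasDerivAt (x := x)).add_const _

lemma hasDerivAt_mk_y (x y : ℝ) : HasDerivAt (fun y : ℝ => (⟨x, y⟩ : ℂ)) Complex.I y := by
  have h : (fun y : ℝ => (⟨x, y⟩ : ℂ)) = fun y : ℝ => (x : ℂ) + (y : ℂ) * Complex.I := by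
    funext x; apply Complex.ext <;> simp
  rw [h]
  simpa using ((Complex.ofRealCLM.hasDerivAt (x := y)).mul_const Complex.I).const_add (x:ℂ)


lemma hasDerivAt_x {g : ℂ → ℂ} (hg : DifferentiableOn ℂ g Hp) {x y : ℝ} (hy : 0 < y) :
    HasDerivAt (fun x : ℝ => g ⟨x, y⟩) (deriv g ⟨x, y⟩) x := by
  have h := (hg.differentiableAt (isOpen_Hp.mem_nhds (show (⟨x, y⟩ : ℂ) ∈ Hp from hy))).hasDerivAt
  exact (h.comp x (hasDerivAt_mk_x x y)).congr_deriv (by simp)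

lemma hasDerivAt_y {g : ℂ → ℂ} (hg : DifferentiableOn ℂ g Hp) {x y : ℝ} (hy : 0 < y) :
    HasDerivAt (fun y : ℝ => g ⟨x, y⟩) (deriv g ⟨x, y⟩ * Complex.I) y := by
  have h := (hg.differentiableAt (isOpen_Hp.mem_nhds (show (⟨x, y⟩ : ℂ) ∈ Hp from hy))).hasDerivAt
  exact (h.comp y (hasDerivAt_mk_y x y)).congr_deriv (by simp)

lemma hasDerivAt_re_x {g : ℂ → ℂ} (hg : DifferentiableOn ℂ g Hp) {x y : ℝ} (hy : 0 < y) :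
    HasDerivAt (fun x : ℝ => (g ⟨x, y⟩).re) (deriv g ⟨x, y⟩).re x :=
  Complex.reCLM.hasFDerivAt.comp_hasDerivAt x (hasDerivAt_x hg hy)

lemma hasDerivAt_im_x {g : ℂ → ℂ} (hg : DifferentiableOn ℂ g Hp) {x y : ℝ} (hy : 0 < y) :
    HasDerivAt (fun x : ℝ => (g ⟨x, y⟩).im) (deriv g ⟨x, y⟩).im x :=
  Complex.imCLM.hasFDerivAt.comp_hasDerivAt x (hasDerivAt_x hg hy)

lemma hasDerivAt_re_y {g : ℂ → ℂ} (hg : DifferentiableOn ℂ g Hp) {x y : ℝ} (hy : 0 < y) :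
    HasDerivAt (fun y : ℝ => (g ⟨x, y⟩).re) (-(deriv g ⟨x, y⟩).im) y := by
  have := Complex.reCLM.hasFDerivAt.comp_hasDerivAt y (hasDerivAt_y (x := x) hg hy)
  simpa [Function.comp_def] using this

lemma hasDerivAt_im_y {g : ℂ → ℂ} (hg : DifferentiableOn ℂ g Hp) {x y : ℝ} (hy : 0 < y) :
    HasDerivAt (fun y : ℝ => (g ⟨x, y⟩).im) ((deriv g ⟨x, y⟩).re) y := by
  have := Complex.imCLM.hasFDerivAt.comp_hasDerivAt y (hasDerivAt_y (x := x) hg hy)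
  simpa [Function.comp_def] using this

/-- The Bellman function, and its first and second derivatives along a curve. -/
noncomputable def U0 (s t L h v : ℝ) : ℝ := h ^ 2 * v ^ s + L * v ^ t
noncomputable def U1 (s t L h v h1 v1 : ℝ) : ℝ :=
  2 * h * h1 * v ^ s + h ^ 2 * (s * v ^ (s - 1) * v1) + L * (t * v ^ (t - 1) * v1)
noncomputable def U2 (s t L h v h1 v1 h2 v2 : ℝ) : ℝ :=
  (2 * h1 ^ 2 * v ^ s + 4 * s * h * h1 * v ^ (s - 1) * v1 + h ^ 2 * (s * (s - 1) * v ^ (s - 2) * v1 ^ 2)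
    + L * (t * (t - 1) * v ^ (t - 2) * v1 ^ 2))
  + (2 * h * v ^ s * h2 + (h ^ 2 * (s * v ^ (s - 1)) + L * (t * v ^ (t - 1))) * v2)

lemma hasDerivAt_U0 {s t L : ℝ} {h v : ℝ → ℝ} {h1 v1 x : ℝ} (hh : HasDerivAt h h1 x)
    (hv : HasDerivAt v v1 x) (hp : 0 < v x) :
    HasDerivAt (fun x => U0 s t L (h x) (v x)) (U1 s t L (h x) (v x) h1 v1) x := by
  have a := ((hh.pow 2).mul (hv.rpow_const (p := s) (Or.inl hp.ne'))).add
    ((hv.rpow_const (p := t) (Or.inl hp.ne')).const_mul L)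
  refine a.congr_deriv ?_
  simp only [U1]
  simp
  ring

lemma hasDerivAt_U1 {s t L : ℝ} {h v h1 v1 : ℝ → ℝ} {h2 v2 x : ℝ} (hh : HasDerivAt h (h1 x) x)
    (hv : HasDerivAt v (v1 x) x) (hh1 : HasDerivAt h1 h2 x)
    (hv1 : HasDerivAt v1 v2 x) (hp : 0 < v x) :
    HasDerivAt (fun x => U1 s t L (h x) (v x) (h1 x) (v1 x))
      (U2 s t L (h x) (v x) (h1 x) (v1 x) h2 v2) x := by
  have vs := hv.rpow_const (p := s) (Or.inl hp.ne')
  have vs1 := hv.rpow_const (p := s - 1) (Or.inl hp.ne')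
  have vt1 := hv.rpow_const (p := t - 1) (Or.inl hp.ne')
  have a := ((((hh.const_mul 2).mul hh1).mul vs).add ((hh.pow 2).mul ((vs1.const_mul s).mul hv1))).add
    (((vt1.const_mul t).mul hv1).const_mul L)
  refine a.congr_deriv ?_
  simp only [U2]
  have e1 : s - 2 = s - 1 - 1 := by ring
  have e2 : t - 2 = t - 1 - 1 := by ring
  rw [e1, e2]
  simp
  ring

lemma U_bounds (s t L : ℝ) (e : ℕ) (hst : t = s + 2 * e) (b : ℝ) (hb : 0 ≤ b) :
    ∃ C, 0 ≤ C ∧ ∀ h v h1 v1 h2 v2 : ℝ, 0 < v → |h| ≤ b * v ^ e → |h1| ≤ b * v ^ e →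
      |h2| ≤ b * v ^ e → |v1| ≤ b * v → |v2| ≤ b * v →
      |U0 s t L h v| ≤ C * v ^ t ∧ |U1 s t L h v h1 v1| ≤ C * v ^ t ∧
      |U2 s t L h v h1 v1 h2 v2| ≤ C * v ^ t := by
  refine ⟨(b^2+|L|) + (2*b*b+b^2*(|s| * b)+|L| * (|t| * b)) + ((2*b^2+4*|s| * b*b*b+b^2*(|s| * |s-1| * b^2)
    +|L| * (|t| * |t-1| * b^2)) + (2*b*b+(b^2*|s|+|L| * |t|)*b)), by positivity, ?_⟩
  intro h v h1 v1 h2 v2 hv hh hh1 hh2 hv1 hv2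
  have hve : 0 < v ^ e := by positivity
  have hvt : 0 < v ^ t := by positivity
  have hat : ∀ k, |k| ≤ b * v ^ e → ∃ α, |α| ≤ b ∧ k = α * v ^ e := by
    intro k hk
    refine ⟨k / v ^ e, ?_, by field_simp⟩
    rw [abs_div, abs_of_pos hve, div_le_iff₀ hve]; exact hk
  have hat' : ∀ k, |k| ≤ b * v → ∃ α, |α| ≤ b ∧ k = α * v := by
    intro k hk
    refine ⟨k / v, ?_, by field_simp⟩
    rw [abs_div, abs_of_pos hv, div_le_iff₀ hv]; exact hk
  obtain ⟨α, hα, rfl⟩ := hat h hh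
  obtain ⟨α1, hα1, rfl⟩ := hat h1 hh1
  obtain ⟨α2, hα2, rfl⟩ := hat h2 hh2
  obtain ⟨β1, hβ1, rfl⟩ := hat' v1 hv1
  obtain ⟨β2, hβ2, rfl⟩ := hat' v2 hv2
  have E : v ^ t = v ^ s * (v ^ e) ^ 2 := by
    rw [hst, Real.rpow_add hv, ← pow_mul]
    congr 1
    rw [← Real.rpow_natCast]; congr 1; push_cast; ring
  have Es1 : v ^ (s - 1) = v ^ s / v := Real.rpow_sub_one hv.ne' s
  have Et1 : v ^ (t - 1) = v ^ t / v := Real.rpow_sub_one hv.ne' t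
  have Es2 : v ^ (s - 2) = v ^ s / v ^ 2 := by
    rw [Real.rpow_sub hv]; norm_num
  have Et2 : v ^ (t - 2) = v ^ t / v ^ 2 := by
    rw [Real.rpow_sub hv]; norm_num
  have u0 : U0 s t L (α * v ^ e) v = (α^2+L) * v ^ t := by
    simp only [U0]; rw [E]; ring
  have u1 : U1 s t L (α * v ^ e) v (α1 * v ^ e) (β1 * v)
      = (2*α*α1+α^2*(s*β1)+L*(t*β1)) * v ^ t := by
    simp only [U1, Es1, Et1]; rw [E]; field_simp
  have u2 : U2 s t L (α * v ^ e) v (α1 * v ^ e) (β1 * v) (α2 * v ^ e) (β2 * v)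
      = ((2*α1^2+4*s*α*α1*β1+α^2*(s*(s-1)*β1^2)
    +L*(t*(t-1)*β1^2)) + (2*α*α2+(α^2*s+L*t)*β2)) * v ^ t := by
    simp only [U2, Es1, Et1, Es2, Et2]; rw [E]; field_simp
  have n0 : |α^2+L| ≤ b^2+|L| := by
    refine (abs_add_le _ _).trans ?_
    rw [abs_pow]; gcongr
  have n1 : |2*α*α1+α^2*(s*β1)+L*(t*β1)| ≤ 2*b*b+b^2*(|s| * b)+|L| * (|t| * b) := by
    refine (abs_add_three _ _ _).trans ?_
    simp only [abs_mul, abs_pow, abs_two]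
    gcongr
  have n2 : |(2*α1^2+4*s*α*α1*β1+α^2*(s*(s-1)*β1^2)
    +L*(t*(t-1)*β1^2)) + (2*α*α2+(α^2*s+L*t)*β2)| ≤ ((2*b^2+4*|s| * b*b*b+b^2*(|s| * |s-1| * b^2)
    +|L| * (|t| * |t-1| * b^2)) + (2*b*b+(b^2*|s|+|L| * |t|)*b)) := by
    refine (abs_add_le _ _).trans ?_
    apply add_le_add
    · refine (abs_add_le _ _).trans ?_
      refine (add_le_add (abs_add_three _ _ _) le_rfl).trans ?_
      have h4 : |(4:ℝ)| = 4 := by norm_num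
      simp only [abs_mul, abs_pow, abs_two, h4]
      gcongr
    · refine (abs_add_le _ _).trans ?_
      rw [abs_mul (α^2*s+L*t)]
      have : |α^2*s+L*t| ≤ b^2*|s|+|L| * |t| := by
        refine (abs_add_le _ _).trans ?_
        simp only [abs_mul, abs_pow]
        gcongr
      simp only [abs_mul, abs_two]
      gcongr
  have p0 : 0 ≤ b^2+|L| := by positivity
  have p1 : 0 ≤ 2*b*b+b^2*(|s| * b)+|L| * (|t| * b) := by positivity
  have p2 : 0 ≤ ((2*b^2+4*|s| * b*b*b+b^2*(|s| * |s-1| * b^2)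
    +|L| * (|t| * |t-1| * b^2)) + (2*b*b+(b^2*|s|+|L| * |t|)*b)) := by positivity
  rw [u0, u1, u2]
  simp only [abs_mul, abs_of_pos hvt]
  refine ⟨?_, ?_, ?_⟩ <;> refine mul_le_mul_of_nonneg_right ?_ hvt.le <;> linarith

lemma U2_lower (s t : ℝ) (e : ℕ) (hst : t = s + 2 * e) (ht : 1 < t) (B : ℝ) (h v h1 v1 : ℝ)
    (hv : 0 < v) (hh : |h| ≤ B * v ^ e) :
    v ^ s * h1 ^ 2 ≤ U2 s t ((4 * s ^ 2 + |s * (s - 1)|) / (t * (t - 1)) * B ^ 2) h v h1 v1 0 0 := by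
  have hve : 0 < v ^ e := by positivity
  have E : v ^ t = v ^ s * (v ^ e) ^ 2 := by
    rw [hst, Real.rpow_add hv, ← pow_mul]
    congr 1
    rw [← Real.rpow_natCast]; congr 1; push_cast; ring
  have Es1 : v ^ (s - 1) = v ^ s / v := Real.rpow_sub_one hv.ne' s
  have Es2 : v ^ (s - 2) = v ^ s / v ^ 2 := by
    rw [Real.rpow_sub hv]; norm_num
  have Et2 : v ^ (t - 2) = v ^ t / v ^ 2 := by
    rw [Real.rpow_sub hv]; norm_num
  have hvs : 0 < v ^ s := by positivity
  have ht1 : 0 < t - 1 := by linarith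
  have ht0 : 0 < t := by linarith
  set β := v1 / v with hβ
  have hv1 : v1 = β * v := by rw [hβ]; field_simp
  have eq : U2 s t ((4 * s ^ 2 + |s * (s - 1)|) / (t * (t - 1)) * B ^ 2) h v h1 v1 0 0
     = v ^ s * (2 * h1 ^ 2 + 4 * s * h1 * (h * β) + s * (s - 1) * (h * β) ^ 2
       + (4 * s ^ 2 + |s * (s - 1)|) * (B * v ^ e * β) ^ 2) := by
    simp only [U2, Es1, Es2, Et2]; rw [E, hv1]; field_simp; ring
  rw [eq]
  refine mul_le_mul_of_nonneg_left ?_ hvs.le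
  have k1 : (h * β) ^ 2 ≤ (B * v ^ e * β) ^ 2 := by
    rw [mul_pow, mul_pow _ β]
    have : h ^ 2 ≤ (B * v ^ e) ^ 2 := sq_le_sq' (by linarith [abs_le.1 hh]) (abs_le.1 hh).2
    gcongr
  have k2 : -(|s * (s - 1)| * (h * β) ^ 2) ≤ s * (s - 1) * (h * β) ^ 2 := by
    have := neg_abs_le (s * (s-1))
    nlinarith [sq_nonneg (h * β)]
  have k3 : (4 * s ^ 2 + |s * (s - 1)|) * (h * β) ^ 2 ≤ (4 * s ^ 2 + |s * (s - 1)|) * (B * v ^ e * β) ^ 2 := by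
    gcongr
  nlinarith [sq_nonneg (h1 + 2 * s * (h * β))]

lemma U2_split (s t L h v h1 v1 h2 v2 : ℝ) :
    U2 s t L h v h1 v1 h2 v2 = U2 s t L h v h1 v1 0 0 +
     (2 * h * v ^ s * h2 + (h ^ 2 * (s * v ^ (s - 1)) + L * (t * v ^ (t - 1))) * v2) := by
  simp only [U2]; ring
end CC

namespace CC
open Set Filter Topology
open scoped ENNReal

lemma mem_Hp_mk {x y : ℝ} (hy : 0 < y) : (⟨x, y⟩ : ℂ) ∈ Hp := hy

lemma continuous_U2 {X : Type*} [TopologicalSpace X] {s t L : ℝ} {h v h1 v1 h2 v2 : X → ℝ}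
    (hh : Continuous h) (hv : Continuous v) (hh1 : Continuous h1) (hv1 : Continuous v1)
    (hh2 : Continuous h2) (hv2 : Continuous v2) (hp : ∀ x, 0 < v x) :
    Continuous fun x => U2 s t L (h x) (v x) (h1 x) (v1 x) (h2 x) (v2 x) := by
  have hr : ∀ r : ℝ, Continuous fun x => v x ^ r := fun r =>
    hv.rpow_const (fun x => Or.inl (hp x).ne')
  have a1 := hr s
  have a2 := hr (s - 1)
  have a3 := hr (s - 2)
  have a4 := hr (t - 1)
  have a5 := hr (t - 2)
  simp only [U2]
  fun_prop

lemma continuous_U1 {X : Type*} [TopologicalSpace X] {s t L : ℝ} {h v h1 v1 : X → ℝ}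
    (hh : Continuous h) (hv : Continuous v) (hh1 : Continuous h1) (hv1 : Continuous v1)
    (hp : ∀ x, 0 < v x) :
    Continuous fun x => U1 s t L (h x) (v x) (h1 x) (v1 x) := by
  have hr : ∀ r : ℝ, Continuous fun x => v x ^ r := fun r =>
    hv.rpow_const (fun x => Or.inl (hp x).ne')
  have a1 := hr s
  have a2 := hr (s - 1)
  have a4 := hr (t - 1)
  simp only [U1]
  fun_prop

lemma continuous_U0 {X : Type*} [TopologicalSpace X] {s t L : ℝ} {h v : X → ℝ}
    (hh : Continuous h) (hv : Continuous v)
    (hp : ∀ x, 0 < v x) :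
    Continuous fun x => U0 s t L (h x) (v x) := by
  have hr : ∀ r : ℝ, Continuous fun x => v x ^ r := fun r =>
    hv.rpow_const (fun x => Or.inl (hp x).ne')
  have a1 := hr s
  have a4 := hr t
  simp only [U0]
  fun_prop

lemma continuous_line {g : ℂ → ℂ} (hg : DifferentiableOn ℂ g Hp) {y : ℝ} (hy : 0 < y) :
    Continuous (fun x : ℝ => g ⟨x, y⟩) :=
  continuous_iff_continuousAt.2 fun _ => (hasDerivAt_x hg hy).continuousAt

lemma Good.green_bounds {c : ℝ} {Q : ℂ → ℂ} (hQ : Good c Q) {f : ℂ → ℂ}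
    (hf : DifferentiableOn ℂ f Hp) (s t L : ℝ) (e : ℕ) (hst : t = s + 2 * e) (ht : 0 ≤ t) {B : ℝ}
    (hB : 0 ≤ B)
    (h0 : ∀ z ∈ Hp, |(f z).re| ≤ B * ‖Q z‖ ^ e)
    (h1 : ∀ z ∈ Hp, ‖deriv f z‖ ≤ B * ‖Q z‖ ^ e / z.im) {y0 : ℝ} (hy0 : 0 < y0) :
    ∃ C, 0 ≤ C ∧ ∀ z : ℂ, |z.im - y0| ≤ y0 / 2 → ∀ a1 b1 a2 b2 : ℝ, |a1| ≤ ‖deriv f z‖ →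
      |b1| ≤ ‖deriv Q z‖ → |a2| ≤ ‖deriv (deriv f) z‖ → |b2| ≤ ‖deriv (deriv Q) z‖ →
      |U0 s t L (f z).re (Q z).re| ≤ C * (Q ⟨z.re, y0⟩).re ^ t ∧
      |U1 s t L (f z).re (Q z).re a1 b1| ≤ C * (Q ⟨z.re, y0⟩).re ^ t ∧
      |U2 s t L (f z).re (Q z).re a1 b1 a2 b2| ≤ C * (Q ⟨z.re, y0⟩).re ^ t := by
  have hc := hQ.c_nonneg
  have hdf : DifferentiableOn ℂ (deriv f) Hp := hf.deriv isOpen_Hp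
  have hdQ : DifferentiableOn ℂ (deriv Q) Hp := hQ.diff.deriv isOpen_Hp
  have h2 : ∀ z ∈ Hp, _ := fun z hz => hQ.cauchy hdf e 1 (B := B) (fun w hw => by simpa using h1 w hw) hz
  have h3 : ∀ z ∈ Hp, _ := fun z hz => hQ.cauchy hdQ 1 1 (B := c) (fun w hw => by simpa using hQ.der w hw) hz
  set K1 := 2 * Real.exp c ^ e * 2 ^ 1 * B with hK1
  set K2 := 2 * Real.exp c ^ 1 * 2 ^ 1 * c with hK2
  have hK1' : 0 ≤ K1 := by positivity
  have hK2' : 0 ≤ K2 := by positivity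
  set b := B * 2 ^ e + B * 2 ^ e / (y0/2) + K1 * 2 ^ e / (y0/2)^2 + c * 2 / (y0/2) + K2 * 2 / (y0/2)^2 with hb
  obtain ⟨C, hC, hCb⟩ := U_bounds s t L e hst b (by positivity)
  refine ⟨C * (2 * Real.exp c) ^ t, by positivity, ?_⟩
  intro z hz a1 b1 a2 b2 ha1 hb1 ha2 hb2
  have hzi := abs_le.1 hz
  have hy : y0 / 2 ≤ z.im := by linarith
  have hzH : z ∈ Hp := by rw [mem_Hp]; linarith
  have hv := hQ.pos z hzH
  have hle := hQ.le z hzH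
  have hve : ‖Q z‖ ^ e ≤ 2 ^ e * (Q z).re ^ e := by
    rw [← mul_pow]; gcongr
  have q0 : |(f z).re| ≤ b * (Q z).re ^ e := by
    calc _ ≤ B * ‖Q z‖ ^ e := h0 z hzH
      _ ≤ B * (2 ^ e * (Q z).re ^ e) := by gcongr
      _ = (B * 2 ^ e) * (Q z).re ^ e := by ring
      _ ≤ _ := by
        gcongr; rw [hb]
        have : 0 ≤ B * 2 ^ e / (y0/2) + K1 * 2 ^ e / (y0/2)^2 + c * 2 / (y0/2) + K2 * 2 / (y0/2)^2 := by positivity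
        linarith
  have q1 : |a1| ≤ b * (Q z).re ^ e := by
    calc _ ≤ B * ‖Q z‖ ^ e / z.im := ha1.trans (h1 z hzH)
      _ ≤ B * (2 ^ e * (Q z).re ^ e) / (y0/2) := by gcongr
      _ = (B * 2 ^ e / (y0/2)) * (Q z).re ^ e := by ring
      _ ≤ _ := by
        gcongr; rw [hb]
        have : 0 ≤ B * 2 ^ e + K1 * 2 ^ e / (y0/2)^2 + c * 2 / (y0/2) + K2 * 2 / (y0/2)^2 := by positivity
        linarith
  have q2 : |a2| ≤ b * (Q z).re ^ e := by
    calc _ ≤ K1 * ‖Q z‖ ^ e / z.im ^ 2 := ha2.trans (h2 z hzH)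
      _ ≤ K1 * (2 ^ e * (Q z).re ^ e) / (y0/2) ^ 2 := by gcongr
      _ = (K1 * 2 ^ e / (y0/2) ^ 2) * (Q z).re ^ e := by ring
      _ ≤ _ := by
        gcongr; rw [hb]
        have : 0 ≤ B * 2 ^ e + B * 2 ^ e / (y0/2) + c * 2 / (y0/2) + K2 * 2 / (y0/2)^2 := by positivity
        linarith
  have r1 : |b1| ≤ b * (Q z).re := by
    calc _ ≤ c * ‖Q z‖ / z.im := hb1.trans (hQ.der z hzH)
      _ ≤ c * (2 * (Q z).re) / (y0/2) := by gcongr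
      _ = (c * 2 / (y0/2)) * (Q z).re := by ring
      _ ≤ _ := by
        gcongr; rw [hb]
        have : 0 ≤ B * 2 ^ e + B * 2 ^ e / (y0/2) + K1 * 2 ^ e / (y0/2)^2 + K2 * 2 / (y0/2)^2 := by positivity
        linarith
  have r2 : |b2| ≤ b * (Q z).re := by
    calc _ ≤ K2 * ‖Q z‖ ^ 1 / z.im ^ 2 := hb2.trans (h3 z hzH)
      _ ≤ K2 * (2 * (Q z).re) / (y0/2) ^ 2 := by rw [pow_one]; gcongr
      _ = (K2 * 2 / (y0/2) ^ 2) * (Q z).re := by ring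
      _ ≤ _ := by
        gcongr; rw [hb]
        have : 0 ≤ B * 2 ^ e + B * 2 ^ e / (y0/2) + K1 * 2 ^ e / (y0/2)^2 + c * 2 / (y0/2) := by positivity
        linarith
  have hw : (⟨z.re, y0⟩ : ℂ) ∈ Hp := hy0
  have hH := (hQ.harnack hw (w := z) (by
    have : z - ⟨z.re, y0⟩ = ((z.im - y0 : ℝ) : ℂ) * Complex.I := by
      apply Complex.ext <;> simp
    rw [this, norm_mul, Complex.norm_I, mul_one, Complex.norm_real]; exact hz)).1
  have hvt : (Q z).re ^ t ≤ (2 * Real.exp c) ^ t * (Q ⟨z.re, y0⟩).re ^ t := by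
    have hp2 := hQ.pos _ hw
    rw [← Real.mul_rpow (by positivity) hp2.le]
    apply Real.rpow_le_rpow hv.le _ ht
    have := hQ.le _ hw
    have e1 := Complex.re_le_norm (Q z)
    have : Real.exp c * ‖Q ⟨z.re, y0⟩‖ ≤ Real.exp c * (2 * (Q ⟨z.re, y0⟩).re) := by gcongr
    linarith
  obtain ⟨u0, u1, u2⟩ := hCb _ _ _ _ _ _ hv q0 q1 q2 r1 r2
  have : C * (Q z).re ^ t ≤ C * (2 * Real.exp c) ^ t * (Q ⟨z.re, y0⟩).re ^ t := by
    rw [mul_assoc]; gcongr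
  exact ⟨u0.trans this, u1.trans this, u2.trans this⟩

theorem Good.green {c : ℝ} {Q : ℂ → ℂ} (hQ : Good c Q) {f : ℂ → ℂ}
    (hf : DifferentiableOn ℂ f Hp) (s t : ℝ) (e : ℕ) (hst : t = s + 2 * e) (ht : 1 < t) {B : ℝ}
    (hB : 0 ≤ B)
    (h0 : ∀ z ∈ Hp, |(f z).re| ≤ B * ‖Q z‖ ^ e)
    (h1 : ∀ z ∈ Hp, ‖deriv f z‖ ≤ B * ‖Q z‖ ^ e / z.im) {M0 : ℝ}
    (hi : ∀ y > 0, Integrable (fun x : ℝ => (Q ⟨x, y⟩).re ^ t))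
    (hM : ∀ y > 0, ∫ x : ℝ, (Q ⟨x, y⟩).re ^ t ≤ M0) :
    ∫⁻ y in Ioi (0:ℝ), ∫⁻ x : ℝ, ENNReal.ofReal (y * (‖deriv f ⟨x, y⟩‖ ^ 2 * (Q ⟨x, y⟩).re ^ s))
      ≤ ENNReal.ofReal (3 * (4 ^ e * (1 + (4 * s ^ 2 + |s * (s - 1)|) / (t * (t - 1))) * B ^ 2 * M0)) := by
  set K := (4 * s ^ 2 + |s * (s - 1)|) / (t * (t - 1)) with hK
  have ht1 : 0 < t - 1 := by linarith
  have ht0 : 0 < t := by linarith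
  have hK0 : 0 ≤ K := by positivity
  set B' := 2 ^ e * B with hB'
  set L := K * B' ^ 2 with hL
  have hdf : DifferentiableOn ℂ (deriv f) Hp := hf.deriv isOpen_Hp
  have hdQ : DifferentiableOn ℂ (deriv Q) Hp := hQ.diff.deriv isOpen_Hp
  have hddf : DifferentiableOn ℂ (deriv (deriv f)) Hp := hdf.deriv isOpen_Hp
  have hddQ : DifferentiableOn ℂ (deriv (deriv Q)) Hp := hdQ.deriv isOpen_Hp
  have hh : ∀ z ∈ Hp, |(f z).re| ≤ B' * (Q z).re ^ e := by
    intro z hz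
    refine (h0 z hz).trans ?_
    have := hQ.le z hz
    have hve : ‖Q z‖ ^ e ≤ 2 ^ e * (Q z).re ^ e := by rw [← mul_pow]; gcongr
    calc B * ‖Q z‖ ^ e ≤ B * (2 ^ e * (Q z).re ^ e) := by gcongr
      _ = _ := by rw [hB']; ring
  let W0 : ℂ → ℝ := fun z => U0 s t L (f z).re (Q z).re
  let W1x : ℂ → ℝ := fun z => U1 s t L (f z).re (Q z).re (deriv f z).re (deriv Q z).re
  let W1y : ℂ → ℝ := fun z => U1 s t L (f z).re (Q z).re (-(deriv f z).im) (-(deriv Q z).im)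
  let W2x : ℂ → ℝ := fun z => U2 s t L (f z).re (Q z).re (deriv f z).re (deriv Q z).re
    (deriv (deriv f) z).re (deriv (deriv Q) z).re
  let W2y : ℂ → ℝ := fun z => U2 s t L (f z).re (Q z).re (-(deriv f z).im) (-(deriv Q z).im)
    (-(deriv (deriv f) z).re) (-(deriv (deriv Q) z).re)
  have lre : ∀ {g : ℂ → ℂ}, DifferentiableOn ℂ g Hp → ∀ {y : ℝ}, 0 < y →
      Continuous (fun x : ℝ => (g ⟨x, y⟩).re) := fun hg _ hy => Complex.continuous_re.comp (continuous_line hg hy)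
  have lim : ∀ {g : ℂ → ℂ}, DifferentiableOn ℂ g Hp → ∀ {y : ℝ}, 0 < y →
      Continuous (fun x : ℝ => (g ⟨x, y⟩).im) := fun hg _ hy => Complex.continuous_im.comp (continuous_line hg hy)
  have pQ : ∀ {y : ℝ}, 0 < y → ∀ x : ℝ, 0 < (Q ⟨x, y⟩).re := fun hy x => hQ.pos _ (mem_Hp_mk hy)
  have c0 : ∀ {y : ℝ}, 0 < y → Continuous (fun x : ℝ => W0 ⟨x, y⟩) := fun hy =>
    continuous_U0 (lre hf hy) (lre hQ.diff hy) (pQ hy)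
  have c1x : ∀ {y : ℝ}, 0 < y → Continuous (fun x : ℝ => W1x ⟨x, y⟩) := fun hy =>
    continuous_U1 (lre hf hy) (lre hQ.diff hy) (lre hdf hy) (lre hdQ hy) (pQ hy)
  have c1y : ∀ {y : ℝ}, 0 < y → Continuous (fun x : ℝ => W1y ⟨x, y⟩) := fun hy =>
    continuous_U1 (lre hf hy) (lre hQ.diff hy) (lim hdf hy).neg (lim hdQ hy).neg (pQ hy)
  have c2x : ∀ {y : ℝ}, 0 < y → Continuous (fun x : ℝ => W2x ⟨x, y⟩) := fun hy =>
    continuous_U2 (lre hf hy) (lre hQ.diff hy) (lre hdf hy) (lre hdQ hy) (lre hddf hy) (lre hddQ hy) (pQ hy)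
  have c2y : ∀ {y : ℝ}, 0 < y → Continuous (fun x : ℝ => W2y ⟨x, y⟩) := fun hy =>
    continuous_U2 (lre hf hy) (lre hQ.diff hy) (lim hdf hy).neg (lim hdQ hy).neg (lre hddf hy).neg
      (lre hddQ hy).neg (pQ hy)
  have are : ∀ z : ℂ, |z.re| ≤ ‖z‖ := Complex.abs_re_le_norm
  have aim : ∀ z : ℂ, |-z.im| ≤ ‖z‖ := fun z => by rw [abs_neg]; exact Complex.abs_im_le_norm z
  have anre : ∀ z : ℂ, |-z.re| ≤ ‖z‖ := fun z => by rw [abs_neg]; exact Complex.abs_re_le_norm z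
  have bnd : ∀ {y0 : ℝ}, 0 < y0 → ∃ C, 0 ≤ C ∧ ∀ x y : ℝ, |y - y0| ≤ y0 / 2 →
      |W0 ⟨x, y⟩| ≤ C * (Q ⟨x, y0⟩).re ^ t ∧ |W1x ⟨x, y⟩| ≤ C * (Q ⟨x, y0⟩).re ^ t ∧
      |W1y ⟨x, y⟩| ≤ C * (Q ⟨x, y0⟩).re ^ t ∧ |W2x ⟨x, y⟩| ≤ C * (Q ⟨x, y0⟩).re ^ t ∧
      |W2y ⟨x, y⟩| ≤ C * (Q ⟨x, y0⟩).re ^ t := by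
    intro y0 hy0
    obtain ⟨C, hC, h⟩ := hQ.green_bounds hf s t L e hst ht0.le hB h0 h1 hy0
    refine ⟨C, hC, fun x y hy => ?_⟩
    have hx := h ⟨x, y⟩ hy _ _ _ _ (are _) (are _) (are _) (are _)
    have hy' := h ⟨x, y⟩ hy _ _ _ _ (aim _) (aim _) (anre _) (anre _)
    exact ⟨hx.1, hx.2.1, hy'.2.1, hx.2.2, hy'.2.2⟩
  have intg : ∀ (W : ℂ → ℝ) {y : ℝ} (_ : 0 < y) (_ : Continuous (fun x : ℝ => W ⟨x, y⟩)) {C : ℝ},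
      (∀ x, |W ⟨x, y⟩| ≤ C * (Q ⟨x, y⟩).re ^ t) → Integrable (fun x : ℝ => W ⟨x, y⟩) := by
    intro W y hy hc C hC
    refine ((hi y hy).const_mul C).mono' hc.aestronglyMeasurable (Eventually.of_forall fun x => ?_)
    simpa using hC x
  have self : ∀ {y : ℝ}, 0 < y → |y - y| ≤ y / 2 := fun hy => by simp; linarith
  have i0 : ∀ {y : ℝ}, 0 < y → Integrable (fun x : ℝ => W0 ⟨x, y⟩) := fun {y} hy => by
    obtain ⟨C, _, h⟩ := bnd hy
    exact intg W0 hy (c0 hy) fun x => (h x y (self hy)).1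
  have i1x : ∀ {y : ℝ}, 0 < y → Integrable (fun x : ℝ => W1x ⟨x, y⟩) := fun {y} hy => by
    obtain ⟨C, _, h⟩ := bnd hy
    exact intg W1x hy (c1x hy) fun x => (h x y (self hy)).2.1
  have i1y : ∀ {y : ℝ}, 0 < y → Integrable (fun x : ℝ => W1y ⟨x, y⟩) := fun {y} hy => by
    obtain ⟨C, _, h⟩ := bnd hy
    exact intg W1y hy (c1y hy) fun x => (h x y (self hy)).2.2.1
  have i2x : ∀ {y : ℝ}, 0 < y → Integrable (fun x : ℝ => W2x ⟨x, y⟩) := fun {y} hy => by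
    obtain ⟨C, _, h⟩ := bnd hy
    exact intg W2x hy (c2x hy) fun x => (h x y (self hy)).2.2.2.1
  have i2y : ∀ {y : ℝ}, 0 < y → Integrable (fun x : ℝ => W2y ⟨x, y⟩) := fun {y} hy => by
    obtain ⟨C, _, h⟩ := bnd hy
    exact intg W2y hy (c2y hy) fun x => (h x y (self hy)).2.2.2.2
  have posY : ∀ {y0 y : ℝ}, 0 < y0 → y ∈ Metric.ball y0 (y0/2) → 0 < y ∧ |y - y0| ≤ y0 / 2 := by
    intro y0 y hy0 hy
    rw [Metric.mem_ball, Real.dist_eq] at hy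
    have := abs_lt.1 hy
    exact ⟨by linarith, hy.le⟩
  have dW0 : ∀ {x y : ℝ}, 0 < y → HasDerivAt (fun y : ℝ => W0 ⟨x, y⟩) (W1y ⟨x, y⟩) y := fun {x y} hy =>
    hasDerivAt_U0 (h := fun y => (f ⟨x, y⟩).re) (v := fun y => (Q ⟨x, y⟩).re)
      (hasDerivAt_re_y hf hy) (hasDerivAt_re_y hQ.diff hy) (pQ hy x)
  have dW1y : ∀ {x y : ℝ}, 0 < y → HasDerivAt (fun y : ℝ => W1y ⟨x, y⟩) (W2y ⟨x, y⟩) y := fun {x y} hy =>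
    hasDerivAt_U1 (h := fun y => (f ⟨x, y⟩).re) (v := fun y => (Q ⟨x, y⟩).re)
      (h1 := fun y => -(deriv f ⟨x, y⟩).im) (v1 := fun y => -(deriv Q ⟨x, y⟩).im)
      (hasDerivAt_re_y hf hy) (hasDerivAt_re_y hQ.diff hy) (hasDerivAt_im_y hdf hy).neg
      (hasDerivAt_im_y hdQ hy).neg (pQ hy x)
  have dW1x : ∀ {x y : ℝ}, 0 < y → HasDerivAt (fun x : ℝ => W1x ⟨x, y⟩) (W2x ⟨x, y⟩) x := fun {x y} hy =>
    hasDerivAt_U1 (h := fun x => (f ⟨x, y⟩).re) (v := fun x => (Q ⟨x, y⟩).re)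
      (h1 := fun x => (deriv f ⟨x, y⟩).re) (v1 := fun x => (deriv Q ⟨x, y⟩).re)
      (hasDerivAt_re_x hf hy) (hasDerivAt_re_x hQ.diff hy) (hasDerivAt_re_x hdf hy)
      (hasDerivAt_re_x hdQ hy) (pQ hy x)
  have z2x : ∀ {y : ℝ}, 0 < y → ∫ x : ℝ, W2x ⟨x, y⟩ = 0 := fun {y} hy =>
    integral_eq_zero_of_hasDerivAt_of_integrable (fun x => dW1x (x := x) hy) (i2x hy) (i1x hy)
  have dm : ∀ y > 0, HasDerivAt (fun y => ∫ x : ℝ, W0 ⟨x, y⟩) (∫ x : ℝ, W1y ⟨x, y⟩) y := by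
    intro y0 hy0
    obtain ⟨C, hC, h⟩ := bnd hy0
    exact (hasDerivAt_integral_of_dominated_loc_of_deriv_le (F := fun y x => W0 ⟨x, y⟩)
      (F' := fun y x => W1y ⟨x, y⟩)
      (bound := fun x => C * (Q ⟨x, y0⟩).re ^ t) (Metric.ball_mem_nhds y0 (half_pos hy0))
      (by filter_upwards [lt_mem_nhds hy0] with y hy using (c0 hy).aestronglyMeasurable) (i0 hy0)
      (c1y hy0).aestronglyMeasurable
      (Eventually.of_forall fun x y hy => (h x y (posY hy0 hy).2).2.2.1)
      ((hi y0 hy0).const_mul C)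
      (Eventually.of_forall fun x y hy => dW0 (posY hy0 hy).1)).2
  have dm1 : ∀ y > 0, HasDerivAt (fun y => ∫ x : ℝ, W1y ⟨x, y⟩) (∫ x : ℝ, (W2x ⟨x, y⟩ + W2y ⟨x, y⟩)) y := by
    intro y0 hy0
    obtain ⟨C, hC, h⟩ := bnd hy0
    rw [integral_add (i2x hy0) (i2y hy0), z2x hy0, zero_add]
    exact (hasDerivAt_integral_of_dominated_loc_of_deriv_le (F := fun y x => W1y ⟨x, y⟩)
      (F' := fun y x => W2y ⟨x, y⟩)
      (bound := fun x => C * (Q ⟨x, y0⟩).re ^ t) (Metric.ball_mem_nhds y0 (half_pos hy0))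
      (by filter_upwards [lt_mem_nhds hy0] with y hy using (c1y hy).aestronglyMeasurable) (i1y hy0)
      (c2y hy0).aestronglyMeasurable
      (Eventually.of_forall fun x y hy => (h x y (posY hy0 hy).2).2.2.2.2)
      ((hi y0 hy0).const_mul C)
      (Eventually.of_forall fun x y hy => dW1y (posY hy0 hy).1)).2
  have low : ∀ z ∈ Hp, ‖deriv f z‖ ^ 2 * (Q z).re ^ s ≤ W2x z + W2y z := by
    intro z hz
    have l1 := U2_lower s t e hst ht B' (f z).re (Q z).re (deriv f z).re (deriv Q z).re (hQ.pos z hz) (hh z hz)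
    have l2 := U2_lower s t e hst ht B' (f z).re (Q z).re (-(deriv f z).im) (-(deriv Q z).im) (hQ.pos z hz) (hh z hz)
    simp only [W2x, W2y]
    rw [U2_split, U2_split s t L _ _ (-(deriv f z).im)]
    have : ‖deriv f z‖ ^ 2 = (deriv f z).re ^ 2 + (deriv f z).im ^ 2 := by
      rw [← Complex.normSq_eq_norm_sq, Complex.normSq_apply]; ring
    rw [this]
    rw [← hK, ← hL] at l1 l2
    linarith
  have up : ∀ z ∈ Hp, 0 ≤ W0 z ∧ W0 z ≤ (1 + K) * B' ^ 2 * (Q z).re ^ t := by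
    intro z hz
    have hv := hQ.pos z hz
    have hL0 : 0 ≤ L := by positivity
    simp only [W0, U0]
    refine ⟨by positivity, ?_⟩
    have E : (Q z).re ^ t = (Q z).re ^ s * ((Q z).re ^ e) ^ 2 := by
      rw [hst, Real.rpow_add hv, ← pow_mul]
      congr 1
      rw [← Real.rpow_natCast]; congr 1; push_cast; ring
    have h2 : (f z).re ^ 2 ≤ (B' * (Q z).re ^ e) ^ 2 := by
      have := abs_le.1 (hh z hz)
      exact sq_le_sq' (by linarith) this.2
    have : (f z).re ^ 2 * (Q z).re ^ s ≤ (B' * (Q z).re ^ e) ^ 2 * (Q z).re ^ s := by gcongr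
    calc _ ≤ (B' * (Q z).re ^ e) ^ 2 * (Q z).re ^ s + L * (Q z).re ^ t := by linarith
      _ = _ := by rw [E, hL]; ring
  have fin := ode_bound (fun y => ∫ x : ℝ, W0 ⟨x, y⟩) (fun y => ∫ x : ℝ, W1y ⟨x, y⟩)
    (fun y => ∫ x : ℝ, (W2x ⟨x, y⟩ + W2y ⟨x, y⟩)) ((1 + K) * B' ^ 2 * M0)
    (fun y hy => integral_nonneg fun x => (up _ (mem_Hp_mk hy)).1)
    (fun y hy => by
      calc _ ≤ ∫ x : ℝ, (1 + K) * B' ^ 2 * (Q ⟨x, y⟩).re ^ t :=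
            integral_mono (i0 hy) ((hi y hy).const_mul _) fun x => (up _ (mem_Hp_mk hy)).2
        _ = (1 + K) * B' ^ 2 * ∫ x : ℝ, (Q ⟨x, y⟩).re ^ t := integral_const_mul _ _
        _ ≤ _ := by
          gcongr; exact hM y hy) dm dm1
    (fun y hy => integral_nonneg fun x => le_trans (by have := pQ hy x; positivity) (low _ (mem_Hp_mk hy)))
  have hfin : 3 * ((1 + K) * B' ^ 2 * M0) = 3 * (4 ^ e * (1 + K) * B ^ 2 * M0) := by
    have : (4:ℝ) ^ e = (2 ^ e) ^ 2 := by rw [← pow_mul, mul_comm e 2, pow_mul]; norm_num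
    rw [hB', this]; ring
  rw [hfin] at fin
  refine le_trans ?_ fin
  refine setLIntegral_mono' measurableSet_Ioi fun y hy => ?_
  have hy' : (0:ℝ) < y := hy
  rw [← integral_const_mul, ofReal_integral_eq_lintegral_ofReal]
  · refine lintegral_mono fun x => ENNReal.ofReal_le_ofReal ?_
    exact mul_le_mul_of_nonneg_left (low _ (mem_Hp_mk hy')) hy'.le
  · exact ((i2x hy').add (i2y hy')).const_mul y
  · refine Eventually.of_forall fun x => mul_nonneg hy'.le ?_
    exact le_trans (by have := pQ hy' x; positivity) (low _ (mem_Hp_mk hy'))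
end CC

namespace CC
open Set Filter Topology
open scoped ENNReal

lemma jensen (f w : ℝ → ℝ≥0∞) (hf : Measurable f) (hw : Measurable w) {p : ℝ} (hp : 1 < p) :
    (∫⁻ t, f t * w t) ^ p ≤ (∫⁻ t, w t) ^ (p - 1) * ∫⁻ t, f t ^ p * w t := by
  have hpq : p.HolderConjugate (p / (p - 1)) := Real.HolderConjugate.conjExponent hp
  have hp0 : 0 < p := by linarith
  have hp1 : 0 < p - 1 := by linarith
  set q := p / (p - 1) with hq
  have hq0 : 0 < q := by positivity
  have h := ENNReal.lintegral_mul_le_Lp_mul_Lq (volume : Measure ℝ) hpq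
    (f := fun t => f t * w t ^ (1 / p)) (g := fun t => w t ^ (1 / q))
    (by fun_prop) (by fun_prop)
  have e1 : ∀ t, f t * w t ^ (1 / p) * w t ^ (1 / q) = f t * w t := by
    intro t
    rw [mul_assoc, ← ENNReal.rpow_add_of_nonneg _ _ (by positivity) (by positivity)]
    have : 1 / p + 1 / q = 1 := by simpa using hpq.inv_add_inv_eq_one
    rw [this, ENNReal.rpow_one]
  have e2 : ∀ t, (f t * w t ^ (1 / p)) ^ p = f t ^ p * w t := by
    intro t
    rw [ENNReal.mul_rpow_of_nonneg _ _ hp0.le, ← ENNReal.rpow_mul, one_div_mul_cancel hp0.ne', ENNReal.rpow_one]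
  have e3 : ∀ t, (w t ^ (1 / q)) ^ q = w t := by
    intro t
    rw [← ENNReal.rpow_mul, one_div_mul_cancel hq0.ne', ENNReal.rpow_one]
  simp only [Pi.mul_apply, e1, e2, e3] at h
  calc _ ≤ ((∫⁻ t, f t ^ p * w t) ^ (1 / p) * (∫⁻ t, w t) ^ (1 / q)) ^ p := by gcongr
    _ = _ := by
      rw [ENNReal.mul_rpow_of_nonneg _ _ hp0.le, ← ENNReal.rpow_mul, one_div_mul_cancel hp0.ne', ENNReal.rpow_one,
        ← ENNReal.rpow_mul, mul_comm]
      congr 2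
      rw [hq]; field_simp

lemma young (f w : ℝ → ℝ≥0∞) (hf : Measurable f) (hw : Measurable w) {p : ℝ} (hp : 1 < p) :
    ∫⁻ x, (∫⁻ t, f t * w (x - t)) ^ p ≤ (∫⁻ t, w t) ^ p * ∫⁻ t, f t ^ p := by
  have hp1 : 0 < p - 1 := by linarith
  calc _ ≤ ∫⁻ x, (∫⁻ t, w t) ^ (p - 1) * ∫⁻ t, f t ^ p * w (x - t) := by
        refine lintegral_mono fun x => ?_
        refine (jensen f (fun t => w (x - t)) hf (by fun_prop) hp).trans ?_
        rw [lintegral_sub_left_eq_self w x]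
    _ = (∫⁻ t, w t) ^ (p - 1) * ∫⁻ x, ∫⁻ t, f t ^ p * w (x - t) := by
        rw [lintegral_const_mul]
        exact Measurable.lintegral_prod_right' (f := fun z : ℝ × ℝ => f z.2 ^ p * w (z.1 - z.2)) (by fun_prop)
    _ = (∫⁻ t, w t) ^ (p - 1) * ∫⁻ t, ∫⁻ x, f t ^ p * w (x - t) := by
        rw [lintegral_lintegral_swap]
        exact (show Measurable (fun z : ℝ × ℝ => f z.2 ^ p * w (z.1 - z.2)) by fun_prop).aemeasurable
    _ = (∫⁻ t, w t) ^ (p - 1) * ((∫⁻ t, w t) * ∫⁻ t, f t ^ p) := by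
        congr 1
        rw [← lintegral_const_mul _ (by fun_prop)]
        refine lintegral_congr fun t => ?_
        rw [lintegral_const_mul _ (by fun_prop), lintegral_sub_right_eq_self w t, mul_comm]
    _ = _ := by
        rw [← mul_assoc]
        congr 1
        nth_rw 2 [← ENNReal.rpow_one (∫⁻ t, w t)]
        rw [← ENNReal.rpow_add_of_nonneg _ _ hp1.le zero_le_one, sub_add_cancel]

noncomputable def CT (g : ℝ → ℂ) (z : ℂ) : ℂ := ∫ t : ℝ, g t / ((t : ℂ) - z)

lemma im_le_norm_sub (t : ℝ) (z : ℂ) : z.im ≤ ‖(t : ℂ) - z‖ := by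
  have := Complex.abs_im_le_norm ((t : ℂ) - z)
  simp at this
  exact (le_abs_self _).trans this

lemma sub_ne {t : ℝ} {z : ℂ} (hz : z ∈ Hp) : (t : ℂ) - z ≠ 0 := by
  intro h
  have h1 := im_le_norm_sub t z
  rw [h, norm_zero] at h1
  exact absurd hz (not_lt.2 h1)

lemma continuous_inv_sub {z : ℂ} (hz : z ∈ Hp) : Continuous fun t : ℝ => ((t : ℂ) - z)⁻¹ :=
  Continuous.inv₀ (by fun_prop) fun _ => sub_ne hz

lemma norm_inv_sub_le {t : ℝ} {z : ℂ} (hz : z ∈ Hp) : ‖((t : ℂ) - z)⁻¹‖ ≤ (z.im)⁻¹ := by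
  rw [norm_inv]
  exact inv_anti₀ hz (im_le_norm_sub t z)

lemma integrable_CT {g : ℝ → ℂ} (hg : Integrable g) {z : ℂ} (hz : z ∈ Hp) :
    Integrable fun t : ℝ => g t / ((t : ℂ) - z) := by
  simp only [div_eq_mul_inv]
  exact hg.mul_bdd (continuous_inv_sub hz).aestronglyMeasurable
    (Eventually.of_forall fun t => norm_inv_sub_le hz)

lemma integrable_CT2 {g : ℝ → ℂ} (hg : Integrable g) {z : ℂ} (hz : z ∈ Hp) :
    Integrable fun t : ℝ => g t / ((t : ℂ) - z) ^ 2 := by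
  have := integrable_CT (integrable_CT hg hz) hz
  refine this.congr (Eventually.of_forall fun t => ?_)
  simp only []
  rw [div_div, sq]

lemma hasDerivAt_CT {g : ℝ → ℂ} (hg : Integrable g) {z : ℂ} (hz : z ∈ Hp) :
    HasDerivAt (CT g) (∫ t : ℝ, g t / ((t : ℂ) - z) ^ 2) z := by
  have hz' : 0 < z.im := hz
  have hb : ∀ w ∈ Metric.ball z (z.im / 2), w ∈ Hp ∧ z.im / 2 ≤ w.im := by
    intro w hw
    rw [Metric.mem_ball, dist_eq_norm] at hw
    have := im_of_near hw.le
    exact ⟨by rw [mem_Hp]; linarith, this.1⟩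
  refine (hasDerivAt_integral_of_dominated_loc_of_deriv_le (F := fun z t => g t / ((t : ℂ) - z))
    (F' := fun z t => g t / ((t : ℂ) - z) ^ 2)
    (bound := fun t => ‖g t‖ * ((z.im / 2) ^ 2)⁻¹) (Metric.ball_mem_nhds z (half_pos hz'))
    ?_ (integrable_CT hg hz) (integrable_CT2 hg hz).aestronglyMeasurable ?_ (hg.norm.mul_const _) ?_).2
  · filter_upwards [isOpen_Hp.mem_nhds hz] with w hw using (integrable_CT hg hw).aestronglyMeasurable
  · refine Eventually.of_forall fun t w hw => ?_
    obtain ⟨h1, h2⟩ := hb w hw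
    rw [norm_div, div_eq_mul_inv, norm_pow]
    gcongr
    exact h2.trans (im_le_norm_sub t w)
  · refine Eventually.of_forall fun t w hw => ?_
    obtain ⟨h1, h2⟩ := hb w hw
    have h3 := ((hasDerivAt_id w).const_sub (t : ℂ)).inv (sub_ne (t := t) h1)
    have h4 := h3.const_mul (g t)
    simp only [div_eq_mul_inv]
    refine h4.congr_deriv ?_
    simp [div_eq_mul_inv]

lemma diffOn_CT {g : ℝ → ℂ} (hg : Integrable g) : DifferentiableOn ℂ (CT g) Hp := fun _ hz =>
  (hasDerivAt_CT hg hz).differentiableAt.differentiableWithinAt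

noncomputable def SS (ρ : ℝ → ℝ) (z : ℂ) : ℂ := (1 / (Real.pi * Complex.I)) * CT (fun t => (ρ t : ℂ)) z

lemma diffOn_SS {ρ : ℝ → ℝ} (hg : Integrable ρ) : DifferentiableOn ℂ (SS ρ) Hp :=
  (diffOn_CT hg.ofReal).const_mul _

noncomputable def PK (y u : ℝ) : ℝ := y / (Real.pi * (u ^ 2 + y ^ 2))

lemma PK_pos {y : ℝ} (hy : 0 < y) (u : ℝ) : 0 < PK y u := by
  have := Real.pi_pos
  unfold PK; positivity

lemma normsq_sub (t : ℝ) (z : ℂ) : ‖(t : ℂ) - z‖ ^ 2 = (z.re - t) ^ 2 + z.im ^ 2 := by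
  rw [← Complex.normSq_eq_norm_sq, Complex.normSq_apply]; simp; ring

lemma re_SS {ρ : ℝ → ℝ} (hg : Integrable ρ) {z : ℂ} (hz : z ∈ Hp) :
    (SS ρ z).re = ∫ t, ρ t * PK z.im (z.re - t) := by
  have hi := (integrable_CT hg.ofReal hz).const_mul (1 / (Real.pi * Complex.I) : ℂ)
  have := integral_re (𝕜 := ℂ) hi
  simp only [RCLike.re_to_complex] at this
  rw [SS, CT, ← integral_const_mul]
  refine this.symm.trans (integral_congr_ae (Eventually.of_forall fun t => ?_))
  have e : (1 / (Real.pi * Complex.I) : ℂ) * ((ρ t : ℂ) / ((t : ℂ) - z))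
     = ((ρ t / (Real.pi * ‖(t : ℂ) - z‖ ^ 2) : ℝ) : ℂ) * (-Complex.I * (starRingEnd ℂ) ((t : ℂ) - z)) := by
    have h1 := sub_ne (t := t) hz
    have h3 : (‖(t : ℂ) - z‖ : ℂ) ≠ 0 := by simpa using h1
    have hpi : (Real.pi : ℂ) ≠ 0 := by simp
    have h2 : ((t : ℂ) - z) * (starRingEnd ℂ) ((t : ℂ) - z) = (‖(t : ℂ) - z‖ : ℂ) ^ 2 := by
      rw [Complex.mul_conj, Complex.normSq_eq_norm_sq]; push_cast; rfl
    have h5 : (1 / (Real.pi * Complex.I) : ℂ) = -Complex.I / Real.pi := by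
      field_simp; simp
    rw [h5]
    push_cast
    rw [← h2]
    have h6 : (starRingEnd ℂ) ((t : ℂ) - z) ≠ 0 := (map_ne_zero _).2 h1
    field_simp
  simp only []
  erw [e]
  rw [Complex.re_ofReal_mul, normsq_sub]
  simp [PK]
  ring

lemma integrable_PK {ρ : ℝ → ℝ} (hg : Integrable ρ) {z : ℂ} (hz : z ∈ Hp) :
    Integrable fun t => ρ t * PK z.im (z.re - t) := by
  have hz' : 0 < z.im := hz
  have := Real.pi_pos
  refine hg.mul_bdd (c := 1 / (Real.pi * z.im)) ?_ ?_
  · apply Continuous.aestronglyMeasurable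
    unfold PK
    refine Continuous.div (by fun_prop) (by fun_prop) fun t => by positivity
  · refine Eventually.of_forall fun t => ?_
    rw [Real.norm_of_nonneg (PK_pos hz' _).le, PK]
    rw [div_le_div_iff₀ (by positivity) (by positivity)]
    nlinarith [mul_nonneg this.le (sq_nonneg (z.re - t))]

lemma norm_deriv_SS {ρ : ℝ → ℝ} (hg : Integrable ρ) (h0 : ∀ t, 0 ≤ ρ t) {z : ℂ} (hz : z ∈ Hp) :
    ‖deriv (SS ρ) z‖ ≤ (SS ρ z).re / z.im := by
  have hz' : 0 < z.im := hz
  have h1 := (hasDerivAt_CT hg.ofReal hz).const_mul (1 / (Real.pi * Complex.I) : ℂ)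
  have : deriv (SS ρ) z = _ := h1.deriv
  rw [this, norm_mul, re_SS hg hz, ← integral_div]
  have hpi := Real.pi_pos
  have n1 : ‖(1 / (Real.pi * Complex.I) : ℂ)‖ = 1 / Real.pi := by
    simp [abs_of_pos hpi]
  rw [n1]
  have h2 := norm_integral_le_integral_norm (μ := volume) (fun t : ℝ => (ρ t : ℂ) / ((t : ℂ) - z) ^ 2)
  refine (mul_le_mul_of_nonneg_left h2 (by positivity)).trans (le_of_eq ?_)
  rw [← integral_const_mul]
  refine integral_congr_ae (Eventually.of_forall fun t => ?_)
  simp only [norm_div, norm_pow, Complex.norm_real, normsq_sub, Real.norm_of_nonneg (h0 t), PK]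
  have : 0 < (z.re - t) ^ 2 + z.im ^ 2 := by positivity
  field_simp

lemma re_SS_pos {ρ : ℝ → ℝ} (hg : Integrable ρ) (h0 : ∀ t, 0 < ρ t) {z : ℂ} (hz : z ∈ Hp) :
    0 < (SS ρ z).re := by
  rw [re_SS hg hz]
  have hp : ∀ t, 0 < ρ t * PK z.im (z.re - t) := fun t => mul_pos (h0 t) (PK_pos hz _)
  rw [integral_pos_iff_support_of_nonneg (fun t => (hp t).le) (integrable_PK hg hz)]
  have : Function.support (fun t => ρ t * PK z.im (z.re - t)) = univ := by
    ext t; simpa using (hp t).ne'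
  rw [this]; simp

end CC

namespace CC
open Set Filter Topology
open scoped ENNReal

lemma lintegral_PK {y : ℝ} (hy : 0 < y) : ∫⁻ u, ENNReal.ofReal (PK y u) = 1 := by
  have hpi := Real.pi_pos
  have e : ∀ u, PK y u = (1 / (Real.pi * y)) * (1 + (y⁻¹ * u) ^ 2)⁻¹ := by
    intro u
    unfold PK
    have h1 : u ^ 2 + y ^ 2 ≠ 0 := by positivity
    have h2 : 1 + (y⁻¹ * u) ^ 2 ≠ 0 := by positivity
    have h3 : y ^ 2 + u ^ 2 ≠ 0 := by positivity
    field_simp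
    ring
  have hi : Integrable (fun u : ℝ => (1 + (y⁻¹ * u) ^ 2)⁻¹) :=
    integrable_inv_one_add_sq.comp_mul_left' (inv_ne_zero hy.ne')
  simp only [e]
  rw [← ofReal_integral_eq_lintegral_ofReal (hi.const_mul _) (Eventually.of_forall fun u => by positivity),
    integral_const_mul, Measure.integral_comp_mul_left (fun u => (1 + u ^ 2)⁻¹), integral_univ_inv_one_add_sq]
  rw [inv_inv, abs_of_pos hy, smul_eq_mul]
  have : 1 / (Real.pi * y) * (y * Real.pi) = 1 := by field_simp
  rw [this, ENNReal.ofReal_one]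

lemma measurable_PK (y : ℝ) : Measurable (PK y) := by unfold PK; fun_prop

lemma re_SS_Lp {ρ : ℝ → ℝ} (hg : Integrable ρ) (hc : Continuous ρ) (h0 : ∀ t, 0 ≤ ρ t) {p : ℝ} (hp : 1 < p)
    {y : ℝ} (hy : 0 < y) :
    ∫⁻ x : ℝ, ENNReal.ofReal (SS ρ ⟨x, y⟩).re ^ p ≤ ∫⁻ t, ENNReal.ofReal (ρ t) ^ p := by
  have h := young (fun t => ENNReal.ofReal (ρ t)) (fun u => ENNReal.ofReal (PK y u))
    (by fun_prop) (by have := measurable_PK y; fun_prop) hp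
  rw [lintegral_PK hy, ENNReal.one_rpow, one_mul] at h
  refine le_trans (le_of_eq (lintegral_congr fun x => ?_)) h
  congr 1
  rw [re_SS hg (mem_Hp_mk hy), ofReal_integral_eq_lintegral_ofReal (integrable_PK hg (mem_Hp_mk hy))
    (Eventually.of_forall fun t => mul_nonneg (h0 t) (PK_pos hy _).le)]
  refine lintegral_congr fun t => ?_
  rw [ENNReal.ofReal_mul (h0 t)]

noncomputable def KK (y u : ℝ) : ℝ := (u ^ 2 + y ^ 2) ^ (-(1/2) : ℝ)

lemma measurable_KK (y : ℝ) : Measurable (KK y) := by unfold KK; fun_prop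

lemma norm_inv_sub_eq {t x y : ℝ} : ‖((t : ℂ) - ⟨x, y⟩)⁻¹‖ = KK y (x - t) := by
  have h := normsq_sub t ⟨x, y⟩
  simp only at h
  rw [norm_inv, KK, ← h, Real.rpow_neg (by positivity), ← Real.rpow_natCast, ← Real.rpow_mul (norm_nonneg _)]
  norm_num

lemma lintegral_KK {p : ℝ} (hp : 1 < p) : ∃ C : ℝ, ∀ y > 0,
    ∫⁻ u, ENNReal.ofReal (KK y u) ^ p = ENNReal.ofReal (C * y ^ (1 - p)) := by
  refine ⟨∫ u : ℝ, (1 + ‖u‖ ^ 2) ^ (-p / 2), fun y hy => ?_⟩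
  have hi : Integrable (fun u : ℝ => (1 + ‖u‖ ^ 2) ^ (-p / 2)) :=
    integrable_rpow_neg_one_add_norm_sq (by simpa using hp)
  have e : ∀ u, ENNReal.ofReal (KK y u) ^ p = ENNReal.ofReal (y ^ (-p) * (1 + ‖y⁻¹ * u‖ ^ 2) ^ (-p / 2)) := by
    intro u
    have h1 : 0 < u ^ 2 + y ^ 2 := by positivity
    rw [ENNReal.ofReal_rpow_of_nonneg (by unfold KK; positivity) (by linarith)]
    congr 1
    have h2 : u ^ 2 + y ^ 2 = y ^ 2 * (1 + ‖y⁻¹ * u‖ ^ 2) := by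
      rw [Real.norm_eq_abs, sq_abs]; field_simp; ring
    have h3 : y ^ (-p) = (y ^ 2) ^ (-p / 2) := by
      rw [← Real.rpow_natCast, ← Real.rpow_mul hy.le]; congr 1; push_cast; ring
    rw [KK, ← Real.rpow_mul h1.le, h2, h3, Real.mul_rpow (by positivity) (by positivity)]
    ring_nf
  have hi' : Integrable (fun u : ℝ => (1 + ‖y⁻¹ * u‖ ^ 2) ^ (-p / 2)) :=
    hi.comp_mul_left' (inv_ne_zero hy.ne')
  simp only [e]
  rw [← ofReal_integral_eq_lintegral_ofReal (hi'.const_mul _) (Eventually.of_forall fun u => by positivity),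
    integral_const_mul, Measure.integral_comp_mul_left (fun u : ℝ => (1 + ‖u‖ ^ 2) ^ (-p / 2)),
    inv_inv, abs_of_pos hy, smul_eq_mul]
  congr 1
  rw [show 1 - p = -p + 1 by ring, Real.rpow_add hy, Real.rpow_one]; ring

lemma CT_Lp {p : ℝ} (hp : 1 < p) : ∃ C : ℝ, ∀ g : ℝ → ℂ, Integrable g → Continuous g →
    ∀ y > 0, ∫⁻ x : ℝ, ‖CT g ⟨x, y⟩‖ₑ ^ p ≤ (∫⁻ t, ‖g t‖ₑ) ^ p * ENNReal.ofReal (C * y ^ (1 - p)) := by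
  obtain ⟨C, hC⟩ := lintegral_KK hp
  refine ⟨C, fun g hg hc y hy => ?_⟩
  rw [← hC y hy]
  refine le_trans (lintegral_mono fun x => ?_) (young (fun u => ENNReal.ofReal (KK y u)) (fun t => ‖g t‖ₑ)
    (by have := measurable_KK y; fun_prop) (by fun_prop) hp)
  gcongr
  refine (enorm_integral_le_lintegral_enorm _).trans (le_of_eq ?_)
  rw [← lintegral_sub_left_eq_self _ x]
  refine lintegral_congr fun t => ?_
  rw [div_eq_mul_inv, enorm_mul, mul_comm]
  congr 1
  rw [← ofReal_norm, norm_inv_sub_eq, sub_sub_cancel]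

/-- Constancy of horizontal integrals of holomorphic functions. -/
lemma Good.const_int {c : ℝ} {Q : ℂ → ℂ} (hQ : Good c Q) {h : ℂ → ℂ} (hh : DifferentiableOn ℂ h Hp)
    {r C : ℝ} (hr : 0 ≤ r) (hC : 0 ≤ C) (b0 : ∀ z ∈ Hp, ‖h z‖ ≤ C * ‖Q z‖ ^ r)
    (b1 : ∀ z ∈ Hp, ‖deriv h z‖ ≤ C * ‖Q z‖ ^ r / z.im)
    (hi : ∀ y > 0, Integrable (fun x : ℝ => ‖Q ⟨x, y⟩‖ ^ r)) {y1 y2 : ℝ} (hy1 : 0 < y1) (hy2 : 0 < y2) :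
    ∫ x : ℝ, h ⟨x, y1⟩ = ∫ x : ℝ, h ⟨x, y2⟩ := by
  have hdh : DifferentiableOn ℂ (deriv h) Hp := hh.deriv isOpen_Hp
  have i0 : ∀ y > 0, Integrable (fun x : ℝ => h ⟨x, y⟩) := fun y hy =>
    ((hi y hy).const_mul C).mono' (continuous_line hh hy).aestronglyMeasurable
      (Eventually.of_forall fun x => b0 _ (mem_Hp_mk hy))
  have i1 : ∀ y > 0, Integrable (fun x : ℝ => deriv h ⟨x, y⟩) := fun y hy =>
    (((hi y hy).const_mul C).div_const y).mono' (continuous_line hdh hy).aestronglyMeasurable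
      (Eventually.of_forall fun x => b1 _ (mem_Hp_mk hy))
  have hd : ∀ y > 0, HasDerivAt (fun y => ∫ x : ℝ, h ⟨x, y⟩) 0 y := by
    intro y0 hy0
    have z : ∫ x : ℝ, deriv h ⟨x, y0⟩ * Complex.I = 0 := by
      rw [integral_mul_const, integral_eq_zero_of_hasDerivAt_of_integrable
        (fun x => hasDerivAt_x (x := x) hh hy0) (i1 y0 hy0) (i0 y0 hy0), zero_mul]
    rw [← z]
    have posY : ∀ {y : ℝ}, y ∈ Metric.ball y0 (y0/2) → 0 < y ∧ |y - y0| ≤ y0 / 2 ∧ y0 / 2 ≤ y := by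
      intro y hy
      rw [Metric.mem_ball, Real.dist_eq] at hy
      have := abs_lt.1 hy
      exact ⟨by linarith, hy.le, by linarith⟩
    refine (hasDerivAt_integral_of_dominated_loc_of_deriv_le (F := fun y x => h ⟨x, y⟩)
      (F' := fun y x => deriv h ⟨x, y⟩ * Complex.I)
      (bound := fun x => C * Real.exp c ^ r / (y0 / 2) * ‖Q ⟨x, y0⟩‖ ^ r) (Metric.ball_mem_nhds y0 (half_pos hy0))
      (by filter_upwards [lt_mem_nhds hy0] with y hy using (continuous_line hh hy).aestronglyMeasurable) (i0 y0 hy0)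
      ((continuous_line hdh hy0).mul continuous_const).aestronglyMeasurable
      (Eventually.of_forall fun x y hy => ?_)
      ((hi y0 hy0).const_mul _)
      (Eventually.of_forall fun x y hy => hasDerivAt_y hh (posY hy).1)).2
    obtain ⟨h1, h2, h3⟩ := posY hy
    rw [norm_mul, Complex.norm_I, mul_one]
    refine (b1 _ (mem_Hp_mk h1)).trans ?_
    have hH := (hQ.harnack (mem_Hp_mk (x := x) hy0) (w := ⟨x, y⟩) (by
      have : (⟨x, y⟩ - ⟨x, y0⟩ : ℂ) = ((y - y0 : ℝ) : ℂ) * Complex.I := by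
        apply Complex.ext <;> simp
      rw [this, norm_mul, Complex.norm_I, mul_one, Complex.norm_real]; exact h2)).1
    have : ‖Q ⟨x, y⟩‖ ^ r ≤ Real.exp c ^ r * ‖Q ⟨x, y0⟩‖ ^ r := by
      rw [← Real.mul_rpow (by positivity) (by positivity)]
      exact Real.rpow_le_rpow (norm_nonneg _) hH hr
    calc _ ≤ C * (Real.exp c ^ r * ‖Q ⟨x, y0⟩‖ ^ r) / (y0 / 2) := by gcongr
      _ = _ := by ring
  exact (isOpen_Ioi (a := (0:ℝ))).is_const_of_deriv_eq_zero isPreconnected_Ioi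
    (fun y hy => (hd y hy).differentiableAt.differentiableWithinAt) (fun y hy => (hd y hy).deriv) hy1 hy2

lemma trig_ineq {p : ℝ} (hp : 1 < p) (hp2 : p ≤ 2) : ∃ α β : ℝ, 0 ≤ α ∧ 0 ≤ β ∧ ∀ w : ℂ, 0 < w.re →
    ‖w‖ ^ p ≤ α * w.re ^ p - β * (w ^ (p : ℂ)).re := by
  have hpi := Real.pi_pos
  set θ0 := (Real.pi / (2 * p) + Real.pi / 2) / 2 with hθ
  have hlt : Real.pi / (2 * p) < Real.pi / 2 := by
    apply div_lt_div_of_pos_left hpi (by norm_num) (by linarith)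
  have h1 : Real.pi / (2 * p) < θ0 := by rw [hθ]; linarith
  have h2 : θ0 < Real.pi / 2 := by rw [hθ]; linarith
  have h0 : 0 < θ0 := lt_trans (by positivity) h1
  have h3 : Real.pi / 2 < θ0 * p := by
    rw [div_lt_iff₀ (by positivity)] at h1; linarith
  have h4 : θ0 * p < Real.pi := by nlinarith
  have hc1 : Real.cos (θ0 * p) < 0 := Real.cos_neg_of_pi_div_two_lt_of_lt h3 (by linarith)
  have hc0 : 0 < Real.cos θ0 := Real.cos_pos_of_mem_Ioo ⟨by linarith, h2⟩
  set β := -1 / Real.cos (θ0 * p) with hβ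
  have hβ0 : 0 ≤ β := by rw [hβ]; exact div_nonneg_of_nonpos (by norm_num) hc1.le
  refine ⟨(1 + β) / Real.cos θ0 ^ p, β, by positivity, hβ0, fun w hw => ?_⟩
  have hwn : 0 < ‖w‖ := norm_pos_iff.2 (by rintro rfl; simp at hw)
  have harg := Complex.abs_arg_lt_pi_div_two_iff.2 (Or.inl hw)
  rw [Complex.cpow_ofReal_re]
  have hre : w.re = ‖w‖ * Real.cos (Complex.arg w) := (Complex.norm_mul_cos_arg w).symm
  have hcp : 0 < Real.cos (Complex.arg w) := by
    rw [hre] at hw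
    exact pos_of_mul_pos_right hw hwn.le
  rw [hre, Real.mul_rpow hwn.le hcp.le]
  have hN : 0 < ‖w‖ ^ p := by positivity
  have key : 1 ≤ (1 + β) / Real.cos θ0 ^ p * Real.cos (Complex.arg w) ^ p - β * Real.cos (Complex.arg w * p) := by
    have ea : Real.cos (Complex.arg w * p) = Real.cos (|Complex.arg w| * p) := by
      rw [← Real.cos_abs, abs_mul, abs_of_pos (by linarith : 0 < p)]
    have eb : Real.cos (Complex.arg w) = Real.cos (|Complex.arg w|) := (Real.cos_abs _).symm
    rw [ea, eb]
    rw [eb] at hcp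
    have hap := abs_nonneg (Complex.arg w)
    rcases le_total θ0 |Complex.arg w| with h | h
    · have : Real.cos (|Complex.arg w| * p) ≤ Real.cos (θ0 * p) :=
        Real.cos_le_cos_of_nonneg_of_le_pi (by positivity) (by nlinarith) (by gcongr)
      have h5 : β * Real.cos (|Complex.arg w| * p) ≤ β * Real.cos (θ0 * p) := by gcongr
      have h6 : β * Real.cos (θ0 * p) = -1 := by rw [hβ]; exact div_mul_cancel₀ _ hc1.ne
      have h7 : 0 ≤ (1 + β) / Real.cos θ0 ^ p * Real.cos |Complex.arg w| ^ p := by positivity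
      linarith
    · have : Real.cos θ0 ≤ Real.cos |Complex.arg w| :=
        Real.cos_le_cos_of_nonneg_of_le_pi hap (by linarith) h
      have h5 : Real.cos θ0 ^ p ≤ Real.cos |Complex.arg w| ^ p :=
        Real.rpow_le_rpow hc0.le this (by linarith)
      have h6 : 1 + β ≤ (1 + β) / Real.cos θ0 ^ p * Real.cos |Complex.arg w| ^ p := by
        rw [div_mul_eq_mul_div, le_div_iff₀ (by positivity)]; gcongr
      have h7 : β * Real.cos (|Complex.arg w| * p) ≤ β := by
        have := Real.cos_le_one (|Complex.arg w| * p)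
        nlinarith
      linarith
  nlinarith [mul_le_mul_of_nonneg_left key hN.le]

/-- Square root of a function with positive real part. -/
noncomputable def sq2 (S : ℂ → ℂ) (z : ℂ) : ℂ := S z ^ ((1 / 2 : ℝ) : ℂ)

structure Pre (S : ℂ → ℂ) : Prop where
  diff : DifferentiableOn ℂ S Hp
  pos : ∀ z ∈ Hp, 0 < (S z).re
  der : ∀ z ∈ Hp, ‖deriv S z‖ ≤ (S z).re / z.im

lemma pre_SS {ρ : ℝ → ℝ} (hg : Integrable ρ) (h0 : ∀ t, 0 < ρ t) : Pre (SS ρ) :=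
  ⟨diffOn_SS hg, fun _ hz => re_SS_pos hg h0 hz, fun _ hz => norm_deriv_SS hg (fun t => (h0 t).le) hz⟩

lemma Pre.norm_pos {S : ℂ → ℂ} (hS : Pre S) {z : ℂ} (hz : z ∈ Hp) : 0 < ‖S z‖ :=
  (hS.pos z hz).trans_le (Complex.re_le_norm _)

lemma Pre.hasDerivAt_cpow {S : ℂ → ℂ} (hS : Pre S) (r : ℝ) {z : ℂ} (hz : z ∈ Hp) :
    HasDerivAt (fun z => S z ^ (r : ℂ)) (r * S z ^ ((r : ℂ) - 1) * deriv S z) z :=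
  (hS.diff.differentiableAt (isOpen_Hp.mem_nhds hz)).hasDerivAt.cpow_const (Or.inl (hS.pos z hz))

lemma Pre.norm_deriv_cpow {S : ℂ → ℂ} (hS : Pre S) {r : ℝ} (hr : 0 ≤ r) {z : ℂ} (hz : z ∈ Hp) :
    ‖deriv (fun z => S z ^ (r : ℂ)) z‖ ≤ r * ‖S z‖ ^ r / z.im := by
  have hz' : 0 < z.im := hz
  have hn := hS.norm_pos hz
  rw [(hS.hasDerivAt_cpow r hz).deriv, norm_mul, norm_mul]
  have e : ((r : ℂ) - 1) = ((r - 1 : ℝ) : ℂ) := by push_cast; rfl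
  rw [e, Complex.norm_cpow_real, Complex.norm_real, Real.norm_of_nonneg hr]
  have h1 := (hS.der z hz).trans (div_le_div_of_nonneg_right (Complex.re_le_norm (S z)) hz'.le)
  calc _ ≤ r * ‖S z‖ ^ (r - 1) * (‖S z‖ / z.im) := by gcongr
    _ = _ := by rw [Real.rpow_sub_one hn.ne']; field_simp

lemma norm_sq2 (S : ℂ → ℂ) (z : ℂ) : ‖sq2 S z‖ = ‖S z‖ ^ (1 / 2 : ℝ) := Complex.norm_cpow_real _ _

lemma Pre.sq2_re {S : ℂ → ℂ} (hS : Pre S) {z : ℂ} (hz : z ∈ Hp) :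
    0 < (sq2 S z).re ∧ ‖sq2 S z‖ ^ 2 ≤ 2 * (sq2 S z).re ^ 2 := by
  have hw := hS.pos z hz
  have hn := hS.norm_pos hz
  have hpi := Real.pi_pos
  have harg := Complex.abs_arg_lt_pi_div_two_iff.2 (Or.inl hw)
  have ha := abs_lt.1 harg
  rw [norm_sq2, sq2, Complex.cpow_ofReal_re]
  have hN : 0 < ‖S z‖ ^ (1 / 2 : ℝ) := by positivity
  have hc : 0 < Real.cos (Complex.arg (S z) * (1 / 2)) :=
    Real.cos_pos_of_mem_Ioo ⟨by linarith, by linarith⟩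
  refine ⟨mul_pos hN hc, ?_⟩
  have h2 : 0 ≤ Real.cos (2 * (Complex.arg (S z) * (1 / 2))) :=
    Real.cos_nonneg_of_mem_Icc ⟨by linarith, by linarith⟩
  rw [Real.cos_two_mul] at h2
  rw [mul_pow]
  nlinarith [sq_nonneg (‖S z‖ ^ (1 / 2 : ℝ))]

lemma Pre.good_sq2 {S : ℂ → ℂ} (hS : Pre S) : Good 1 (sq2 S) := by
  refine ⟨fun z hz => (hS.hasDerivAt_cpow (1/2) hz).differentiableAt.differentiableWithinAt,
    fun z hz => (hS.sq2_re hz).1, fun z hz => ?_, fun z hz => ?_⟩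
  · obtain ⟨h1, h2⟩ := hS.sq2_re hz
    nlinarith [norm_nonneg (sq2 S z)]
  · have hz' : 0 < z.im := hz
    have := hS.norm_deriv_cpow (r := 1/2) (by norm_num) hz
    refine this.trans ?_
    rw [norm_sq2, one_mul]
    gcongr
    have : 0 ≤ ‖S z‖ ^ (1/2 : ℝ) := by positivity
    linarith
end CC

namespace CC
open Set Filter Topology
open scoped ENNReal

lemma enorm_rpow_eq (w : ℂ) {p : ℝ} (hp : 0 ≤ p) : ‖w‖ₑ ^ p = ENNReal.ofReal (‖w‖ ^ p) := by
  rw [← ofReal_norm, ENNReal.ofReal_rpow_of_nonneg (norm_nonneg _) hp]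

lemma integrable_of_lintegral {h : ℝ → ℂ} (hc : Continuous h) {p : ℝ} (hp : 0 ≤ p)
    (hf : ∫⁻ x, ‖h x‖ₑ ^ p < ∞) : Integrable fun x => ‖h x‖ ^ p := by
  refine ⟨(hc.norm.rpow_const fun _ => Or.inr hp).aestronglyMeasurable, ?_⟩
  rw [hasFiniteIntegral_iff_enorm]
  refine lt_of_le_of_lt (le_of_eq (lintegral_congr fun x => ?_)) hf
  rw [enorm_rpow_eq _ hp, Real.enorm_eq_ofReal (by positivity)]

lemma lintegral_enorm_rpow {h : ℝ → ℂ} {p : ℝ} (hp : 0 ≤ p)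
    (hi : Integrable fun x => ‖h x‖ ^ p) : ∫⁻ x, ‖h x‖ₑ ^ p = ENNReal.ofReal (∫ x, ‖h x‖ ^ p) := by
  rw [ofReal_integral_eq_lintegral_ofReal hi (Eventually.of_forall fun x => by positivity)]
  exact lintegral_congr fun x => enorm_rpow_eq _ hp

def RieszAt (p : ℝ) : Prop := ∃ C : ℝ, 0 ≤ C ∧ ∀ ρ : ℝ → ℝ, Continuous ρ → Integrable ρ →
  (∀ t, 0 < ρ t) → ∀ y > 0, ∫⁻ x : ℝ, ‖SS ρ ⟨x, y⟩‖ₑ ^ p ≤ ENNReal.ofReal C * ∫⁻ t, ENNReal.ofReal (ρ t) ^ p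

lemma SS_Lp {p : ℝ} (hp : 1 < p) {ρ : ℝ → ℝ} (hg : Integrable ρ) (hc : Continuous ρ) :
    ∃ K : ℝ, ∀ y > 0, ∫⁻ x : ℝ, ‖SS ρ ⟨x, y⟩‖ₑ ^ p ≤ ENNReal.ofReal (K * y ^ (1 - p)) := by
  obtain ⟨C, hC⟩ := CT_Lp hp
  have hfin : (∫⁻ t, ‖(ρ t : ℂ)‖ₑ) < ∞ := hg.ofReal.2
  set A := (‖(1 / (Real.pi * Complex.I) : ℂ)‖ₑ * ∫⁻ t, ‖(ρ t : ℂ)‖ₑ) ^ p with hA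
  have hA' : A ≠ ∞ := ENNReal.rpow_ne_top_of_nonneg (by linarith) (ENNReal.mul_ne_top enorm_ne_top hfin.ne)
  refine ⟨A.toReal * C, fun y hy => ?_⟩
  have h := hC _ hg.ofReal (Complex.continuous_ofReal.comp hc) y hy
  have : ∀ x : ℝ, ‖SS ρ ⟨x, y⟩‖ₑ ^ p = ‖(1 / (Real.pi * Complex.I) : ℂ)‖ₑ ^ p * ‖CT (fun t => (ρ t : ℂ)) ⟨x, y⟩‖ₑ ^ p := by
    intro x
    rw [SS, enorm_mul, ENNReal.mul_rpow_of_nonneg _ _ (by linarith)]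
  simp only [this]
  rw [lintegral_const_mul' _ _ (ENNReal.rpow_ne_top_of_nonneg (by linarith) enorm_ne_top)]
  refine (mul_le_mul_right h _).trans ?_
  rw [← mul_assoc, ← ENNReal.mul_rpow_of_nonneg _ _ (by linarith)]
  change A * _ ≤ _
  rw [mul_assoc, ENNReal.ofReal_mul ENNReal.toReal_nonneg, ENNReal.ofReal_toReal hA']

lemma riesz_le2 {p : ℝ} (hp : 1 < p) (hp2 : p ≤ 2) : RieszAt p := by
  obtain ⟨α, β, hα, hβ, htrig⟩ := trig_ineq hp hp2
  refine ⟨α, hα, fun ρ hc hg h0 y hy => ?_⟩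
  have hp0 : 0 ≤ p := by linarith
  have hS := pre_SS hg h0
  obtain ⟨K, hK⟩ := SS_Lp hp hg hc
  have hcS : ∀ y > 0, Continuous fun x : ℝ => SS ρ ⟨x, y⟩ := fun y hy => continuous_line hS.diff hy
  have hi : ∀ y > 0, Integrable fun x : ℝ => ‖SS ρ ⟨x, y⟩‖ ^ p := fun y hy =>
    integrable_of_lintegral (hcS y hy) hp0 (lt_of_le_of_lt (hK y hy) ENNReal.ofReal_lt_top)
  have hnQ : ∀ z, ‖sq2 (SS ρ) z‖ ^ (2 * p) = ‖SS ρ z‖ ^ p := by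
    intro z
    rw [norm_sq2, ← Real.rpow_mul (norm_nonneg _)]; congr 1; ring
  set h : ℂ → ℂ := fun z => SS ρ z ^ (p : ℂ) with hh
  have hhd : DifferentiableOn ℂ h Hp := fun z hz =>
    (hS.hasDerivAt_cpow p hz).differentiableAt.differentiableWithinAt
  have hnh : ∀ z, ‖h z‖ = ‖SS ρ z‖ ^ p := fun z => Complex.norm_cpow_real _ _
  have hconst : ∀ y1 > 0, ∀ y2 > 0, ∫ x : ℝ, h ⟨x, y1⟩ = ∫ x : ℝ, h ⟨x, y2⟩ := fun y1 hy1 y2 hy2 =>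
    hS.good_sq2.const_int hhd (r := 2 * p) (C := p) (by positivity) hp0
      (fun z hz => by
        rw [hnQ, hnh]
        have : 0 ≤ ‖SS ρ z‖ ^ p := by positivity
        nlinarith)
      (fun z hz => by rw [hnQ]; exact hS.norm_deriv_cpow hp0 hz)
      (fun y hy => by simpa only [hnQ] using hi y hy) hy1 hy2
  have hJ : ∫ x : ℝ, h ⟨x, y⟩ = 0 := by
    have hb : ∀ Y > 0, ‖∫ x : ℝ, h ⟨x, y⟩‖ ≤ |K| * Y ^ (1 - p) := by
      intro Y hY
      rw [hconst y hy Y hY]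
      refine (norm_integral_le_integral_norm _).trans ?_
      simp only [hnh]
      have h1 := hK Y hY
      rw [lintegral_enorm_rpow hp0 (hi Y hY)] at h1
      have h2 := h1.trans (ENNReal.ofReal_le_ofReal (q := |K| * Y ^ (1 - p)) (by gcongr; exact le_abs_self K))
      rwa [ENNReal.ofReal_le_ofReal_iff (by positivity)] at h2
    have ht : Tendsto (fun Y : ℝ => |K| * Y ^ (1 - p)) atTop (𝓝 0) := by
      have := (tendsto_rpow_neg_atTop (show 0 < p - 1 by linarith)).const_mul |K|
      simpa only [neg_sub, mul_zero] using this
    have := ge_of_tendsto ht (by filter_upwards [eventually_gt_atTop 0] with Y hY using hb Y hY)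
    exact norm_le_zero_iff.1 this
  have hih : Integrable fun x : ℝ => h ⟨x, y⟩ :=
    (hi y hy).mono' (continuous_line hhd hy).aestronglyMeasurable (Eventually.of_forall fun x => (hnh _).le)
  have hir : Integrable fun x : ℝ => (SS ρ ⟨x, y⟩).re ^ p := by
    refine (hi y hy).mono' ((Complex.continuous_re.comp (hcS y hy)).rpow_const
      (fun _ => Or.inr hp0)).aestronglyMeasurable (Eventually.of_forall fun x => ?_)
    have := hS.pos _ (mem_Hp_mk (x := x) hy)
    rw [Real.norm_of_nonneg (by positivity)]
    exact Real.rpow_le_rpow this.le (Complex.re_le_norm _) hp0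
  have hire : Integrable fun x : ℝ => (h ⟨x, y⟩).re := hih.re
  have main : ∫ x : ℝ, ‖SS ρ ⟨x, y⟩‖ ^ p ≤ α * ∫ x : ℝ, (SS ρ ⟨x, y⟩).re ^ p := by
    have h1 : ∫ x : ℝ, ‖SS ρ ⟨x, y⟩‖ ^ p ≤ ∫ x : ℝ, (α * (SS ρ ⟨x, y⟩).re ^ p - β * (h ⟨x, y⟩).re) :=
      integral_mono (hi y hy) ((hir.const_mul α).sub (hire.const_mul β)) fun x =>
        htrig _ (hS.pos _ (mem_Hp_mk hy))
    rw [integral_sub (hir.const_mul α) (hire.const_mul β), integral_const_mul, integral_const_mul] at h1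
    have h2 : ∫ x : ℝ, (h ⟨x, y⟩).re = 0 := by
      have := integral_re (𝕜 := ℂ) hih
      simp only [RCLike.re_to_complex] at this
      rw [this, hJ]; simp
    rw [h2] at h1; linarith
  rw [lintegral_enorm_rpow hp0 (hi y hy)]
  refine (ENNReal.ofReal_le_ofReal main).trans ?_
  rw [ENNReal.ofReal_mul hα]
  gcongr
  rw [ofReal_integral_eq_lintegral_ofReal hir (Eventually.of_forall fun x => by
    have := hS.pos _ (mem_Hp_mk (x := x) hy)
    positivity)]
  refine le_trans (le_of_eq (lintegral_congr fun x => ?_)) (re_SS_Lp hg hc (fun t => (h0 t).le) hp hy)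
  rw [ENNReal.ofReal_rpow_of_nonneg (hS.pos _ (mem_Hp_mk (x := x) hy)).le hp0]

end CC

namespace CC
open Set Filter Topology
open scoped ENNReal

lemma add_rpow_le2 {a b r : ℝ} (ha : 0 ≤ a) (hb : 0 ≤ b) (hr : 0 ≤ r) :
    (a + b) ^ r ≤ 2 ^ r * (a ^ r + b ^ r) := by
  have h1 : (a + b) ^ r ≤ (2 * max a b) ^ r := by
    apply Real.rpow_le_rpow (by positivity) _ hr
    have := le_max_left a b
    have := le_max_right a b
    linarith
  rw [Real.mul_rpow (by norm_num) (by positivity)] at h1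
  refine h1.trans ?_
  gcongr
  have pa : 0 ≤ a ^ r := by positivity
  have pb : 0 ≤ b ^ r := by positivity
  rcases max_choice a b with h | h <;> rw [h] <;> linarith

lemma add_rpow_le3 {a b c r : ℝ} (ha : 0 ≤ a) (hb : 0 ≤ b) (hc : 0 ≤ c) (hr : 0 ≤ r) :
    (a + b + c) ^ r ≤ 3 ^ r * (a ^ r + b ^ r + c ^ r) := by
  have h1 : (a + b + c) ^ r ≤ (3 * max (max a b) c) ^ r := by
    apply Real.rpow_le_rpow (by positivity) _ hr
    have := le_max_left a b
    have := le_max_right a b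
    have := le_max_left (max a b) c
    have := le_max_right (max a b) c
    linarith
  have pa : 0 ≤ a ^ r := by positivity
  have pb : 0 ≤ b ^ r := by positivity
  have pc : 0 ≤ c ^ r := by positivity
  rw [Real.mul_rpow (by norm_num) (by positivity)] at h1
  refine h1.trans ?_
  gcongr
  rcases max_choice (max a b) c with h | h <;> rw [h]
  · rcases max_choice a b with h | h <;> rw [h] <;> linarith
  · linarith

lemma integral_norm_rpow_pos {g : ℝ → ℂ} (hc : Continuous g) {p : ℝ} (hp : 0 < p)
    (hip : Integrable fun t => ‖g t‖ ^ p) (hne : g ≠ 0) : 0 < ∫ t, ‖g t‖ ^ p := by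
  rw [integral_pos_iff_support_of_nonneg (fun t => by positivity) hip]
  obtain ⟨t, ht⟩ := Function.ne_iff.1 hne
  apply IsOpen.measure_pos
  · exact (hc.norm.rpow_const fun _ => Or.inr hp.le).isOpen_support
  · refine ⟨t, ?_⟩
    have : 0 < ‖g t‖ := norm_pos_iff.2 ht
    exact (Real.rpow_pos_of_pos this p).ne'

lemma pick {g : ℝ → ℂ} (hc : Continuous g) (hg : Integrable g) {p : ℝ} (hp : 1 < p)
    (hip : Integrable fun t => ‖g t‖ ^ p) (hne : g ≠ 0) :
    ∃ ρ : ℝ → ℝ, Continuous ρ ∧ Integrable ρ ∧ (∀ t, ‖g t‖ < ρ t) ∧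
      ∫⁻ t, ENNReal.ofReal (ρ t) ^ p ≤ ENNReal.ofReal (2 ^ p * 2 * ∫ t, ‖g t‖ ^ p) := by
  have hp0 : 0 < p := by linarith
  have hN := integral_norm_rpow_pos hc hp0 hip hne
  set N := ∫ t, ‖g t‖ ^ p with hNd
  have hpi := Real.pi_pos
  set ε := (N / Real.pi) ^ (1 / p) with hε
  have hε0 : 0 < ε := by positivity
  have hεp : ε ^ p = N / Real.pi := by
    rw [hε, ← Real.rpow_mul (by positivity), one_div_mul_cancel hp0.ne', Real.rpow_one]
  refine ⟨fun t => ‖g t‖ + ε * (1 + t ^ 2)⁻¹, ?_, ?_, ?_, ?_⟩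
  · have : Continuous fun t : ℝ => (1 + t ^ 2)⁻¹ := Continuous.inv₀ (by fun_prop) fun t => by positivity
    fun_prop
  · exact hg.norm.add (integrable_inv_one_add_sq.const_mul ε)
  · intro t
    have : 0 < ε * (1 + t ^ 2)⁻¹ := by positivity
    linarith
  · have hi2 : Integrable (fun t : ℝ => 2 ^ p * ‖g t‖ ^ p + 2 ^ p * (N / Real.pi) * (1 + t ^ 2)⁻¹) := (hip.const_mul (2 ^ p)).add (integrable_inv_one_add_sq.const_mul (2 ^ p * (N / Real.pi)))
    have e : 2 ^ p * 2 * N = ∫ t, (2 ^ p * ‖g t‖ ^ p + 2 ^ p * (N / Real.pi) * (1 + t ^ 2)⁻¹) := by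
      rw [integral_add (hip.const_mul (2 ^ p)) (integrable_inv_one_add_sq.const_mul (2 ^ p * (N / Real.pi))),
        integral_const_mul, integral_const_mul, integral_univ_inv_one_add_sq, ← hNd]
      field_simp; ring
    rw [e, ofReal_integral_eq_lintegral_ofReal hi2 (Eventually.of_forall fun t => by
      positivity)]
    refine lintegral_mono fun t => ?_
    rw [ENNReal.ofReal_rpow_of_nonneg (by positivity) hp0.le]
    apply ENNReal.ofReal_le_ofReal
    refine (add_rpow_le2 (by positivity) (by positivity) hp0.le).trans ?_
    rw [mul_add, mul_assoc (2 ^ p) (N / Real.pi)]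
    gcongr
    rw [Real.mul_rpow (by positivity) (by positivity), hεp]
    gcongr
    have h1 : (1 + t ^ 2)⁻¹ ≤ 1 := inv_le_one_of_one_le₀ (by nlinarith [sq_nonneg t])
    have h2 : 0 < (1 + t ^ 2)⁻¹ := by positivity
    calc ((1 + t ^ 2)⁻¹) ^ p ≤ ((1 + t ^ 2)⁻¹) ^ (1:ℝ) := Real.rpow_le_rpow_of_exponent_ge h2 h1 hp.le
      _ = _ := Real.rpow_one _

theorem exists_Q {p : ℝ} (hp : 1 < p) (hR : RieszAt p) : ∃ C : ℝ, 0 < C ∧ ∀ g : ℝ → ℂ, Continuous g →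
    Integrable g → Integrable (fun t => ‖g t‖ ^ p) → g ≠ 0 → ∃ Q : ℂ → ℂ, Good 1 Q ∧
      (∀ z ∈ Hp, ‖CT g z‖ ≤ 8 * Real.pi * ‖Q z‖ ^ 2) ∧
      (∀ y > 0, Integrable fun x : ℝ => (Q ⟨x, y⟩).re ^ (2 * p)) ∧
      (∀ y > 0, ∫ x : ℝ, (Q ⟨x, y⟩).re ^ (2 * p) ≤ C * ∫ t, ‖g t‖ ^ p) := by
  obtain ⟨C, hC, hR⟩ := hR
  have hp0 : 0 < p := by linarith
  refine ⟨3 ^ (2 * p) * (3 * (C * (2 ^ p * (2 ^ p * 2)))) + 1, by positivity, fun g hc hg hip hne => ?_⟩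
  obtain ⟨ρ, hρc, hρi, hρ, hρp⟩ := pick hc hg hp hip hne
  have hN := integral_norm_rpow_pos hc hp0 hip hne
  set N := ∫ t, ‖g t‖ ^ p with hNd
  have hρ0 : ∀ t, 0 < ρ t := fun t => (norm_nonneg _).trans_lt (hρ t)
  let ρ1 : ℝ → ℝ := fun t => ρ t + (g t).re
  let ρ2 : ℝ → ℝ := fun t => ρ t + (g t).im
  have hc1 : Continuous ρ1 := hρc.add (Complex.continuous_re.comp hc)
  have hc2 : Continuous ρ2 := hρc.add (Complex.continuous_im.comp hc)
  have hi1 : Integrable ρ1 := hρi.add hg.re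
  have hi2 : Integrable ρ2 := hρi.add hg.im
  have b1 : ∀ t, 0 < ρ1 t ∧ ρ1 t ≤ 2 * ρ t := fun t => by
    have := hρ t
    have h := abs_le.1 (Complex.abs_re_le_norm (g t))
    simp only [ρ1]
    constructor <;> linarith
  have b2 : ∀ t, 0 < ρ2 t ∧ ρ2 t ≤ 2 * ρ t := fun t => by
    have := hρ t
    have h := abs_le.1 (Complex.abs_im_le_norm (g t))
    simp only [ρ2]
    constructor <;> linarith
  have s0 := pre_SS hρi hρ0
  have s1 := pre_SS hi1 fun t => (b1 t).1
  have s2 := pre_SS hi2 fun t => (b2 t).1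
  have g0 := s0.good_sq2
  have g1 := s1.good_sq2
  have g2 := s2.good_sq2
  let Q : ℂ → ℂ := fun z => sq2 (SS ρ) z + sq2 (SS ρ1) z + sq2 (SS ρ2) z
  have hnle : ∀ {S : ℂ → ℂ}, Pre S → ∀ z ∈ Hp, ‖sq2 S z‖ ≤ Real.sqrt 2 * (sq2 S z).re := by
    intro S hS z hz
    obtain ⟨h1, h2⟩ := hS.sq2_re hz
    apply le_of_sq_le_sq _ (by positivity)
    rw [mul_pow, Real.sq_sqrt (by norm_num)]; exact h2
  have sqrt2 : Real.sqrt 2 ≤ 2 := by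
    rw [Real.sqrt_le_left (by norm_num)]; norm_num
  have hQd : ∀ z ∈ Hp, HasDerivAt Q (deriv (sq2 (SS ρ)) z + deriv (sq2 (SS ρ1)) z + deriv (sq2 (SS ρ2)) z) z := by
    intro z hz
    have hn := isOpen_Hp.mem_nhds hz
    exact ((g0.diff.differentiableAt hn).hasDerivAt.add (g1.diff.differentiableAt hn).hasDerivAt).add
      (g2.diff.differentiableAt hn).hasDerivAt
  have hQn : ∀ z, ‖Q z‖ ≤ ‖sq2 (SS ρ) z‖ + ‖sq2 (SS ρ1) z‖ + ‖sq2 (SS ρ2) z‖ := fun z => norm_add₃_le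
  have hQre : ∀ z, (Q z).re = (sq2 (SS ρ) z).re + (sq2 (SS ρ1) z).re + (sq2 (SS ρ2) z).re := fun z => by simp [Q]
  have hG : Good 1 Q := by
    refine ⟨fun z hz => (hQd z hz).differentiableAt.differentiableWithinAt, fun z hz => ?_, fun z hz => ?_, fun z hz => ?_⟩
    · rw [hQre]
      have := g0.pos z hz
      have := g1.pos z hz
      have := g2.pos z hz
      linarith
    · rw [hQre]
      have := hQn z
      have := g0.le z hz
      have := g1.le z hz
      have := g2.le z hz
      linarith
    · have hz' : 0 < z.im := hz
      rw [(hQd z hz).deriv]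
      refine norm_add₃_le.trans ?_
      have d : ∀ {S : ℂ → ℂ}, Pre S → ‖deriv (sq2 S) z‖ ≤ (sq2 S z).re / z.im := by
        intro S hS
        refine (hS.norm_deriv_cpow (r := 1/2) (by norm_num) hz).trans ?_
        rw [← norm_sq2]
        have h1 := hnle hS z hz
        have h2 := (hS.sq2_re hz).1
        gcongr
        nlinarith
      have h3 := add_le_add (add_le_add (d s0) (d s1)) (d s2)
      rw [← add_div, ← add_div, ← hQre] at h3
      refine h3.trans ?_
      rw [one_mul]
      gcongr
      exact Complex.re_le_norm _
  have hSle : ∀ {S : ℂ → ℂ}, Pre S → ∀ z ∈ Hp, ‖S z‖ ≤ 2 * (sq2 S z).re ^ 2 := by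
    intro S hS z hz
    have := (hS.sq2_re hz).2
    rw [norm_sq2, ← Real.rpow_natCast, ← Real.rpow_mul (norm_nonneg _)] at this
    norm_num at this
    simpa using this
  have hCT : ∀ z ∈ Hp, CT g z = (Real.pi * Complex.I) * ((SS ρ1 z - SS ρ z) + Complex.I * (SS ρ2 z - SS ρ z)) := by
    intro z hz
    have e : CT g z = (CT (fun t => (ρ1 t : ℂ)) z - CT (fun t => (ρ t : ℂ)) z) +
        Complex.I * (CT (fun t => (ρ2 t : ℂ)) z - CT (fun t => (ρ t : ℂ)) z) := by
      have j0 := integrable_CT hρi.ofReal hz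
      have j1 := integrable_CT hi1.ofReal hz
      have j2 := integrable_CT hi2.ofReal hz
      unfold CT
      erw [← integral_sub j1 j0, ← integral_sub j2 j0, ← integral_const_mul, ← integral_add (j1.sub j0)
        ((j2.sub j0).const_mul _)]
      refine integral_congr_ae (Eventually.of_forall fun t => ?_)
      simp only [ρ1, ρ2, Pi.sub_apply]
      have := Complex.re_add_im (g t)
      nth_rw 1 [← this]
      simp only [Complex.coe_algebraMap]
      push_cast
      ring
    rw [e]
    unfold SS
    have hpi : (Real.pi : ℂ) ≠ 0 := by simp
    field_simp
  have hpi := Real.pi_pos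
  have meas : ∀ y > 0, ∫⁻ x : ℝ, ENNReal.ofReal ((Q ⟨x, y⟩).re ^ (2 * p)) ≤
      ENNReal.ofReal (3 ^ (2 * p) * (3 * (C * (2 ^ p * (2 ^ p * 2)))) * N) := by
    intro y hy
    have hpow : ∀ (S : ℂ → ℂ) z, ‖sq2 S z‖ ^ (2 * p) = ‖S z‖ ^ p := by
      intro S z
      rw [norm_sq2, ← Real.rpow_mul (norm_nonneg _)]; congr 1; ring
    have hx : ∀ x : ℝ, ENNReal.ofReal ((Q ⟨x, y⟩).re ^ (2 * p)) ≤ ENNReal.ofReal (3 ^ (2 * p)) *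
        (‖SS ρ ⟨x, y⟩‖ₑ ^ p + ‖SS ρ1 ⟨x, y⟩‖ₑ ^ p + ‖SS ρ2 ⟨x, y⟩‖ₑ ^ p) := by
      intro x
      rw [enorm_rpow_eq _ hp0.le, enorm_rpow_eq _ hp0.le, enorm_rpow_eq _ hp0.le, ← ENNReal.ofReal_add (by positivity) (by positivity),
        ← ENNReal.ofReal_add (by positivity) (by positivity), ← ENNReal.ofReal_mul (by positivity)]
      apply ENNReal.ofReal_le_ofReal
      rw [← hpow, ← hpow, ← hpow]
      refine le_trans ?_ (add_rpow_le3 (norm_nonneg _) (norm_nonneg _) (norm_nonneg _) (by positivity))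
      exact Real.rpow_le_rpow (hG.pos _ (mem_Hp_mk hy)).le ((Complex.re_le_norm _).trans (hQn _)) (by positivity)
    refine (lintegral_mono hx).trans ?_
    have mS : ∀ {S : ℂ → ℂ}, Pre S → Measurable fun x : ℝ => ‖S ⟨x, y⟩‖ₑ ^ p := fun hS =>
      ((continuous_line hS.diff hy).measurable.enorm).pow_const p
    rw [lintegral_const_mul' _ _ ENNReal.ofReal_ne_top, lintegral_add_right _ (mS s2), lintegral_add_right _ (mS s1)]
    have bρ : ∀ r : ℝ → ℝ, (∀ t, r t ≤ 2 * ρ t) → ENNReal.ofReal C * ∫⁻ t, ENNReal.ofReal (r t) ^ p ≤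
        ENNReal.ofReal (C * (2 ^ p * (2 ^ p * 2)) * N) := by
      intro r hr
      have : ∀ t, ENNReal.ofReal (r t) ^ p ≤ ENNReal.ofReal (2 ^ p) * ENNReal.ofReal (ρ t) ^ p := by
        intro t
        rw [← ENNReal.ofReal_rpow_of_nonneg (by norm_num) hp0.le, ← ENNReal.mul_rpow_of_nonneg _ _ hp0.le,
          ← ENNReal.ofReal_mul (by norm_num)]
        exact ENNReal.rpow_le_rpow (ENNReal.ofReal_le_ofReal (hr t)) hp0.le
      calc _ ≤ ENNReal.ofReal C * (ENNReal.ofReal (2 ^ p) * ENNReal.ofReal (2 ^ p * 2 * N)) := by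
            gcongr
            refine (lintegral_mono this).trans ?_
            rw [lintegral_const_mul' _ _ ENNReal.ofReal_ne_top]
            gcongr
        _ = _ := by
            rw [← ENNReal.ofReal_mul (by positivity), ← ENNReal.ofReal_mul (by positivity)]
            congr 1; ring
    have t0 := (hR ρ hρc hρi hρ0 y hy).trans (bρ ρ fun t => by linarith [hρ0 t])
    have t1 := (hR ρ1 hc1 hi1 (fun t => (b1 t).1) y hy).trans (bρ ρ1 fun t => (b1 t).2)
    have t2 := (hR ρ2 hc2 hi2 (fun t => (b2 t).1) y hy).trans (bρ ρ2 fun t => (b2 t).2)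
    calc _ ≤ ENNReal.ofReal (3 ^ (2 * p)) * (ENNReal.ofReal (C * (2 ^ p * (2 ^ p * 2)) * N) +
          ENNReal.ofReal (C * (2 ^ p * (2 ^ p * 2)) * N) + ENNReal.ofReal (C * (2 ^ p * (2 ^ p * 2)) * N)) := by gcongr
      _ = _ := by
        rw [← ENNReal.ofReal_add (by positivity) (by positivity), ← ENNReal.ofReal_add (by positivity) (by positivity),
          ← ENNReal.ofReal_mul (by positivity)]
        congr 1; ring
  have hvi : ∀ y > 0, Integrable fun x : ℝ => (Q ⟨x, y⟩).re ^ (2 * p) := by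
    intro y hy
    refine ⟨((Complex.continuous_re.comp (continuous_line hG.diff hy)).rpow_const
      fun _ => Or.inr (by positivity)).aestronglyMeasurable, ?_⟩
    rw [hasFiniteIntegral_iff_enorm]
    refine lt_of_le_of_lt ((le_of_eq (lintegral_congr fun x => ?_)).trans (meas y hy)) ENNReal.ofReal_lt_top
    have := hG.pos _ (mem_Hp_mk (x := x) hy)
    rw [Real.enorm_eq_ofReal (by positivity)]
  refine ⟨Q, hG, fun z hz => ?_, hvi, fun y hy => ?_⟩
  · rw [hCT z hz, norm_mul, norm_mul, Complex.norm_I, mul_one, Complex.norm_real, Real.norm_of_nonneg hpi.le]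
    have h1 : ‖(SS ρ1 z - SS ρ z) + Complex.I * (SS ρ2 z - SS ρ z)‖ ≤
        (‖SS ρ1 z‖ + ‖SS ρ z‖) + (‖SS ρ2 z‖ + ‖SS ρ z‖) := by
      refine (norm_add_le _ _).trans (add_le_add (norm_sub_le _ _) ?_)
      rw [norm_mul, Complex.norm_I, one_mul]; exact norm_sub_le _ _
    have l0 := hSle s0 z hz
    have l1 := hSle s1 z hz
    have l2 := hSle s2 z hz
    have p0 := g0.pos z hz
    have p1 := g1.pos z hz
    have p2 := g2.pos z hz
    have hr := hQre z
    have hv : (Q z).re ≤ ‖Q z‖ := Complex.re_le_norm _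
    have v0 : (sq2 (SS ρ) z).re ^ 2 ≤ ‖Q z‖ ^ 2 := by gcongr; linarith
    have v1 : (sq2 (SS ρ1) z).re ^ 2 ≤ ‖Q z‖ ^ 2 := by gcongr; linarith
    have v2 : (sq2 (SS ρ2) z).re ^ 2 ≤ ‖Q z‖ ^ 2 := by gcongr; linarith
    have : ‖(SS ρ1 z - SS ρ z) + Complex.I * (SS ρ2 z - SS ρ z)‖ ≤ 8 * ‖Q z‖ ^ 2 := by linarith
    calc _ ≤ Real.pi * (8 * ‖Q z‖ ^ 2) := by gcongr
      _ = _ := by ring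
  · have h1 := meas y hy
    rw [← ofReal_integral_eq_lintegral_ofReal (hvi y hy) (Eventually.of_forall fun x => by
      have := hG.pos _ (mem_Hp_mk (x := x) hy)
      positivity), ENNReal.ofReal_le_ofReal_iff (by positivity)] at h1
    nlinarith
end CC

namespace CC
open Set Filter Topology
open scoped ENNReal

lemma CT_riesz {p : ℝ} (hp : 1 < p) (hR : RieszAt p) : ∃ K : ℝ, 0 < K ∧ ∀ g : ℝ → ℂ, Continuous g →
    Integrable g → Integrable (fun t => ‖g t‖ ^ p) → g ≠ 0 → ∀ y > 0,
    ∫⁻ x : ℝ, ‖CT g ⟨x, y⟩‖ₑ ^ p ≤ ENNReal.ofReal (K * ∫ t, ‖g t‖ ^ p) := by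
  obtain ⟨C, hC, h⟩ := exists_Q hp hR
  have hpi := Real.pi_pos
  have hp0 : 0 < p := by linarith
  refine ⟨(32 * Real.pi) ^ p * C, by positivity, fun g hc hg hip hne y hy => ?_⟩
  obtain ⟨Q, hQ, h1, h2, h3⟩ := h g hc hg hip hne
  have h4 : ∀ x : ℝ, ‖CT g ⟨x, y⟩‖ₑ ^ p ≤ ENNReal.ofReal ((32 * Real.pi) ^ p * (Q ⟨x, y⟩).re ^ (2 * p)) := by
    intro x
    have hz := mem_Hp_mk (x := x) hy
    have hv := hQ.pos _ hz
    rw [enorm_rpow_eq _ hp0.le]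
    apply ENNReal.ofReal_le_ofReal
    rw [Real.rpow_mul hv.le, ← Real.mul_rpow (by positivity) (by positivity)]
    apply Real.rpow_le_rpow (norm_nonneg _) _ hp0.le
    refine (h1 _ hz).trans ?_
    have := hQ.le _ hz
    calc _ ≤ 8 * Real.pi * (2 * (Q ⟨x, y⟩).re) ^ 2 := by gcongr
      _ = _ := by norm_num; ring
  refine (lintegral_mono h4).trans ?_
  rw [← ofReal_integral_eq_lintegral_ofReal ((h2 y hy).const_mul _) (Eventually.of_forall fun x => by
    have := hQ.pos _ (mem_Hp_mk (x := x) hy)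
    positivity), integral_const_mul]
  apply ENNReal.ofReal_le_ofReal
  rw [mul_assoc]
  have := h3 y hy
  gcongr

lemma riesz_gt2 {q : ℝ} (hq : 2 < q) : RieszAt q := by
  have hpq : q.HolderConjugate (q / (q - 1)) := Real.HolderConjugate.conjExponent (by linarith)
  set p := q / (q - 1) with hpd
  have hq1 : 0 < q - 1 := by linarith
  have hq0 : 0 < q := by linarith
  have hp1 : 1 < p := by rw [hpd, one_lt_div hq1]; linarith
  have hp0 : 0 < p := by linarith
  have hp2 : p ≤ 2 := by rw [hpd, div_le_iff₀ hq1]; linarith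
  obtain ⟨K, hK, hCT⟩ := CT_riesz hp1 (riesz_le2 hp1 hp2)
  refine ⟨K ^ (q / p), by positivity, fun ρ hc hρ h0 y hy => ?_⟩
  have hS := pre_SS hρ h0
  let S : ℝ → ℂ := fun x => SS ρ ⟨x, y⟩
  have hSc : Continuous S := continuous_line hS.diff hy
  have hSp : ∀ x, 0 < ‖S x‖ := fun x => hS.norm_pos (mem_Hp_mk hy)
  have iS : ∀ r : ℝ, 1 < r → Integrable fun x => ‖S x‖ ^ r := by
    intro r hr
    obtain ⟨A, hA⟩ := SS_Lp hr hρ hc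
    exact integrable_of_lintegral hSc (by linarith) (lt_of_le_of_lt (hA y hy) ENNReal.ofReal_lt_top)
  let g : ℝ → ℂ := fun x => S x * ((‖S x‖ ^ (q - 2) : ℝ) : ℂ)
  have hgn : ∀ x, ‖g x‖ = ‖S x‖ ^ (q - 1) := by
    intro x
    simp only [g]
    rw [norm_mul, Complex.norm_real, Real.norm_of_nonneg (by positivity)]
    nth_rw 1 [← Real.rpow_one ‖S x‖]
    rw [← Real.rpow_add (hSp x)]; congr 1; ring
  have hgc : Continuous g := by
    have : Continuous fun x => ‖S x‖ ^ (q - 2) := hSc.norm.rpow_const fun x => Or.inl (hSp x).ne'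
    exact hSc.mul (Complex.continuous_ofReal.comp this)
  have hgi : Integrable g := (iS (q - 1) (by linarith)).mono' hgc.aestronglyMeasurable
    (Eventually.of_forall fun x => (hgn x).le)
  have hgp : ∀ x, ‖g x‖ ^ p = ‖S x‖ ^ q := by
    intro x
    rw [hgn, ← Real.rpow_mul (norm_nonneg _)]; congr 1; rw [hpd]; field_simp
  have hgip : Integrable fun x => ‖g x‖ ^ p := by simpa only [hgp] using iS q (by linarith)
  have hgne : g ≠ 0 := by
    intro h
    have := hgn 0
    rw [h] at this
    have h2 := Real.rpow_pos_of_pos (hSp 0) (q - 1)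
    simp at this
    linarith
  have hNpos := integral_norm_rpow_pos hgc hp0 hgip hgne
  have hCTg := hCT g hgc hgi hgip hgne y hy
  simp only [hgp] at hNpos hCTg
  set N := ∫ x, ‖S x‖ ^ q with hN
  -- Fubini
  have fub : (N : ℂ) = (1 / (Real.pi * Complex.I)) * ∫ t : ℝ, (ρ t : ℂ) * (-(starRingEnd ℂ) (CT g ⟨t, y⟩)) := by
    have e1 : (N : ℂ) = ∫ x, S x * (starRingEnd ℂ) (g x) := by
      rw [hN, ← integral_complex_ofReal]
      refine integral_congr_ae (Eventually.of_forall fun x => ?_)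
      simp only [g, map_mul, Complex.conj_ofReal]
      rw [← mul_assoc, Complex.mul_conj, Complex.normSq_eq_norm_sq, ← Complex.ofReal_mul]
      congr 1
      rw [← Real.rpow_natCast, ← Real.rpow_add (hSp x)]; congr 1; push_cast; ring
    have e2 : ∀ x, S x * (starRingEnd ℂ) (g x) = (1 / (Real.pi * Complex.I)) *
        ∫ t : ℝ, (ρ t : ℂ) * (starRingEnd ℂ) (g x) * ((t : ℂ) - ⟨x, y⟩)⁻¹ := by
      intro x
      simp only [S, SS, CT]
      rw [mul_assoc, ← integral_mul_const]
      congr 2; funext t; ring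
    rw [e1]
    simp only [e2]
    rw [integral_const_mul]
    congr 1
    rw [integral_integral_swap]
    · refine integral_congr_ae (Eventually.of_forall fun t => ?_)
      simp only [mul_assoc]
      rw [integral_const_mul]
      congr 1
      rw [CT, ← integral_conj, ← integral_neg]
      refine integral_congr_ae (Eventually.of_forall fun x => ?_)
      simp only [div_eq_mul_inv, map_mul, map_inv₀]
      rw [← mul_neg]
      congr 1
      rw [← inv_neg]
      congr 1
      apply Complex.ext <;> simp
    · have hprod : Integrable (fun z : ℝ × ℝ => (starRingEnd ℂ) (g z.1) * (ρ z.2 : ℂ)) := by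
        have h1 : Integrable (fun x => (starRingEnd ℂ) (g x)) :=
          (Complex.conjCLE.toContinuousLinearMap.integrable_comp hgi)
        exact h1.mul_prod hρ.ofReal
      have : Integrable (fun z : ℝ × ℝ => ((starRingEnd ℂ) (g z.1) * (ρ z.2 : ℂ)) * ((z.2 : ℂ) - ⟨z.1, y⟩)⁻¹) := by
        refine hprod.mul_bdd (c := y⁻¹) ?_ (Eventually.of_forall fun z => norm_inv_sub_le (mem_Hp_mk hy))
        apply Continuous.aestronglyMeasurable
        refine Continuous.inv₀ ?_ fun z => sub_ne (mem_Hp_mk hy)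
        have : ∀ z : ℝ × ℝ, (⟨z.1, y⟩ : ℂ) = (z.1 : ℂ) + y * Complex.I := fun z => by apply Complex.ext <;> simp
        simp only [this]
        fun_prop
      refine this.congr (Eventually.of_forall fun z => ?_)
      simp only [Function.uncurry]; ring
  have hpi := Real.pi_gt_three
  have main : ENNReal.ofReal N ≤ (∫⁻ t, ENNReal.ofReal (ρ t) ^ q) ^ (1 / q) *
      (ENNReal.ofReal (K * N)) ^ (1 / p) := by
    have e1 : ENNReal.ofReal N = ‖(N : ℂ)‖ₑ := by
      rw [← ofReal_norm, Complex.norm_real, Real.norm_of_nonneg hNpos.le]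
    rw [e1, fub, enorm_mul]
    have e2 : ‖(1 / (Real.pi * Complex.I) : ℂ)‖ₑ ≤ 1 := by
      rw [← ofReal_norm]
      simp only [norm_div, norm_mul, Complex.norm_I, Complex.norm_real, norm_one, mul_one]
      rw [ENNReal.ofReal_le_one, Real.norm_of_nonneg (by linarith), div_le_one (by linarith)]; linarith
    refine (mul_le_mul_left e2 _).trans ?_
    rw [one_mul]
    refine (enorm_integral_le_lintegral_enorm _).trans ?_
    have e3 : ∀ t, ‖(ρ t : ℂ) * (-(starRingEnd ℂ) (CT g ⟨t, y⟩))‖ₑ = ENNReal.ofReal (ρ t) * ‖CT g ⟨t, y⟩‖ₑ := by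
      intro t
      rw [enorm_mul, enorm_neg]
      congr 1
      · rw [← ofReal_norm, Complex.norm_real, Real.norm_of_nonneg (h0 t).le]
      · rw [← ofReal_norm, ← ofReal_norm, RCLike.norm_conj]
    simp only [e3]
    have hm : Continuous fun x : ℝ => CT g ⟨x, y⟩ := continuous_line (diffOn_CT hgi) hy
    refine (ENNReal.lintegral_mul_le_Lp_mul_Lq volume hpq (f := fun t => ENNReal.ofReal (ρ t))
      (g := fun t => ‖CT g ⟨t, y⟩‖ₑ) (by fun_prop) hm.measurable.enorm.aemeasurable).trans ?_
    gcongr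
  rw [show (∫⁻ x : ℝ, ‖SS ρ ⟨x, y⟩‖ₑ ^ q) = ENNReal.ofReal N from lintegral_enorm_rpow hq0.le (iS q (by linarith))]
  set R := ∫⁻ t, ENNReal.ofReal (ρ t) ^ q with hRd
  by_cases hR : R = ∞
  · rw [hR, ENNReal.mul_top]
    · exact le_top
    · simp only [ne_eq, ENNReal.ofReal_eq_zero, not_le]; positivity
  have h1 : R = ENNReal.ofReal R.toReal := (ENNReal.ofReal_toReal hR).symm
  rw [h1, ENNReal.ofReal_rpow_of_nonneg (by positivity) (by positivity),
    ENNReal.ofReal_rpow_of_nonneg (by positivity) (by positivity), ← ENNReal.ofReal_mul (by positivity),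
    ENNReal.ofReal_le_ofReal_iff (by positivity)] at main
  rw [h1, ← ENNReal.ofReal_mul (by positivity)]
  apply ENNReal.ofReal_le_ofReal
  set r := R.toReal with hr
  have hr0 : 0 ≤ r := ENNReal.toReal_nonneg
  have hs : 1 / p + 1 / q = 1 := by simpa [add_comm] using hpq.inv_add_inv_eq_one
  have hN1 : N = N ^ (1 / p) * N ^ (1 / q) := by
    rw [← Real.rpow_add hNpos, hs, Real.rpow_one]
  have hNp : 0 < N ^ (1 / p) := by positivity
  have h2 : N ^ (1 / q) ≤ r ^ (1 / q) * K ^ (1 / p) := by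
    rw [Real.mul_rpow hK.le hNpos.le] at main
    nth_rw 1 [hN1] at main
    refine le_of_mul_le_mul_left ?_ hNp
    linarith
  have h3 := Real.rpow_le_rpow (by positivity) h2 hq0.le
  rw [← Real.rpow_mul hNpos.le, one_div_mul_cancel hq0.ne', Real.rpow_one, Real.mul_rpow (by positivity) (by positivity),
    ← Real.rpow_mul hr0, one_div_mul_cancel hq0.ne', Real.rpow_one, ← Real.rpow_mul hK.le] at h3
  rw [show q / p = 1 / p * q by ring]
  linarith

lemma rieszAt {p : ℝ} (hp : 1 < p) : RieszAt p := by
  rcases le_or_gt p 2 with h | h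
  · exact riesz_le2 hp h
  · exact riesz_gt2 h
end CC

namespace CC
open Set Filter Topology
open scoped ENNReal

noncomputable def AA (f : ℂ → ℝ) : ℝ≥0∞ := ∫⁻ y in Ioi (0:ℝ), ∫⁻ x : ℝ, ENNReal.ofReal (f ⟨x, y⟩)

noncomputable def muH : Measure (ℝ × ℝ) := (volume.restrict (Ioi (0:ℝ))).prod volume

lemma continuous_mk2 : Continuous fun w : ℝ × ℝ => (⟨w.2, w.1⟩ : ℂ) := by
  have : (fun w : ℝ × ℝ => (⟨w.2, w.1⟩ : ℂ)) = fun w => (w.2 : ℂ) + w.1 * Complex.I := by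
    funext z; apply Complex.ext <;> simp
  rw [this]; fun_prop

lemma muH_eq : muH = (volume : Measure (ℝ × ℝ)).restrict (Ioi 0 ×ˢ univ) := by
  unfold muH
  conv_lhs => rw [← Measure.restrict_univ (μ := (volume : Measure ℝ))]
  rw [show (volume.restrict univ).restrict (Ioi (0:ℝ)) = volume.restrict (Ioi 0) by rw [Measure.restrict_univ],
    Measure.prod_restrict]
  rfl

lemma aem_muH {f : ℂ → ℝ} (hf : ContinuousOn f Hp) :
    AEMeasurable (fun w : ℝ × ℝ => ENNReal.ofReal (f ⟨w.2, w.1⟩)) muH := by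
  have h1 : ContinuousOn (fun w : ℝ × ℝ => f ⟨w.2, w.1⟩) (Ioi 0 ×ˢ univ) :=
    hf.comp continuous_mk2.continuousOn fun w hw => mem_Hp_mk hw.1
  rw [muH_eq]
  exact (h1.aemeasurable (measurableSet_Ioi.prod MeasurableSet.univ)).ennreal_ofReal

lemma AA_eq {f : ℂ → ℝ} (hf : ContinuousOn f Hp) :
    AA f = ∫⁻ w, ENNReal.ofReal (f ⟨w.2, w.1⟩) ∂muH := by
  unfold AA muH
  rw [lintegral_prod _ (aem_muH hf)]

lemma ae_muH : ∀ᵐ w ∂muH, (0:ℝ) < w.1 := by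
  rw [muH_eq]
  filter_upwards [ae_restrict_mem (measurableSet_Ioi.prod MeasurableSet.univ)] with w hw
  exact hw.1

lemma holder3 {W X Y Z : ℂ → ℝ} (hW : ContinuousOn W Hp) (hX : ContinuousOn X Hp) (hY : ContinuousOn Y Hp)
    (hZ : ContinuousOn Z Hp) {α β γ : ℝ} (ha : 0 ≤ α) (hb : 0 ≤ β) (hc : 0 ≤ γ) (h1 : α + β + γ = 1)
    (hX0 : ∀ z ∈ Hp, 0 ≤ X z) (hY0 : ∀ z ∈ Hp, 0 ≤ Y z) (hZ0 : ∀ z ∈ Hp, 0 ≤ Z z)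
    (h : ∀ z ∈ Hp, W z ≤ X z ^ α * Y z ^ β * Z z ^ γ) :
    AA W ≤ AA X ^ α * AA Y ^ β * AA Z ^ γ := by
  rw [AA_eq hW, AA_eq hX, AA_eq hY, AA_eq hZ]
  have := ENNReal.lintegral_prod_norm_pow_le (μ := muH) (Finset.univ : Finset (Fin 3))
    (f := ![fun w : ℝ × ℝ => ENNReal.ofReal (X ⟨w.2, w.1⟩), fun w : ℝ × ℝ => ENNReal.ofReal (Y ⟨w.2, w.1⟩),
      fun w : ℝ × ℝ => ENNReal.ofReal (Z ⟨w.2, w.1⟩)]) (p := ![α, β, γ])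
    (by intro i _; fin_cases i
        · exact aem_muH hX
        · exact aem_muH hY
        · exact aem_muH hZ) (by simp [Fin.sum_univ_three, h1])
    (by intro i _; fin_cases i <;> simpa)
  simp only [Fin.prod_univ_three, Matrix.cons_val_zero, Matrix.cons_val_one, Matrix.cons_val_two, Matrix.head_cons,
    Matrix.tail_cons] at this
  refine le_trans (lintegral_mono_ae ?_) this
  filter_upwards [ae_muH] with w hw
  have hz : (⟨w.2, w.1⟩ : ℂ) ∈ Hp := mem_Hp_mk hw
  have e1 := hX0 _ hz
  have e2 := hY0 _ hz
  have e3 := hZ0 _ hz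
  rw [ENNReal.ofReal_rpow_of_nonneg e1 ha, ENNReal.ofReal_rpow_of_nonneg e2 hb, ENNReal.ofReal_rpow_of_nonneg e3 hc,
    ← ENNReal.ofReal_mul (by positivity), ← ENNReal.ofReal_mul (by positivity)]
  exact ENNReal.ofReal_le_ofReal (h _ hz)

lemma integrable_PK1 {y : ℝ} (hy : 0 < y) : Integrable (PK y) := by
  refine ⟨(measurable_PK y).aestronglyMeasurable, ?_⟩
  rw [hasFiniteIntegral_iff_ofReal (Eventually.of_forall fun u => (PK_pos hy u).le), lintegral_PK hy]
  simp

lemma integral_PK1 {y : ℝ} (hy : 0 < y) : ∫ u, PK y u = 1 := by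
  rw [integral_eq_lintegral_of_nonneg_ae (Eventually.of_forall fun u => (PK_pos hy u).le)
    (measurable_PK y).aestronglyMeasurable, lintegral_PK hy]
  simp

lemma abs_re_SS_le {A : ℝ → ℝ} (hA : Integrable A) {M : ℝ} (hM : ∀ t, |A t| ≤ M) {z : ℂ} (hz : z ∈ Hp) :
    |(SS A z).re| ≤ M := by
  have hz' : 0 < z.im := hz
  rw [re_SS hA hz, ← Real.norm_eq_abs]
  refine (norm_integral_le_of_norm_le (g := fun t => M * PK z.im (z.re - t))
    (((integrable_PK1 hz').comp_sub_left z.re).const_mul M) (Eventually.of_forall fun t => ?_)).trans ?_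
  · rw [norm_mul, Real.norm_of_nonneg (PK_pos hz' _).le]
    exact mul_le_mul_of_nonneg_right (hM t) (PK_pos hz' _).le
  · rw [integral_const_mul, integral_sub_left_eq_self (fun u => PK z.im u) volume, integral_PK1 hz', mul_one]

lemma norm_deriv_SS_le {A : ℝ → ℝ} (hA : Integrable A) {M : ℝ} (hM : ∀ t, |A t| ≤ M) {z : ℂ} (hz : z ∈ Hp) :
    ‖deriv (SS A) z‖ ≤ M / z.im := by
  have hz' : 0 < z.im := hz
  have hpi := Real.pi_pos
  have h1 := (hasDerivAt_CT hA.ofReal hz).const_mul (1 / (Real.pi * Complex.I) : ℂ)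
  have : deriv (SS A) z = _ := h1.deriv
  rw [this, ← integral_const_mul]
  refine (norm_integral_le_of_norm_le (g := fun t => M / z.im * PK z.im (z.re - t))
    (((integrable_PK1 hz').comp_sub_left z.re).const_mul _) (Eventually.of_forall fun t => ?_)).trans ?_
  · rw [norm_mul, norm_div, norm_div, norm_pow, normsq_sub]
    simp only [norm_one, norm_mul, Complex.norm_I, Complex.norm_real, mul_one]
    have e : M / z.im * PK z.im (z.re - t) = 1 / ‖Real.pi‖ * (M / ((z.re - t) ^ 2 + z.im ^ 2)) := by
      unfold PK; rw [Real.norm_of_nonneg hpi.le]; field_simp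
    rw [e]
    have := hM t
    gcongr
    simpa using this
  · rw [integral_const_mul, integral_sub_left_eq_self (fun u => PK z.im u) volume, integral_PK1 hz', mul_one]

structure HasN (Q : ℂ → ℂ) (r N : ℝ) : Prop where
  good : Good 1 Q
  int : ∀ y > 0, Integrable fun x : ℝ => (Q ⟨x, y⟩).re ^ (2 * r)
  le : ∀ y > 0, ∫ x : ℝ, (Q ⟨x, y⟩).re ^ (2 * r) ≤ N

lemma HasN.nonneg {Q : ℂ → ℂ} {r N : ℝ} (h : HasN Q r N) : 0 ≤ N := by
  refine le_trans ?_ (h.le 1 one_pos)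
  refine integral_nonneg fun x => ?_
  have := h.good.pos _ (mem_Hp_mk (x := x) one_pos)
  simp only [Pi.zero_apply]
  positivity

lemma area_SS {r : ℝ} (hr : 1 < r) : ∃ C : ℝ, 0 < C ∧ ∀ (Q : ℂ → ℂ) (N : ℝ), HasN Q r N → ∀ (A : ℝ → ℝ) (M : ℝ),
    Integrable A → (∀ t, |A t| ≤ M) →
    AA (fun z => z.im * (‖deriv (SS A) z‖ ^ 2 * (Q z).re ^ (2 * r))) ≤ ENNReal.ofReal (C * (M ^ 2 * N)) := by
  refine ⟨3 * (4 ^ 0 * (1 + (4 * (2 * r) ^ 2 + |2 * r * (2 * r - 1)|) / (2 * r * (2 * r - 1)))), ?_, ?_⟩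
  · have : 0 < 2 * r * (2 * r - 1) := by nlinarith
    positivity
  · intro Q N h A M hA hM
    have hM0 : 0 ≤ M := (abs_nonneg _).trans (hM 0)
    have := h.good.green (diffOn_SS hA) (2 * r) (2 * r) 0 (by simp) (by linarith) hM0
      (fun z hz => by simpa using abs_re_SS_le hA hM hz) (fun z hz => by simpa using norm_deriv_SS_le hA hM hz)
      h.int h.le
    refine this.trans (le_of_eq ?_)
    congr 1; ring

lemma area_F {p : ℝ} (hp : 1 < p) : ∃ C : ℝ, 0 < C ∧ ∀ (Q : ℂ → ℂ) (N : ℝ), HasN Q p N → ∀ F : ℂ → ℂ,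
    DifferentiableOn ℂ F Hp → (∀ z ∈ Hp, ‖F z‖ ≤ 8 * Real.pi * ‖Q z‖ ^ 2) →
    AA (fun z => z.im * (‖deriv F z‖ ^ 2 * (Q z).re ^ (2 * (p - 2)))) ≤ ENNReal.ofReal (C * N) := by
  have hpi := Real.pi_pos
  set B := 2 * Real.exp 1 ^ 2 * (8 * Real.pi) with hB
  have hB0 : 0 < B := by positivity
  have hBle : 8 * Real.pi ≤ B := by
    have : 1 ≤ Real.exp 1 := Real.one_le_exp zero_le_one
    have : 1 ≤ Real.exp 1 ^ 2 := one_le_pow₀ this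
    rw [hB]; nlinarith
  set s := 2 * (p - 2) with hs
  refine ⟨3 * (4 ^ 2 * (1 + (4 * s ^ 2 + |s * (s - 1)|) / (2 * p * (2 * p - 1))) * B ^ 2), ?_, ?_⟩
  · have : 0 < 2 * p * (2 * p - 1) := by nlinarith
    positivity
  · intro Q N h F hF hb
    have := h.good.green hF s (2 * p) 2 (by rw [hs]; push_cast; ring) (by linarith) hB0.le
      (fun z hz => by
        refine (Complex.abs_re_le_norm _).trans ((hb z hz).trans ?_)
        gcongr) (fun z hz => by
          have := h.good.cauchy hF 2 0 (B := 8 * Real.pi) (by simpa using hb) hz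
          simpa [hB] using this)
      h.int h.le
    refine this.trans (le_of_eq ?_)
    congr 1; ring

lemma contOn_re {Q : ℂ → ℂ} (hQ : DifferentiableOn ℂ Q Hp) : ContinuousOn (fun z => (Q z).re) Hp :=
  Complex.continuous_re.comp_continuousOn hQ.continuousOn

lemma area {p q : ℝ} (hpq : p.HolderConjugate q) (hp2 : p ≤ 2) : ∃ C : ℝ, 0 < C ∧
    ∀ (QF QG F : ℂ → ℂ) (NF NG : ℝ), HasN QF p NF → HasN QG q NG → DifferentiableOn ℂ F Hp →
    (∀ z ∈ Hp, ‖F z‖ ≤ 8 * Real.pi * ‖QF z‖ ^ 2) → ∀ (A : ℝ → ℝ) (M : ℝ),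
    Integrable A → (∀ t, |A t| ≤ M) →
    AA (fun z => z.im * ‖deriv F z‖ * (QG z).re ^ 2 * ‖deriv (SS A) z‖) ≤
      ENNReal.ofReal (C * (M * NF ^ (1 / p) * NG ^ (1 / q))) := by
  obtain ⟨c1, h1, H1⟩ := area_F hpq.lt
  obtain ⟨c2, h2, H2⟩ := area_SS hpq.symm.lt
  obtain ⟨c3, h3, H3⟩ := area_SS hpq.lt
  have hp0 := hpq.pos
  have hq0 := hpq.symm.pos
  have hpq1 : 1 / p + 1 / q = 1 := by simpa using hpq.inv_add_inv_eq_one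
  set γ := 1 / p - 1 / 2 with hγ
  have hγ0 : 0 ≤ γ := by
    have : 1 / 2 ≤ 1 / p := by gcongr
    linarith
  have hβ0 : 0 ≤ 1 / q := by positivity
  refine ⟨c1 ^ (1 / 2 : ℝ) * c2 ^ (1 / q) * c3 ^ γ, by positivity, ?_⟩
  intro QF QG F NF NG hF hG hFd hFb A M hA hM
  have hNF := hF.nonneg
  have hNG := hG.nonneg
  have hM0 : 0 ≤ M := (abs_nonneg _).trans (hM 0)
  have cS : ContinuousOn (fun z => ‖deriv (SS A) z‖) Hp := ((diffOn_SS hA).deriv isOpen_Hp).continuousOn.norm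
  have cF : ContinuousOn (fun z => ‖deriv F z‖) Hp := (hFd.deriv isOpen_Hp).continuousOn.norm
  have cG := contOn_re hG.good.diff
  have cQ := contOn_re hF.good.diff
  have cim : ContinuousOn (fun z : ℂ => z.im) Hp := Complex.continuous_im.continuousOn
  have pG : ∀ z ∈ Hp, 0 < (QG z).re := hG.good.pos
  have pF : ∀ z ∈ Hp, 0 < (QF z).re := hF.good.pos
  have := holder3 (W := fun z => z.im * ‖deriv F z‖ * (QG z).re ^ 2 * ‖deriv (SS A) z‖)
    (X := fun z => z.im * (‖deriv F z‖ ^ 2 * (QF z).re ^ (2 * (p - 2))))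
    (Y := fun z => z.im * (‖deriv (SS A) z‖ ^ 2 * (QG z).re ^ (2 * q)))
    (Z := fun z => z.im * (‖deriv (SS A) z‖ ^ 2 * (QF z).re ^ (2 * p)))
    (((cim.mul cF).mul (cG.pow 2)).mul cS)
    (cim.mul ((cF.pow 2).mul (cQ.rpow_const fun z hz => Or.inl (pF z hz).ne')))
    (cim.mul ((cS.pow 2).mul (cG.rpow_const fun z hz => Or.inl (pG z hz).ne')))
    (cim.mul ((cS.pow 2).mul (cQ.rpow_const fun z hz => Or.inl (pF z hz).ne')))
    (α := 1 / 2) (β := 1 / q) (γ := γ) (by norm_num) hβ0 hγ0 (by rw [hγ]; linarith)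
    (fun z hz => by have := pF z hz; have : 0 < z.im := hz; positivity)
    (fun z hz => by have := pG z hz; have : 0 < z.im := hz; positivity)
    (fun z hz => by have := pF z hz; have : 0 < z.im := hz; positivity) ?_
  · refine this.trans ?_
    refine (mul_le_mul' (mul_le_mul' (ENNReal.rpow_le_rpow (H1 QF NF hF F hFd hFb) (by norm_num))
      (ENNReal.rpow_le_rpow (H2 QG NG hG A M hA hM) hβ0)) (ENNReal.rpow_le_rpow (H3 QF NF hF A M hA hM) hγ0)).trans ?_
    rw [ENNReal.ofReal_rpow_of_nonneg (by positivity) (by norm_num),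
      ENNReal.ofReal_rpow_of_nonneg (by positivity) hβ0, ENNReal.ofReal_rpow_of_nonneg (by positivity) hγ0,
      ← ENNReal.ofReal_mul (by positivity), ← ENNReal.ofReal_mul (by positivity)]
    apply ENNReal.ofReal_le_ofReal
    apply le_of_eq
    rw [Real.mul_rpow h1.le hNF, Real.mul_rpow h2.le (by positivity), Real.mul_rpow (sq_nonneg M) hNG,
      Real.mul_rpow h3.le (by positivity), Real.mul_rpow (sq_nonneg M) hNF]
    have e1 : NF ^ (1 / p) = NF ^ (1 / 2 : ℝ) * NF ^ γ := by
      rw [← Real.rpow_add_of_nonneg hNF (by norm_num) hγ0]; congr 1; rw [hγ]; ring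
    have e2 : M = (M ^ 2) ^ (1 / q) * (M ^ 2) ^ γ := by
      rw [← Real.rpow_add_of_nonneg (sq_nonneg M) hβ0 hγ0,
        show 1 / q + γ = 1 / 2 by rw [hγ]; linarith, ← Real.sqrt_eq_rpow, Real.sqrt_sq hM0]
    rw [e1]
    nth_rw 3 [e2]
    ring
  · intro z hz
    have hv := pF z hz
    have hw := pG z hz
    have hy : 0 < z.im := hz
    have hS := norm_nonneg (deriv (SS A) z)
    have hFn := norm_nonneg (deriv F z)
    generalize ‖deriv (SS A) z‖ = S at *
    generalize ‖deriv F z‖ = f at *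
    generalize (QF z).re = v at *
    generalize (QG z).re = w at *
    generalize z.im = y at *
    have e2 : ∀ s : ℝ, 0 ≤ s → (s ^ 2) ^ (1 / q) * (s ^ 2) ^ γ = s := by
      intro s hs
      rw [← Real.rpow_add_of_nonneg (sq_nonneg s) hβ0 hγ0,
        show 1 / q + γ = 1 / 2 by rw [hγ]; linarith, ← Real.sqrt_eq_rpow, Real.sqrt_sq hs]
    have e3 : y ^ (1 / 2 : ℝ) * y ^ (1 / q) * y ^ γ = y := by
      rw [← Real.rpow_add hy, ← Real.rpow_add hy, show 1 / 2 + 1 / q + γ = 1 by rw [hγ]; linarith, Real.rpow_one]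
    have e4 : (v ^ (2 * (p - 2))) ^ (1 / 2 : ℝ) * (v ^ (2 * p)) ^ γ = 1 := by
      rw [← Real.rpow_mul hv.le, ← Real.rpow_mul hv.le, ← Real.rpow_add hv]
      rw [show 2 * (p - 2) * (1 / 2) + 2 * p * γ = 0 by rw [hγ]; field_simp; ring, Real.rpow_zero]
    have e5 : (w ^ (2 * q)) ^ (1 / q) = w ^ 2 := by
      rw [← Real.rpow_mul hw.le, ← Real.rpow_natCast]; congr 1; field_simp; norm_num
    have e6 : (f ^ 2) ^ (1 / 2 : ℝ) = f := by rw [← Real.sqrt_eq_rpow, Real.sqrt_sq hFn]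
    have hS2 := e2 S hS
    apply le_of_eq
    rw [Real.mul_rpow hy.le (by positivity), Real.mul_rpow (by positivity) (by positivity),
      Real.mul_rpow hy.le (by positivity), Real.mul_rpow (by positivity) (by positivity),
      Real.mul_rpow hy.le (by positivity), Real.mul_rpow (by positivity) (by positivity), e5, e6]
    calc y * f * w ^ 2 * S = (y ^ (1 / 2 : ℝ) * y ^ (1 / q) * y ^ γ) * f * w ^ 2 * ((S ^ 2) ^ (1 / q) * (S ^ 2) ^ γ)
          * ((v ^ (2 * (p - 2))) ^ (1 / 2 : ℝ) * (v ^ (2 * p)) ^ γ) := by rw [e3, hS2, e4, mul_one]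
      _ = _ := by ring
end CC

namespace CC
open Set Filter Topology
open scoped ENNReal

lemma mk_eq (x y : ℝ) : (⟨x, y⟩ : ℂ) = (x : ℂ) + y * Complex.I := by apply Complex.ext <;> simp

lemma line_zero {k : ℂ → ℂ} (hk : DifferentiableOn ℂ k Hp) {s x C : ℝ} (hs : 0 < s) (hC : 0 ≤ C)
    (hb : ∀ z : ℂ, s ≤ z.im → ‖k z‖ ≤ C / ((z.re - x) ^ 2 + z.im ^ 2)) : ∫ t : ℝ, k ⟨t, s⟩ = 0 := by
  have hpi := Real.pi_pos
  have hPK : ∀ τ, 0 < τ → ∀ t, C / ((t - x) ^ 2 + τ ^ 2) = (C * Real.pi / τ) * PK τ (t - x) := by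
    intro τ hτ t; unfold PK; field_simp
  have h_intg : ∀ τ, s ≤ τ → Integrable fun t : ℝ => k ⟨t, τ⟩ := by
    intro τ hτ
    have hτ0 : 0 < τ := by linarith
    refine (((integrable_PK1 hτ0).comp_sub_right x).const_mul (C * Real.pi / τ)).mono'
      (continuous_line hk hτ0).aestronglyMeasurable (Eventually.of_forall fun t => ?_)
    rw [← hPK τ hτ0]
    exact hb ⟨t, τ⟩ hτ
  have hbound : ∀ τ, s ≤ τ → ‖∫ t : ℝ, k ⟨t, τ⟩‖ ≤ C * Real.pi / τ := by
    intro τ hτ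
    have hτ0 : 0 < τ := by linarith
    refine (norm_integral_le_of_norm_le (((integrable_PK1 hτ0).comp_sub_right x).const_mul (C * Real.pi / τ))
      (Eventually.of_forall fun t => ?_)).trans ?_
    · rw [← hPK τ hτ0]
      exact hb ⟨t, τ⟩ hτ
    · rw [integral_const_mul, integral_sub_right_eq_self (fun u => PK τ u) x, integral_PK1 hτ0, mul_one]
  have hshift : ∀ τ, s ≤ τ → ∫ t : ℝ, k ⟨t, s⟩ = ∫ t : ℝ, k ⟨t, τ⟩ := by
    intro τ hτ
    have hside : ∀ σ : ℝ, (σ = 1 ∨ σ = -1) → Tendsto (fun R : ℝ => ∫ y in s..τ, k ⟨x + σ * R, y⟩) atTop (𝓝 0) := by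
      intro σ hσ
      rw [tendsto_zero_iff_norm_tendsto_zero]
      have hlim : Tendsto (fun R : ℝ => C / R ^ 2 * |τ - s|) atTop (𝓝 0) := by
        have : Tendsto (fun R : ℝ => C / R ^ 2) atTop (𝓝 0) :=
          Tendsto.div_atTop tendsto_const_nhds (tendsto_pow_atTop two_ne_zero)
        simpa using this.mul_const |τ - s|
      refine squeeze_zero' (Eventually.of_forall fun R => norm_nonneg _) ?_ hlim
      filter_upwards [eventually_gt_atTop 0] with R hR
      refine intervalIntegral.norm_integral_le_of_norm_le_const fun y hy => ?_
      rw [uIoc_of_le hτ] at hy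
      refine (hb ⟨x + σ * R, y⟩ hy.1.le).trans ?_
      have hσ2 : σ ^ 2 = 1 := by rcases hσ with h | h <;> rw [h] <;> norm_num
      have e : (x + σ * R - x) ^ 2 = R ^ 2 := by
        rw [show x + σ * R - x = σ * R by ring, mul_pow, hσ2, one_mul]
      simp only [e]
      gcongr
      nlinarith [sq_nonneg y]
    have h1 := (intervalIntegral_tendsto_integral (h_intg s le_rfl)
      (tendsto_atBot_add_const_left atTop x tendsto_neg_atTop_atBot) (tendsto_atTop_add_const_left atTop x tendsto_id))
    have h2 := (intervalIntegral_tendsto_integral (h_intg τ hτ)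
      (tendsto_atBot_add_const_left atTop x tendsto_neg_atTop_atBot) (tendsto_atTop_add_const_left atTop x tendsto_id))
    have h3 := ((h1.sub h2).add ((hside 1 (Or.inl rfl)).const_mul Complex.I)).sub
      ((hside (-1) (Or.inr rfl)).const_mul Complex.I)
    have h4 : ∀ R : ℝ, _ = (0:ℂ) := fun R =>
      Complex.integral_boundary_rect_eq_zero_of_differentiableOn k ⟨x + -R, s⟩ ⟨x + R, τ⟩
      (hk.mono fun z hz => by
        have := hz.2
        simp only [mem_preimage, uIcc_of_le hτ] at this
        exact lt_of_lt_of_le hs this.1)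
    simp only [← mk_eq, smul_eq_mul] at h4
    simp only [id, neg_one_mul, one_mul, h4] at h3
    have h5 := tendsto_nhds_unique h3 tendsto_const_nhds
    simp only [mul_zero, add_zero, sub_zero] at h5
    exact sub_eq_zero.mp h5
  have hlim : Tendsto (fun τ : ℝ => C * Real.pi / τ) atTop (𝓝 0) := Tendsto.div_atTop tendsto_const_nhds tendsto_id
  have : ‖∫ t : ℝ, k ⟨t, s⟩‖ ≤ 0 := by
    refine ge_of_tendsto hlim ?_
    filter_upwards [eventually_ge_atTop s] with τ hτ
    rw [hshift τ hτ]
    exact hbound τ hτ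
  simpa using this

lemma poisson {Φ : ℂ → ℂ} (hΦ : DifferentiableOn ℂ Φ Hp) {B : ℝ} (hb : ∀ z ∈ Hp, ‖Φ z‖ ≤ B) {s : ℝ} (hs : 0 < s)
    (x : ℝ) : Φ ⟨x, 2 * s⟩ = ∫ t : ℝ, Φ ⟨t, s⟩ * (PK s (x - t) : ℂ) := by
  have hpi := Real.pi_pos
  set z0 : ℂ := ⟨x, 2 * s⟩ with hz0
  have hz0H : z0 ∈ Hp := mem_Hp_mk (by linarith)
  have hB : 0 ≤ B := (norm_nonneg _).trans (hb z0 hz0H)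
  have hd : DifferentiableOn ℂ (dslope Φ z0) Hp :=
    (Complex.differentiableOn_dslope (isOpen_Hp.mem_nhds hz0H)).2 hΦ
  have hne : ∀ z ∈ Hp, z - (x : ℂ) ≠ 0 := by
    intro z hz h
    have h1 : z.im = (0 : ℂ).im := by rw [← h]; simp
    have : 0 < z.im := hz
    simp at h1; linarith
  have hk : DifferentiableOn ℂ (fun z => dslope Φ z0 z / (z - x)) Hp :=
    hd.div (by fun_prop) hne
  have hcb : Metric.closedBall z0 (s / 2) ⊆ Hp := by
    intro w hw
    rw [Metric.mem_closedBall, dist_eq_norm] at hw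
    have := (abs_le.mp ((Complex.abs_im_le_norm (w - z0)).trans hw)).1
    simp [hz0] at this
    show 0 < w.im
    linarith
  obtain ⟨B1, hB1⟩ := (isCompact_closedBall z0 (s / 2)).exists_bound_of_continuousOn (hd.continuousOn.mono hcb)
  have hB10 : 0 ≤ B1 := (norm_nonneg _).trans (hB1 z0 (Metric.mem_closedBall_self (by linarith)))
  have hdist : ‖z0 - x‖ = 2 * s := by
    rw [show z0 - (x:ℂ) = ((2 * s : ℝ) : ℂ) * Complex.I by apply Complex.ext <;> simp [hz0], norm_mul, Complex.norm_real,
      Complex.norm_I, mul_one, Real.norm_of_nonneg (by linarith)]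
  have key : ∀ z ∈ Hp, ‖dslope Φ z0 z‖ * ‖z - x‖ ≤ 10 * B + 3 * s * B1 := by
    intro z hz
    have htri : ‖z - x‖ ≤ ‖z - z0‖ + 2 * s := by
      rw [← hdist, show z - (x:ℂ) = (z - z0) + (z0 - x) by ring]; exact norm_add_le _ _
    by_cases h : ‖z - z0‖ ≤ s / 2
    · have h1 := hB1 z (by rwa [Metric.mem_closedBall, dist_eq_norm])
      calc _ ≤ B1 * (3 * s) := by gcongr; linarith
        _ ≤ _ := by nlinarith
    · push Not at h
      have hne : z ≠ z0 := by rintro rfl; simp at h; linarith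
      have hpos : 0 < ‖z - z0‖ := by linarith
      rw [dslope_of_ne _ hne, slope_def_field, norm_div, div_mul_eq_mul_div, div_le_iff₀ hpos]
      have h1 : ‖Φ z - Φ z0‖ ≤ 2 * B := (norm_sub_le _ _).trans (by linarith [hb z hz, hb z0 hz0H])
      have h2 : ‖z - x‖ ≤ 5 * ‖z - z0‖ := by linarith
      calc _ ≤ 2 * B * (5 * ‖z - z0‖) := by gcongr
        _ ≤ (10 * B + 3 * s * B1) * ‖z - z0‖ := by
          have : 0 ≤ 3 * s * B1 * ‖z - z0‖ := by positivity
          linarith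
  have hzero := line_zero hk hs (x := x) (C := 10 * B + 3 * s * B1) (by positivity) (by
    intro z hz
    have hzH : z ∈ Hp := lt_of_lt_of_le hs hz
    have h1 : (z.re - x) ^ 2 + z.im ^ 2 = ‖z - x‖ ^ 2 := by
      rw [← Complex.normSq_eq_norm_sq, Complex.normSq_apply]; simp; ring
    have h2 : 0 < ‖z - x‖ := norm_pos_iff.2 (hne z hzH)
    rw [h1, norm_div, div_le_div_iff₀ h2 (by positivity)]
    nlinarith [key z hzH])
  have e : ∀ t : ℝ, dslope Φ z0 ⟨t, s⟩ / (⟨t, s⟩ - (x:ℂ)) =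
      ((Real.pi / s : ℝ) : ℂ) * (Φ ⟨t, s⟩ * (PK s (x - t) : ℂ) - Φ z0 * (PK s (x - t) : ℂ)) := by
    intro t
    have hne1 : (⟨t, s⟩ : ℂ) ≠ z0 := by
      intro h; have := congrArg Complex.im h; simp [hz0] at this; linarith
    have hne2 : (⟨t, s⟩ : ℂ) - z0 ≠ 0 := sub_ne_zero.2 hne1
    have hne3 := hne ⟨t, s⟩ (mem_Hp_mk hs)
    rw [dslope_of_ne _ hne1, slope_def_field, ← sub_mul]
    have hprod : ((⟨t, s⟩ : ℂ) - z0) * (⟨t, s⟩ - (x:ℂ)) = (((x - t) ^ 2 + s ^ 2 : ℝ) : ℂ) := by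
      rw [hz0, mk_eq, mk_eq]; push_cast; linear_combination (-(s:ℂ) ^ 2) * Complex.I_sq
    have hpos : (0:ℝ) < (x - t) ^ 2 + s ^ 2 := by positivity
    rw [div_div, hprod]
    unfold PK
    have : (((x - t) ^ 2 + s ^ 2 : ℝ) : ℂ) ≠ 0 := by exact_mod_cast hpos.ne'
    have hsC : (s : ℂ) ≠ 0 := by exact_mod_cast hs.ne'
    have hpiC : (Real.pi : ℂ) ≠ 0 := by exact_mod_cast hpi.ne'
    rw [Complex.ofReal_div, Complex.ofReal_div, Complex.ofReal_mul]
    field_simp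
  simp only [e] at hzero
  rw [integral_const_mul] at hzero
  have hPKi : Integrable fun t => ((PK s (x - t) : ℝ) : ℂ) := ((integrable_PK1 hs).comp_sub_left x).ofReal
  have hPKi2 : Integrable fun t : ℝ => Φ ⟨t, s⟩ * ((PK s (x - t) : ℝ) : ℂ) :=
    hPKi.bdd_mul (c := B) (continuous_line hΦ hs).aestronglyMeasurable
      (Eventually.of_forall fun t => hb _ (mem_Hp_mk hs))
  rw [integral_sub hPKi2 (hPKi.const_mul _), integral_const_mul, integral_complex_ofReal,
    integral_sub_left_eq_self (fun u => PK s u) volume, integral_PK1 hs] at hzero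
  have hps : ((Real.pi / s : ℝ) : ℂ) ≠ 0 := by
    have : Real.pi / s ≠ 0 := by positivity
    exact_mod_cast this
  have := (mul_eq_zero.1 hzero).resolve_left hps
  simp only [Complex.ofReal_one, mul_one] at this
  exact (sub_eq_zero.1 this).symm

lemma tonelli_chain {K : ℝ → ℝ≥0∞} (hK : Measurable K) (n : ℕ) :
    ∫⁻ y in Ioi (0:ℝ), ENNReal.ofReal (y ^ n) * ∫⁻ s in Ioi y, K s ≤
      ∫⁻ s in Ioi (0:ℝ), ENNReal.ofReal (s ^ (n + 1)) * K s := by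
  let E : Set (ℝ × ℝ) := {w | 0 < w.1 ∧ w.1 < w.2}
  have hE : MeasurableSet E := (measurableSet_lt measurable_const measurable_fst).inter
    (measurableSet_lt measurable_fst measurable_snd)
  let φ : ℝ × ℝ → ℝ≥0∞ := E.indicator fun w => ENNReal.ofReal (w.1 ^ n) * K w.2
  have hφ : Measurable φ := Measurable.indicator (by fun_prop) hE
  have h1 : ∫⁻ y in Ioi (0:ℝ), ENNReal.ofReal (y ^ n) * ∫⁻ s in Ioi y, K s = ∫⁻ y, ∫⁻ s, φ (y, s) := by
    rw [← lintegral_indicator measurableSet_Ioi]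
    refine lintegral_congr fun y => ?_
    by_cases hy : 0 < y
    · rw [indicator_of_mem (show y ∈ Ioi (0:ℝ) from hy), ← lintegral_const_mul _ hK, ← lintegral_indicator measurableSet_Ioi]
      refine lintegral_congr fun s => ?_
      by_cases hs : y < s
      · rw [indicator_of_mem (show s ∈ Ioi y from hs)]
        have : φ (y, s) = _ := indicator_of_mem (show (y, s) ∈ E from ⟨hy, hs⟩) _
        exact this.symm
      · rw [indicator_of_notMem (show s ∉ Ioi y from hs)]
        have : φ (y, s) = 0 := indicator_of_notMem (show (y, s) ∉ E from fun h => hs h.2) _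
        exact this.symm
    · rw [indicator_of_notMem (show y ∉ Ioi (0:ℝ) from hy)]
      symm
      rw [lintegral_eq_zero_iff (by fun_prop)]
      refine Eventually.of_forall fun s => ?_
      exact indicator_of_notMem (show (y, s) ∉ E from fun h => hy h.1) _
  rw [h1, lintegral_lintegral_swap (f := fun y s => φ (y, s)) hφ.aemeasurable, ← lintegral_indicator measurableSet_Ioi]
  refine lintegral_mono fun s => ?_
  by_cases hs : 0 < s
  · rw [indicator_of_mem (show s ∈ Ioi (0:ℝ) from hs)]
    have : ∀ y, φ (y, s) ≤ (Ioo 0 s).indicator (fun _ => ENNReal.ofReal (s ^ n) * K s) y := by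
      intro y
      by_cases h : (y, s) ∈ E
      · rw [indicator_of_mem (show y ∈ Ioo 0 s from h)]
        have : φ (y, s) = ENNReal.ofReal (y ^ n) * K s := indicator_of_mem h _
        rw [this]
        have h0 : 0 ≤ y := h.1.le
        have h1 : y ≤ s := h.2.le
        gcongr
      · have : φ (y, s) = 0 := indicator_of_notMem h _
        rw [this]; exact zero_le
    refine (lintegral_mono this).trans ?_
    rw [lintegral_indicator measurableSet_Ioo, setLIntegral_const, Real.volume_Ioo, sub_zero, pow_succ,
      ENNReal.ofReal_mul (by positivity)]
    apply le_of_eq; ring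
  · rw [indicator_of_notMem (show s ∉ Ioi (0:ℝ) from hs)]
    rw [nonpos_iff_eq_zero, lintegral_eq_zero_iff (by fun_prop)]
    refine Eventually.of_forall fun y => ?_
    exact indicator_of_notMem (show (y, s) ∉ E from fun h => hs (h.1.trans h.2)) _

lemma tail_bound {J J' : ℝ → ℂ} (hd : ∀ y, 0 ≤ y → HasDerivAt J (J' y) y) (hc : ContinuousOn J' (Ici 0))
    (hlim : Tendsto J atTop (𝓝 0)) {y : ℝ} (hy : 0 ≤ y) : ‖J y‖ₑ ≤ ∫⁻ s in Ioi y, ‖J' s‖ₑ := by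
  by_cases h : ∫⁻ s in Ioi y, ‖J' s‖ₑ = ∞
  · rw [h]; exact le_top
  · have hsub : Ioi y ⊆ Ici 0 := fun s hs => hy.trans (le_of_lt hs)
    have hi : IntegrableOn J' (Ioi y) := ⟨(hc.mono hsub).aestronglyMeasurable measurableSet_Ioi, lt_top_iff_ne_top.2 h⟩
    have := integral_Ioi_of_hasDerivAt_of_tendsto' (fun x hx => hd x (hy.trans hx)) hi hlim
    rw [zero_sub] at this
    rw [← enorm_neg, ← this]
    exact enorm_integral_le_lintegral_enorm _

lemma chain_all {J : ℕ → ℝ → ℂ} {c : ℂ} (hc : ‖c‖ = 1) (hd : ∀ j, ∀ y, 0 ≤ y → HasDerivAt (J j) (c * J (j + 1) y) y)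
    (hlim : ∀ j, Tendsto (J j) atTop (𝓝 0)) (n : ℕ) :
    ‖J 0 0‖ₑ ≤ ∫⁻ y in Ioi (0:ℝ), ENNReal.ofReal (y ^ n) * ‖J (n + 1) y‖ₑ := by
  have hcont : ∀ j, ContinuousOn (J j) (Ici 0) := fun j y hy => (hd j y hy).continuousAt.continuousWithinAt
  have hce : ‖c‖ₑ = 1 := by rw [← ofReal_norm, hc]; simp
  have htail : ∀ j y, 0 ≤ y → ‖J j y‖ₑ ≤ ∫⁻ s in Ioi y, ‖J (j + 1) s‖ₑ := by
    intro j y hy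
    have := tail_bound (hd j) ((hcont (j + 1)).const_smul c) (hlim j) hy
    simpa only [enorm_mul, hce, one_mul] using this
  induction n with
  | zero => simpa using htail 0 0 le_rfl
  | succ n ih =>
    refine ih.trans ?_
    let K : ℝ → ℝ≥0∞ := fun s => ‖J (n + 1 + 1) (max s 0)‖ₑ
    have hKc : Continuous fun s => J (n + 1 + 1) (max s 0) :=
      (hcont (n + 1 + 1)).comp_continuous (by fun_prop) fun s => le_max_right s 0
    have hK : Measurable K := hKc.measurable.enorm
    have h1 : ∀ y, 0 ≤ y → ∫⁻ s in Ioi y, ‖J (n + 1 + 1) s‖ₑ = ∫⁻ s in Ioi y, K s := by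
      intro y hy
      refine setLIntegral_congr_fun measurableSet_Ioi fun s hs => ?_
      simp only [K]
      rw [max_eq_left (hy.trans (le_of_lt hs))]
    have h2 : ∫⁻ s in Ioi (0:ℝ), ENNReal.ofReal (s ^ (n + 1)) * K s =
        ∫⁻ y in Ioi (0:ℝ), ENNReal.ofReal (y ^ (n + 1)) * ‖J (n + 1 + 1) y‖ₑ := by
      refine setLIntegral_congr_fun measurableSet_Ioi fun s hs => ?_
      simp only [K]
      rw [max_eq_left (le_of_lt hs)]
    rw [← h2]
    refine le_trans ?_ (tonelli_chain hK n)
    refine setLIntegral_mono' measurableSet_Ioi fun y hy => ?_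
    rw [← h1 y (le_of_lt hy)]
    exact mul_le_mul_right (htail _ _ (le_of_lt hy)) _
end CC

namespace CC
open Set Filter Topology
open scoped ENNReal

noncomputable def dS (a : SchwartzMap ℝ ℂ) : SchwartzMap ℝ ℂ := SchwartzMap.derivCLM ℂ ℂ a

lemma coe_dS (a : SchwartzMap ℝ ℂ) : ⇑(dS a) = deriv ⇑a := by
  funext x; exact SchwartzMap.derivCLM_apply ℂ a x

lemma coe_dS_iter (k : ℕ) (a : SchwartzMap ℝ ℂ) : ⇑(dS^[k] a) = deriv^[k] ⇑a := by
  induction k with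
  | zero => rfl
  | succ k ih => rw [Function.iterate_succ_apply', Function.iterate_succ_apply', coe_dS, ih]

lemma hasDerivAt_S (a : SchwartzMap ℝ ℂ) (x : ℝ) : HasDerivAt ⇑a (dS a x) x := by
  rw [coe_dS]; exact a.differentiableAt.hasDerivAt

lemma CT_parts {u u' : ℝ → ℂ} (hd : ∀ t, HasDerivAt u (u' t) t) (hu : Integrable u) (hu' : Integrable u')
    {z : ℂ} (hz : z ∈ Hp) : HasDerivAt (CT u) (CT u' z) z := by
  refine (hasDerivAt_CT hu hz).congr_deriv ?_
  have h1 : ∀ t : ℝ, HasDerivAt (fun t : ℝ => u t / ((t : ℂ) - z)) (u' t / ((t : ℂ) - z) - u t / ((t : ℂ) - z) ^ 2) t := by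
    intro t
    have hne := sub_ne (t := t) hz
    have h := (hd t).div ((Complex.ofRealCLM.hasDerivAt (x := t)).sub_const z) hne
    refine h.congr_deriv ?_
    simp
    field_simp
  have := integral_eq_zero_of_hasDerivAt_of_integrable h1 ((integrable_CT hu' hz).sub (integrable_CT2 hu hz))
    (integrable_CT hu hz)
  rw [integral_sub (integrable_CT hu' hz) (integrable_CT2 hu hz)] at this
  exact (sub_eq_zero.1 this).symm

lemma hasDerivAt_CTS (u : SchwartzMap ℝ ℂ) {z : ℂ} (hz : z ∈ Hp) : HasDerivAt (CT u) (CT (dS u) z) z :=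
  CT_parts (hasDerivAt_S u) u.integrable (dS u).integrable hz

lemma iteratedDeriv_CTS (u : SchwartzMap ℝ ℂ) (n : ℕ) {z : ℂ} (hz : z ∈ Hp) :
    iteratedDeriv n (CT u) z = CT (dS^[n] u) z := by
  induction n generalizing z with
  | zero => simp
  | succ n ih =>
    rw [iteratedDeriv_succ, Function.iterate_succ_apply']
    have : iteratedDeriv n (CT u) =ᶠ[𝓝 z] CT (dS^[n] u) := by
      filter_upwards [isOpen_Hp.mem_nhds hz] with w hw using ih hw
    rw [this.deriv_eq]
    exact (hasDerivAt_CTS _ hz).deriv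

noncomputable def N1 (u : SchwartzMap ℝ ℂ) : ℝ := ∫ t, ‖u t‖

lemma N1_nonneg (u : SchwartzMap ℝ ℂ) : 0 ≤ N1 u := integral_nonneg fun _ => norm_nonneg _

lemma norm_CTS_le (u : SchwartzMap ℝ ℂ) {z : ℂ} (hz : z ∈ Hp) : ‖CT u z‖ ≤ N1 u / z.im := by
  have hz' : 0 < z.im := hz
  unfold CT N1
  rw [div_eq_mul_inv, ← integral_mul_const]
  refine norm_integral_le_of_norm_le (u.integrable.norm.mul_const _) (Eventually.of_forall fun t => ?_)
  rw [norm_div, div_eq_mul_inv]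
  gcongr
  exact im_le_norm_sub t z

noncomputable def PH (u w : SchwartzMap ℝ ℂ) (z : ℂ) : ℂ := CT u z * CT w z

lemma hasDerivAt_PH (u w : SchwartzMap ℝ ℂ) {z : ℂ} (hz : z ∈ Hp) :
    HasDerivAt (PH u w) (PH (dS u) w z + PH u (dS w) z) z :=
  (hasDerivAt_CTS u hz).mul (hasDerivAt_CTS w hz)

lemma diffOn_PH (u w : SchwartzMap ℝ ℂ) : DifferentiableOn ℂ (PH u w) Hp := fun _ hz =>
  (hasDerivAt_PH u w hz).differentiableAt.differentiableWithinAt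

lemma norm_PH_le (u w : SchwartzMap ℝ ℂ) {z : ℂ} (hz : z ∈ Hp) : ‖PH u w z‖ ≤ N1 u * N1 w / z.im ^ 2 := by
  have hz' : 0 < z.im := hz
  unfold PH
  rw [norm_mul]
  refine (mul_le_mul (norm_CTS_le u hz) (norm_CTS_le w hz) (norm_nonneg _)
    (div_nonneg (N1_nonneg _) hz'.le)).trans (le_of_eq ?_)
  field_simp

lemma integrable_aPH (a u w : SchwartzMap ℝ ℂ) {y : ℝ} (hy : 0 < y) :
    Integrable fun x : ℝ => a x * PH u w ⟨x, y⟩ :=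
  a.integrable.mul_bdd (c := N1 u * N1 w / y ^ 2) (continuous_line (diffOn_PH u w) hy).aestronglyMeasurable
    (Eventually.of_forall fun x => norm_PH_le u w (mem_Hp_mk hy))

/-- the trilinear form at height `y` -/
noncomputable def TT (y : ℝ) (a u w : SchwartzMap ℝ ℂ) : ℂ := ∫ x : ℝ, a x * PH u w ⟨x, y⟩

lemma TT_parts {y : ℝ} (hy : 0 < y) (a u w : SchwartzMap ℝ ℂ) :
    TT y (dS a) u w + (TT y a (dS u) w + TT y a u (dS w)) = 0 := by
  unfold TT
  have i1 := integrable_aPH (dS a) u w hy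
  have i2 := integrable_aPH a (dS u) w hy
  have i3 := integrable_aPH a u (dS w) hy
  have i23 : Integrable fun x : ℝ => a x * PH (dS u) w ⟨x, y⟩ + a x * PH u (dS w) ⟨x, y⟩ := i2.add i3
  rw [← integral_add i2 i3, ← integral_add i1 i23]
  refine integral_eq_zero_of_hasDerivAt_of_integrable (f := fun x : ℝ => a x * PH u w ⟨x, y⟩) (fun x => ?_)
    (i1.add i23) (integrable_aPH a u w hy)
  have h := (hasDerivAt_S a x).mul ((hasDerivAt_PH u w (mem_Hp_mk (x := x) hy)).comp x (hasDerivAt_mk_x x y))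
  refine h.congr_deriv ?_
  simp
  ring

lemma norm_TT_le {y : ℝ} (hy : 0 < y) (a u w : SchwartzMap ℝ ℂ) : ‖TT y a u w‖ ≤ N1 a * (N1 u * N1 w) / y ^ 2 := by
  have e : N1 a * (N1 u * N1 w) / y ^ 2 = ∫ t, ‖a t‖ * (N1 u * N1 w / y ^ 2) := by
    rw [integral_mul_const, mul_div_assoc]; rfl
  rw [e]
  unfold TT
  refine norm_integral_le_of_norm_le (a.integrable.norm.mul_const _) (Eventually.of_forall fun t => ?_)
  rw [norm_mul]
  gcongr
  exact norm_PH_le u w (mem_Hp_mk hy)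

lemma hasDerivAt_TT {y : ℝ} (hy : 0 < y) (a u w : SchwartzMap ℝ ℂ) :
    HasDerivAt (fun y => TT y a u w) (-Complex.I * TT y (dS a) u w) y := by
  have e : -Complex.I * TT y (dS a) u w = ∫ x : ℝ, a x * ((PH (dS u) w ⟨x, y⟩ + PH u (dS w) ⟨x, y⟩) * Complex.I) := by
    have h := TT_parts hy a u w
    have i2 := integrable_aPH a (dS u) w hy
    have i3 := integrable_aPH a u (dS w) hy
    have : TT y (dS a) u w = - (TT y a (dS u) w + TT y a u (dS w)) := eq_neg_of_add_eq_zero_left h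
    rw [this]
    unfold TT
    rw [← integral_add i2 i3, neg_mul_neg, ← integral_const_mul]
    congr 1; funext x; ring
  rw [e]
  have hb : ∀ y' ∈ Metric.ball y (y / 2), 0 < y' ∧ y / 2 ≤ y' := by
    intro y' h
    rw [Metric.mem_ball, Real.dist_eq, abs_lt] at h
    constructor <;> linarith
  set B := (N1 (dS u) * N1 w + N1 u * N1 (dS w)) / (y / 2) ^ 2
  refine (hasDerivAt_integral_of_dominated_loc_of_deriv_le (F := fun y (x : ℝ) => a x * PH u w ⟨x, y⟩)
    (F' := fun y (x : ℝ) => a x * ((PH (dS u) w ⟨x, y⟩ + PH u (dS w) ⟨x, y⟩) * Complex.I))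
    (bound := fun t => ‖a t‖ * B) (Metric.ball_mem_nhds y (half_pos hy))
    ?_ (integrable_aPH a u w hy) ?_ ?_ (a.integrable.norm.mul_const _) ?_).2
  · filter_upwards [lt_mem_nhds hy] with y' hy' using (integrable_aPH a u w hy').aestronglyMeasurable
  · refine (a.continuous.mul (((continuous_line (diffOn_PH _ _) hy).add
      (continuous_line (diffOn_PH _ _) hy)).mul continuous_const)).aestronglyMeasurable
  · refine Eventually.of_forall fun t y' hy' => ?_
    obtain ⟨h1, h2⟩ := hb y' hy'
    rw [norm_mul, norm_mul, Complex.norm_I, mul_one]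
    gcongr
    refine (norm_add_le _ _).trans ((add_le_add (norm_PH_le _ _ (mem_Hp_mk h1)) (norm_PH_le _ _ (mem_Hp_mk h1))).trans ?_)
    rw [← add_div]
    have := mul_nonneg (N1_nonneg (dS u)) (N1_nonneg w)
    have := mul_nonneg (N1_nonneg u) (N1_nonneg (dS w))
    simp only [B]
    gcongr
  · refine Eventually.of_forall fun t y' hy' => ?_
    obtain ⟨h1, h2⟩ := hb y' hy'
    have h := ((hasDerivAt_PH u w (mem_Hp_mk (x := t) h1)).comp y' (hasDerivAt_mk_y t y')).const_mul (a t)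
    exact h
end CC

namespace CC
open Set Filter Topology
open scoped ENNReal

lemma PK_even (s u : ℝ) : PK s (-u) = PK s u := by unfold PK; rw [neg_sq]

lemma deriv_SS_parts {ρ ρ' : ℝ → ℝ} (hd : ∀ t, HasDerivAt ρ (ρ' t) t) (h : Integrable ρ) (h' : Integrable ρ')
    {z : ℂ} (hz : z ∈ Hp) : deriv (SS ρ) z = SS ρ' z := by
  have := (CT_parts (u := fun t => (ρ t : ℂ)) (u' := fun t => (ρ' t : ℂ)) (fun t => (hd t).ofReal_comp)
    h.ofReal h'.ofReal hz).const_mul (1 / (Real.pi * Complex.I) : ℂ)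
  exact this.deriv

lemma re_int (b : SchwartzMap ℝ ℂ) : Integrable fun t => (b t).re := b.integrable.re
lemma im_int (b : SchwartzMap ℝ ℂ) : Integrable fun t => (b t).im := b.integrable.im

lemma inner_bound (b : SchwartzMap ℝ ℂ) {s : ℝ} (hs : 0 < s) (t : ℝ) :
    ‖∫ x : ℝ, dS b x * (PK s (x - t) : ℂ)‖ ≤
      ‖deriv (SS fun t => (b t).re) ⟨t, s⟩‖ + ‖deriv (SS fun t => (b t).im) ⟨t, s⟩‖ := by
  have hz : (⟨t, s⟩ : ℂ) ∈ Hp := mem_Hp_mk hs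
  have h1 : ∀ t, HasDerivAt (fun t => (b t).re) (dS b t).re t := fun t =>
    Complex.reCLM.hasFDerivAt.comp_hasDerivAt t (hasDerivAt_S b t)
  have h2 : ∀ t, HasDerivAt (fun t => (b t).im) (dS b t).im t := fun t =>
    Complex.imCLM.hasFDerivAt.comp_hasDerivAt t (hasDerivAt_S b t)
  rw [deriv_SS_parts h1 (re_int b) (re_int _) hz, deriv_SS_parts h2 (im_int b) (im_int _) hz]
  have e1 := re_SS (re_int (dS b)) hz
  have e2 := re_SS (im_int (dS b)) hz
  have i1 := integrable_PK (re_int (dS b)) hz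
  have i2 := integrable_PK (im_int (dS b)) hz
  have e : ∫ x : ℝ, dS b x * (PK s (x - t) : ℂ) =
      ((SS (fun t => (dS b t).re) ⟨t, s⟩).re : ℂ) + ((SS (fun t => (dS b t).im) ⟨t, s⟩).re : ℂ) * Complex.I := by
    rw [e1, e2, ← integral_complex_ofReal, ← integral_complex_ofReal, ← integral_mul_const,
      ← integral_add i1.ofReal (i2.ofReal.mul_const _)]
    congr 1; funext x
    rw [← PK_even s (x - t), neg_sub]
    nth_rw 1 [← Complex.re_add_im (dS b x)]
    push_cast
    ring
  rw [e]
  refine (norm_add_le _ _).trans ?_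
  rw [norm_mul, Complex.norm_I, mul_one, Complex.norm_real, Complex.norm_real]
  exact add_le_add (Complex.abs_re_le_norm _) (Complex.abs_re_le_norm _)

lemma swap_bound (b : SchwartzMap ℝ ℂ) {Φ : ℂ → ℂ} (hΦ : DifferentiableOn ℂ Φ Hp) {B : ℝ}
    (hb : ∀ z ∈ Hp, ‖Φ z‖ ≤ B) {s : ℝ} (hs : 0 < s) :
    ‖∫ x : ℝ, dS b x * Φ ⟨x, 2 * s⟩‖ₑ ≤ ∫⁻ t : ℝ, ENNReal.ofReal (‖Φ ⟨t, s⟩‖ *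
      (‖deriv (SS fun t => (b t).re) ⟨t, s⟩‖ + ‖deriv (SS fun t => (b t).im) ⟨t, s⟩‖)) := by
  have e : ∫ x : ℝ, dS b x * Φ ⟨x, 2 * s⟩ = ∫ t : ℝ, Φ ⟨t, s⟩ * ∫ x : ℝ, dS b x * (PK s (x - t) : ℂ) := by
    simp only [poisson hΦ hb hs, ← integral_const_mul]
    rw [integral_integral_swap]
    · congr 1; funext t; congr 1; funext x; ring
    · have h1 := Integrable.convolution_integrand (ContinuousLinearMap.mul ℝ ℂ) (dS b).integrable
        (integrable_PK1 hs).ofReal (μ := volume) (ν := volume) (𝕜 := ℝ)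
      have h2 := h1.swap
      have h3 := h2.bdd_mul (c := B) (f := fun w : ℝ × ℝ => Φ ⟨w.2, s⟩)
        (((continuous_line hΦ hs).comp continuous_snd).aestronglyMeasurable)
        (Eventually.of_forall fun w => hb _ (mem_Hp_mk hs))
      refine h3.congr (Eventually.of_forall fun w => ?_)
      simp only [Function.uncurry, Function.comp_def, Prod.swap, ContinuousLinearMap.mul_apply']
      rw [← PK_even s (w.1 - w.2), neg_sub]
      simp
      ring
  rw [e]
  refine (enorm_integral_le_lintegral_enorm _).trans (lintegral_mono fun t => ?_)
  simp only
  rw [← ofReal_norm, norm_mul]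
  exact ENNReal.ofReal_le_ofReal (mul_le_mul_of_nonneg_left (inner_bound b hs t) (norm_nonneg _))

lemma shift_mem {δ : ℝ} (hδ : 0 < δ) {z : ℂ} (hz : z ∈ Hp) : z + (δ : ℂ) * Complex.I ∈ Hp := by
  have : 0 < z.im := hz
  show 0 < (z + (δ : ℂ) * Complex.I).im
  simp; linarith

lemma diffOn_shift {f : ℂ → ℂ} (hf : DifferentiableOn ℂ f Hp) {δ : ℝ} (hδ : 0 < δ) :
    DifferentiableOn ℂ (fun z => f (z + (δ : ℂ) * Complex.I)) Hp :=
  hf.comp (by fun_prop) fun _ hz => shift_mem hδ hz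

lemma shift_mk (x y δ : ℝ) : (⟨x, y⟩ : ℂ) + (δ : ℂ) * Complex.I = ⟨x, y + δ⟩ := by
  apply Complex.ext <;> simp

lemma HasN.shift {Q : ℂ → ℂ} {r N : ℝ} (h : HasN Q r N) {δ : ℝ} (hδ : 0 < δ) :
    HasN (fun z => Q (z + (δ : ℂ) * Complex.I)) r N := by
  refine ⟨⟨diffOn_shift h.good.diff hδ, fun z hz => h.good.pos _ (shift_mem hδ hz),
    fun z hz => h.good.le _ (shift_mem hδ hz), fun z hz => ?_⟩, fun y hy => ?_, fun y hy => ?_⟩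
  · rw [deriv_comp_add_const]
    refine (h.good.der _ (shift_mem hδ hz)).trans ?_
    have : 0 < z.im := hz
    gcongr
    simp; linarith
  · simp only [shift_mk]; exact h.int _ (by linarith)
  · simp only [shift_mk]; exact h.le _ (by linarith)

lemma AA_add {f g : ℂ → ℝ} (hf : ContinuousOn f Hp) (hg : ContinuousOn g Hp) (h0 : ∀ z ∈ Hp, 0 ≤ f z)
    (h1 : ∀ z ∈ Hp, 0 ≤ g z) : AA (fun z => f z + g z) = AA f + AA g := by
  have e := AA_eq (f := fun z => f z + g z) (hf.add hg)
  rw [AA_eq hf, AA_eq hg, e, ← lintegral_add_left' (aem_muH hf)]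
  refine lintegral_congr_ae ?_
  filter_upwards [ae_muH] with w hw
  exact ENNReal.ofReal_add (h0 _ (mem_Hp_mk hw)) (h1 _ (mem_Hp_mk hw))

lemma main_area {p q : ℝ} (hpq : p.HolderConjugate q) (hp2 : p ≤ 2) (l : ℕ) : ∃ C : ℝ, 0 < C ∧
    ∀ a f g : SchwartzMap ℝ ℂ, ∀ δ > 0, ∀ M : ℝ, (∀ t, ‖dS^[l + 1] a t‖ ≤ M) →
    ∀ QF QG : ℂ → ℂ, ∀ NF NG : ℝ, HasN QF p NF → HasN QG q NG →
    (∀ z ∈ Hp, ‖CT f z‖ ≤ 8 * Real.pi * ‖QF z‖ ^ 2) → (∀ z ∈ Hp, ‖CT g z‖ ≤ 8 * Real.pi * ‖QG z‖ ^ 2) →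
    ‖TT δ a (dS f) (dS^[l] g)‖ₑ ≤ ENNReal.ofReal (C * (M * NF ^ (1 / p) * NG ^ (1 / q))) := by
  obtain ⟨C0, hC0, HA⟩ := area hpq hp2
  have hpi := Real.pi_pos
  set Cl := (2 * Real.exp 1 ^ 2 * 2 ^ l) ^ l * (8 * Real.pi) with hCl
  have hCl0 : 0 < Cl := by positivity
  refine ⟨2 ^ (l + 1 + 1) * (4 * Cl) * (C0 + C0), by positivity, ?_⟩
  intro a f g δ hδ M hM QF QG NF NG hF hG hFb hGb
  let b := dS^[l + 1] a
  let Φ : ℂ → ℂ := fun z => PH (dS f) (dS^[l] g) (z + (δ : ℂ) * Complex.I)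
  have hΦ : DifferentiableOn ℂ Φ Hp := diffOn_shift (diffOn_PH _ _) hδ
  have hΦb : ∀ z ∈ Hp, ‖Φ z‖ ≤ N1 (dS f) * N1 (dS^[l] g) / δ ^ 2 := by
    intro z hz
    have hz' : 0 < z.im := hz
    refine (norm_PH_le _ _ (shift_mem hδ hz)).trans ?_
    have := mul_nonneg (N1_nonneg (dS f)) (N1_nonneg (dS^[l] g))
    gcongr
    simp; linarith
  let F : ℂ → ℂ := fun z => CT f (z + (δ : ℂ) * Complex.I)
  have hFd : DifferentiableOn ℂ F Hp := diffOn_shift (diffOn_CT f.integrable) hδ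
  have hF' := hF.shift hδ
  have hG' := hG.shift hδ
  have hdF : ∀ z ∈ Hp, deriv F z = CT (dS f) (z + (δ : ℂ) * Complex.I) := by
    intro z hz
    simp only [F]
    rw [deriv_comp_add_const]
    exact (hasDerivAt_CTS f (shift_mem hδ hz)).deriv
  -- the chain
  have hM1 : ∀ t, |(b t).re| ≤ M := fun t => (Complex.abs_re_le_norm _).trans (hM t)
  have hM2 : ∀ t, |(b t).im| ≤ M := fun t => (Complex.abs_im_le_norm _).trans (hM t)
  let A1 := HA _ _ F NF NG hF' hG' hFd (fun z hz => hFb _ (shift_mem hδ hz)) _ M (re_int b) hM1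
  let A2 := HA _ _ F NF NG hF' hG' hFd (fun z hz => hFb _ (shift_mem hδ hz)) _ M (im_int b) hM2
  let J : ℕ → ℝ → ℂ := fun j s => 2 ^ j * TT (2 * s + δ) (dS^[j] a) (dS f) (dS^[l] g)
  have hch := chain_all (J := J) (c := -Complex.I) (by simp) (fun j y hy => by
    have h1 := hasDerivAt_TT (y := 2 * y + δ) (by linarith) (dS^[j] a) (dS f) (dS^[l] g)
    have h2 : HasDerivAt (fun s : ℝ => 2 * s + δ) 2 y := by
      simpa using ((hasDerivAt_id y).const_mul 2).add_const δ
    have h3 := (h1.scomp y h2).const_mul ((2:ℂ) ^ j)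
    refine h3.congr_deriv ?_
    simp only [J, Function.iterate_succ_apply', pow_succ, Complex.real_smul]
    push_cast
    ring) (fun j => by
      rw [tendsto_zero_iff_norm_tendsto_zero]
      have hlim : Tendsto (fun s : ℝ => 2 ^ j * (N1 (dS^[j] a) * (N1 (dS f) * N1 (dS^[l] g)) / (2 * s + δ) ^ 2))
          atTop (𝓝 0) := by
        have : Tendsto (fun s : ℝ => N1 (dS^[j] a) * (N1 (dS f) * N1 (dS^[l] g)) / (2 * s + δ) ^ 2) atTop (𝓝 0) := by
          refine Tendsto.div_atTop tendsto_const_nhds ((tendsto_pow_atTop two_ne_zero).comp ?_)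
          exact tendsto_atTop_add_const_right _ _ (tendsto_id.const_mul_atTop two_pos)
        simpa using this.const_mul (2 ^ j)
      refine squeeze_zero' (Eventually.of_forall fun R => norm_nonneg _) ?_ hlim
      filter_upwards [eventually_gt_atTop 0] with s hs
      simp only [J]
      rw [norm_mul, norm_pow, Complex.norm_ofNat]
      gcongr
      exact norm_TT_le (by linarith) _ _ _) (l + 1)
  have e0 : J 0 0 = TT δ a (dS f) (dS^[l] g) := by simp [J]
  rw [e0] at hch
  refine hch.trans ?_
  let W : (ℝ → ℝ) → ℂ → ℝ := fun A z =>
    z.im * ‖deriv F z‖ * (QG (z + (δ : ℂ) * Complex.I)).re ^ 2 * ‖deriv (SS A) z‖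
  have hWc : ∀ A, Integrable A → ContinuousOn (W A) Hp := fun A hA =>
    ((Complex.continuous_im.continuousOn.mul (hFd.deriv isOpen_Hp).continuousOn.norm).mul
    ((contOn_re hG'.good.diff).pow 2)).mul ((diffOn_SS hA).deriv isOpen_Hp).continuousOn.norm
  have hW0 : ∀ A, ∀ z ∈ Hp, 0 ≤ W A z := fun A z hz => by
    have : 0 < z.im := hz
    simp only [W]; positivity
  have hstep : ∫⁻ y in Ioi (0:ℝ), ENNReal.ofReal (y ^ (l + 1)) * ‖J (l + 1 + 1) y‖ₑ ≤
      ENNReal.ofReal (2 ^ (l + 1 + 1) * (4 * Cl)) * AA (fun z => W (fun t => (b t).re) z + W (fun t => (b t).im) z) := by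
    unfold AA
    rw [← lintegral_const_mul' _ _ ENNReal.ofReal_ne_top]
    refine setLIntegral_mono' measurableSet_Ioi fun s hs => ?_
    have hs : 0 < s := hs
    rw [← lintegral_const_mul' _ _ ENNReal.ofReal_ne_top]
    have e1 : ‖J (l + 1 + 1) s‖ₑ = ENNReal.ofReal (2 ^ (l + 1 + 1)) * ‖∫ x : ℝ, dS b x * Φ ⟨x, 2 * s⟩‖ₑ := by
      simp only [J, TT, Φ, b, Function.iterate_succ_apply', shift_mk]
      rw [enorm_mul, ← ofReal_norm, norm_pow, Complex.norm_ofNat]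
    rw [e1, ← mul_assoc, ← ENNReal.ofReal_mul (by positivity)]
    refine (mul_le_mul_right (swap_bound b hΦ hΦb hs) _).trans ?_
    rw [← lintegral_const_mul' _ _ ENNReal.ofReal_ne_top]
    refine lintegral_mono fun t => ?_
    have hz : (⟨t, s⟩ : ℂ) ∈ Hp := mem_Hp_mk hs
    simp only
    rw [← ENNReal.ofReal_mul (by positivity), ← ENNReal.ofReal_mul (by positivity)]
    apply ENNReal.ofReal_le_ofReal
    have hz2 := shift_mem hδ hz
    have k1 : ‖CT (dS^[l] g) (⟨t, s⟩ + (δ : ℂ) * Complex.I)‖ ≤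
        Cl * (4 * (QG (⟨t, s⟩ + (δ : ℂ) * Complex.I)).re ^ 2) / s ^ l := by
      rw [← iteratedDeriv_CTS g l hz2]
      refine ((hG.good.cauchy_iter (diffOn_CT g.integrable) 2 hGb l).2 _ hz2).trans ?_
      rw [← hCl]
      have h5 := hG.good.le _ hz2
      have h6 : ‖QG (⟨t, s⟩ + (δ : ℂ) * Complex.I)‖ ^ 2 ≤ 4 * (QG (⟨t, s⟩ + (δ : ℂ) * Complex.I)).re ^ 2 := by
        calc _ ≤ (2 * (QG (⟨t, s⟩ + (δ : ℂ) * Complex.I)).re) ^ 2 := by gcongr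
          _ = _ := by ring
      gcongr
      simp; linarith
    simp only [Φ, PH, W]
    rw [hdF _ hz, norm_mul]
    set D := ‖deriv (SS fun t => (b t).re) ⟨t, s⟩‖
    set D2 := ‖deriv (SS fun t => (b t).im) ⟨t, s⟩‖
    have hD : 0 ≤ D := norm_nonneg _
    have hD2 : 0 ≤ D2 := norm_nonneg _
    calc _ ≤ s ^ (l + 1) * 2 ^ (l + 1 + 1) * (‖CT (dS f) (⟨t, s⟩ + (δ : ℂ) * Complex.I)‖ *
          (Cl * (4 * (QG (⟨t, s⟩ + (δ : ℂ) * Complex.I)).re ^ 2) / s ^ l) * (D + D2)) := by gcongr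
      _ = _ := by
        field_simp
        try ring
  refine hstep.trans ?_
  rw [AA_add (hWc _ (re_int b)) (hWc _ (im_int b)) (hW0 _) (hW0 _)]
  refine (mul_le_mul_right (add_le_add A1 A2) _).trans ?_
  have h7 := hF.nonneg
  have h8 := hG.nonneg
  have h9 : 0 ≤ M := (norm_nonneg _).trans (hM 0)
  rw [← ENNReal.ofReal_add (by positivity) (by positivity), ← ENNReal.ofReal_mul (by positivity)]
  apply ENNReal.ofReal_le_ofReal
  apply le_of_eq; ring
end CC

namespace CC
open Set Filter Topology
open scoped ENNReal

lemma int_rpow_S (f : SchwartzMap ℝ ℂ) {p : ℝ} (hp : 1 < p) : Integrable (fun t => ‖f t‖ ^ p) := by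
  have h := (f.memLp (ENNReal.ofReal p) volume).integrable_norm_rpow (by simp; linarith) ENNReal.ofReal_ne_top
  rwa [ENNReal.toReal_ofReal (by linarith)] at h

noncomputable def NN (p : ℝ) (f : SchwartzMap ℝ ℂ) : ℝ := (∫ t, ‖f t‖ ^ p) ^ (1 / p)

lemma int_nn (p : ℝ) (f : SchwartzMap ℝ ℂ) : 0 ≤ ∫ t, ‖f t‖ ^ p := integral_nonneg fun _ => by positivity

lemma NN_nonneg (p : ℝ) (f : SchwartzMap ℝ ℂ) : 0 ≤ NN p f := Real.rpow_nonneg (int_nn p f) _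

lemma dS_zero : dS 0 = 0 := by simp [dS]
lemma dS_iter_zero (l : ℕ) : dS^[l] 0 = 0 := Function.iterate_fixed dS_zero l
lemma CT_zero (z : ℂ) : CT (0 : SchwartzMap ℝ ℂ) z = 0 := by simp [CT]

lemma TT_zero_left (δ : ℝ) (a w : SchwartzMap ℝ ℂ) : TT δ a 0 w = 0 := by simp only [TT, PH, CT_zero]; simp
lemma TT_zero_right (δ : ℝ) (a w : SchwartzMap ℝ ℂ) : TT δ a w 0 = 0 := by simp only [TT, PH, CT_zero]; simp
lemma TT_symm (δ : ℝ) (a u w : SchwartzMap ℝ ℂ) : TT δ a u w = TT δ a w u := by simp [TT, PH, mul_comm]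

lemma S_ne {f : SchwartzMap ℝ ℂ} (h : f ≠ 0) : (⇑f : ℝ → ℂ) ≠ 0 := fun h' => h (by ext x; exact congrFun h' x)

lemma claim_main {p q : ℝ} (hpq : p.HolderConjugate q) (hp2 : p ≤ 2) (l : ℕ) : ∃ C : ℝ, 0 < C ∧
    ∀ a f g : SchwartzMap ℝ ℂ, ∀ δ > 0, ∀ M : ℝ, (∀ t, ‖dS^[l + 1] a t‖ ≤ M) →
    ‖TT δ a (dS f) (dS^[l] g)‖ ≤ C * (M * NN p f * NN q g) := by
  obtain ⟨C, hC, H⟩ := main_area hpq hp2 l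
  obtain ⟨C1, hC1, H1⟩ := exists_Q hpq.lt (rieszAt hpq.lt)
  obtain ⟨C2, hC2, H2⟩ := exists_Q hpq.symm.lt (rieszAt hpq.symm.lt)
  refine ⟨C * (C1 ^ (1 / p) * C2 ^ (1 / q)), by positivity, fun a f g δ hδ M hM => ?_⟩
  have hM0 : 0 ≤ M := (norm_nonneg _).trans (hM 0)
  have := NN_nonneg p f
  have := NN_nonneg q g
  by_cases hf : f = 0
  · rw [hf, dS_zero, TT_zero_left, norm_zero]; have := NN_nonneg p 0; positivity
  by_cases hg : g = 0
  · rw [hg, dS_iter_zero, TT_zero_right, norm_zero]; have := NN_nonneg q 0; positivity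
  obtain ⟨QF, f1, f2, f3, f4⟩ := H1 f f.continuous f.integrable (int_rpow_S f hpq.lt) (S_ne hf)
  obtain ⟨QG, g1, g2, g3, g4⟩ := H2 g g.continuous g.integrable (int_rpow_S g hpq.symm.lt) (S_ne hg)
  have h := H a f g δ hδ M hM QF QG _ _ ⟨f1, f3, f4⟩ ⟨g1, g3, g4⟩ f2 g2
  have i1 := int_nn p f
  have i2 := int_nn q g
  rw [← ofReal_norm, ENNReal.ofReal_le_ofReal_iff (by positivity), Real.mul_rpow hC1.le i1, Real.mul_rpow hC2.le i2] at h
  refine h.trans (le_of_eq ?_)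
  simp only [NN]; ring

lemma claim_zero {p q : ℝ} (hpq : p.HolderConjugate q) : ∃ C : ℝ, 0 < C ∧
    ∀ a f g : SchwartzMap ℝ ℂ, ∀ δ > 0, ∀ M : ℝ, (∀ t, ‖a t‖ ≤ M) →
    ‖TT δ a f g‖ ≤ C * (M * NN p f * NN q g) := by
  obtain ⟨K1, hK1, H1⟩ := CT_riesz hpq.lt (rieszAt hpq.lt)
  obtain ⟨K2, hK2, H2⟩ := CT_riesz hpq.symm.lt (rieszAt hpq.symm.lt)
  refine ⟨(K1 ^ (1 / p) * K2 ^ (1 / q)), by positivity, fun a f g δ hδ M hM => ?_⟩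
  have hM0 : 0 ≤ M := (norm_nonneg _).trans (hM 0)
  have hp0 := hpq.pos
  have hq0 := hpq.symm.pos
  have := NN_nonneg p f
  have := NN_nonneg q g
  by_cases hf : f = 0
  · rw [hf, TT_zero_left, norm_zero]; have := NN_nonneg p 0; positivity
  by_cases hg : g = 0
  · rw [hg, TT_zero_right, norm_zero]; have := NN_nonneg q 0; positivity
  have h1 := H1 f f.continuous f.integrable (int_rpow_S f hpq.lt) (S_ne hf) δ hδ
  have h2 := H2 g g.continuous g.integrable (int_rpow_S g hpq.symm.lt) (S_ne hg) δ hδ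
  have i1 := int_nn p f
  have i2 := int_nn q g
  have m1 : AEMeasurable (fun x : ℝ => ‖CT f ⟨x, δ⟩‖ₑ) :=
    (continuous_line (diffOn_CT f.integrable) hδ).measurable.enorm.aemeasurable
  have m2 : AEMeasurable (fun x : ℝ => ‖CT g ⟨x, δ⟩‖ₑ) :=
    (continuous_line (diffOn_CT g.integrable) hδ).measurable.enorm.aemeasurable
  have key : ‖TT δ a f g‖ₑ ≤ ENNReal.ofReal ((K1 ^ (1 / p) * K2 ^ (1 / q)) * (M * NN p f * NN q g)) := by
    unfold TT
    refine (enorm_integral_le_lintegral_enorm _).trans ?_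
    calc _ ≤ ∫⁻ x : ℝ, ENNReal.ofReal M * (‖CT f ⟨x, δ⟩‖ₑ * ‖CT g ⟨x, δ⟩‖ₑ) := by
          refine lintegral_mono fun x => ?_
          simp only [PH, enorm_mul]
          gcongr
          rw [← ofReal_norm]
          exact ENNReal.ofReal_le_ofReal (hM x)
      _ = ENNReal.ofReal M * ∫⁻ x : ℝ, (‖CT f ⟨x, δ⟩‖ₑ * ‖CT g ⟨x, δ⟩‖ₑ) :=
          lintegral_const_mul' _ _ ENNReal.ofReal_ne_top
      _ ≤ ENNReal.ofReal M * ((ENNReal.ofReal (K1 * ∫ t, ‖f t‖ ^ p)) ^ (1 / p) *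
            (ENNReal.ofReal (K2 * ∫ t, ‖g t‖ ^ q)) ^ (1 / q)) := by
          refine mul_le_mul_right ((ENNReal.lintegral_mul_le_Lp_mul_Lq volume hpq m1 m2).trans ?_) _
          gcongr
      _ = _ := by
          rw [ENNReal.ofReal_rpow_of_nonneg (by positivity) (by positivity),
            ENNReal.ofReal_rpow_of_nonneg (by positivity) (by positivity),
            ← ENNReal.ofReal_mul (by positivity), ← ENNReal.ofReal_mul hM0, Real.mul_rpow hK1.le i1,
            Real.mul_rpow hK2.le i2]
          congr 1
          simp only [NN]; ring
  rwa [← ofReal_norm, ENNReal.ofReal_le_ofReal_iff (by positivity)] at key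

def Claim (p q : ℝ) (m l : ℕ) : Prop := ∃ C : ℝ, 0 < C ∧
    ∀ a f g : SchwartzMap ℝ ℂ, ∀ δ > 0, ∀ M : ℝ, (∀ t, ‖dS^[m + l] a t‖ ≤ M) →
    ‖TT δ a (dS^[m] f) (dS^[l] g)‖ ≤ C * (M * NN p f * NN q g)

lemma claim_one {p q : ℝ} (hpq : p.HolderConjugate q) (hp2 : p ≤ 2) (l : ℕ) : Claim p q 1 l := by
  obtain ⟨C, hC, H⟩ := claim_main hpq hp2 l
  refine ⟨C, hC, fun a f g δ hδ M hM => H a f g δ hδ M ?_⟩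
  rwa [add_comm l 1]

lemma claim_z {p q : ℝ} (hpq : p.HolderConjugate q) (hp2 : p ≤ 2) (l : ℕ) : Claim p q 0 l := by
  induction l with
  | zero => exact claim_zero hpq
  | succ l ih =>
    obtain ⟨C, hC, H⟩ := ih
    obtain ⟨D, hD, H1⟩ := claim_one hpq hp2 l
    refine ⟨C + D, by positivity, fun a f g δ hδ M hM => ?_⟩
    have e := TT_parts hδ a f (dS^[l] g)
    have h1 := H (dS a) f g δ hδ M (by rw [← Function.iterate_succ_apply]; exact hM)
    have h2 := H1 a f g δ hδ M (by rwa [add_comm 1 l, ← zero_add (l + 1)])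
    have e2 : TT δ a (dS^[0] f) (dS^[l + 1] g) = - (TT δ (dS a) (dS^[0] f) (dS^[l] g) + TT δ a (dS^[1] f) (dS^[l] g)) := by
      rw [Function.iterate_succ_apply' dS l g]
      simp only [Function.iterate_zero, id, Function.iterate_one]
      linear_combination e
    rw [e2, norm_neg]
    refine (norm_add_le _ _).trans ?_
    linarith

lemma claim_le {p q : ℝ} (hpq : p.HolderConjugate q) (hp2 : p ≤ 2) (m l : ℕ) : Claim p q m l := by
  induction m generalizing l with
  | zero => exact claim_z hpq hp2 l
  | succ m ih =>
    obtain ⟨C, hC, H⟩ := ih l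
    obtain ⟨D, hD, H1⟩ := ih (l + 1)
    refine ⟨C + D, by positivity, fun a f g δ hδ M hM => ?_⟩
    have e := TT_parts hδ a (dS^[m] f) (dS^[l] g)
    have h1 := H (dS a) f g δ hδ M (by
      rw [← Function.iterate_succ_apply]
      convert hM using 5; omega)
    have h2 := H1 a f g δ hδ M (by convert hM using 5; omega)
    have e2 : TT δ a (dS^[m + 1] f) (dS^[l] g) = - (TT δ (dS a) (dS^[m] f) (dS^[l] g) + TT δ a (dS^[m] f) (dS^[l + 1] g)) := by
      rw [Function.iterate_succ_apply' dS l g, Function.iterate_succ_apply' dS m f]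
      linear_combination e
    rw [e2, norm_neg]
    refine (norm_add_le _ _).trans ?_
    linarith

theorem claim {p q : ℝ} (hpq : p.HolderConjugate q) (m l : ℕ) : Claim p q m l := by
  rcases le_total p 2 with h | h
  · exact claim_le hpq h m l
  · have hq : q ≤ 2 := by
      have h1 := hpq.inv_add_inv_eq_one
      have h3 := hpq.symm.pos
      by_contra hq
      push Not at hq
      have : p⁻¹ ≤ 2⁻¹ := by gcongr
      have : q⁻¹ < 2⁻¹ := by gcongr
      linarith
    obtain ⟨C, hC, H⟩ := claim_le hpq.symm hq l m
    refine ⟨C, hC, fun a f g δ hδ M hM => ?_⟩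
    rw [TT_symm]
    refine (H a g f δ hδ M (by rwa [add_comm l m])).trans (le_of_eq (by ring))

end CC

namespace CC
open Set Filter Topology
open scoped ENNReal FourierTransform

lemma FT1_eq (u : SchwartzMap ℝ ℂ) (ξ : ℝ) : FT1 u ξ = (𝓕 u) ((2 * Real.pi)⁻¹ * ξ) := by
  rw [SchwartzMap.fourier_coe, Real.fourier_real_eq_integral_exp_smul]
  unfold FT1
  refine integral_congr_ae (Eventually.of_forall fun x => ?_)
  simp only [smul_eq_mul]
  congr 2
  push_cast
  have : (Real.pi : ℂ) ≠ 0 := by exact_mod_cast Real.pi_ne_zero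
  field_simp

lemma continuous_FT1 (u : SchwartzMap ℝ ℂ) : Continuous (FT1 u) := by
  have : FT1 u = fun ξ => (𝓕 u) ((2 * Real.pi)⁻¹ * ξ) := funext (FT1_eq u)
  rw [this]
  exact (𝓕 u).continuous.comp (by fun_prop)

lemma integrable_FT1 (u : SchwartzMap ℝ ℂ) : Integrable (FT1 u) := by
  have : FT1 u = fun ξ => (𝓕 u) ((2 * Real.pi)⁻¹ * ξ) := funext (FT1_eq u)
  rw [this]
  exact (𝓕 u).integrable.comp_mul_left' (by positivity)

lemma norm_e (x ξ : ℝ) : ‖Complex.exp (Complex.I * (x : ℂ) * (ξ : ℂ))‖ = 1 := by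
  rw [Complex.norm_exp]; simp

lemma norm_e' (x ξ : ℝ) : ‖Complex.exp (-(Complex.I * (x : ℂ) * (ξ : ℂ)))‖ = 1 := by
  rw [Complex.norm_exp]; simp

lemma inversion (u : SchwartzMap ℝ ℂ) (x : ℝ) :
    u x = ((1 / (2 * Real.pi) : ℝ) : ℂ) * ∫ ξ : ℝ, Complex.exp (Complex.I * (x : ℂ) * (ξ : ℂ)) * FT1 u ξ := by
  have h := congrFun (u.continuous.fourierInv_fourier_eq u.integrable (𝓕 u).integrable) x
  rw [← h, Real.fourierInv_eq']
  have h2 := Measure.integral_comp_mul_left (fun ξ : ℝ => Complex.exp (Complex.I * (x : ℂ) * (ξ : ℂ)) * FT1 u ξ) (2 * Real.pi)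
  rw [abs_of_pos (by positivity), Complex.real_smul] at h2
  rw [one_div, ← h2]
  refine integral_congr_ae (Eventually.of_forall fun v => ?_)
  simp only [smul_eq_mul]
  rw [FT1_eq, inv_mul_cancel_left₀ (by positivity), SchwartzMap.fourier_coe]
  congr 2
  simp
  ring

lemma integrable_eS (u : SchwartzMap ℝ ℂ) (ξ : ℝ) :
    Integrable (fun x : ℝ => Complex.exp (-(Complex.I * (x : ℂ) * (ξ : ℂ))) * u x) :=
  u.integrable.bdd_mul (c := 1) (by fun_prop) (Eventually.of_forall fun x => (norm_e' x ξ).le)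

lemma FT1_dS (u : SchwartzMap ℝ ℂ) (ξ : ℝ) : FT1 (dS u) ξ = Complex.I * ξ * FT1 u ξ := by
  have hd : ∀ x : ℝ, HasDerivAt (fun x : ℝ => Complex.exp (-(Complex.I * (x : ℂ) * (ξ : ℂ))) * u x)
      (Complex.exp (-(Complex.I * (x : ℂ) * (ξ : ℂ))) * dS u x -
        Complex.I * ξ * (Complex.exp (-(Complex.I * (x : ℂ) * (ξ : ℂ))) * u x)) x := by
    intro x
    have h1 : HasDerivAt (fun x : ℝ => (-(Complex.I * (x : ℂ) * (ξ : ℂ)))) (-(Complex.I * ξ)) x := by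
      have := (((Complex.ofRealCLM.hasDerivAt (x := x)).const_mul Complex.I).mul_const (ξ : ℂ)).fun_neg
      simpa using this
    refine (h1.cexp.mul (hasDerivAt_S u x)).congr_deriv ?_
    ring
  have h := integral_eq_zero_of_hasDerivAt_of_integrable hd
    ((integrable_eS (dS u) ξ).sub ((integrable_eS u ξ).const_mul _)) (integrable_eS u ξ)
  rw [integral_sub (integrable_eS (dS u) ξ) ((integrable_eS u ξ).const_mul _), integral_const_mul] at h
  exact sub_eq_zero.1 h

/-- Hilbert transform with derivative. -/
lemma integrable_Hil (u : SchwartzMap ℝ ℂ) (x : ℝ) : Integrable (fun ξ : ℝ => Complex.exp (Complex.I * (x : ℂ) * (ξ : ℂ)) *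
      (-Complex.I * ((Real.sign ξ : ℝ) : ℂ)) * FT1 u ξ) := by
  refine (integrable_FT1 u).bdd_mul (c := 1) ?_ (Eventually.of_forall fun ξ => ?_)
  · have : Measurable Real.sign := by
      unfold Real.sign
      exact Measurable.ite measurableSet_Iio measurable_const (Measurable.ite measurableSet_Ioi measurable_const measurable_const)
    exact (Measurable.mul (by fun_prop) ((Complex.measurable_ofReal.comp this).const_mul _)).aestronglyMeasurable
  · rw [norm_mul, norm_e]
    rcases Real.sign_apply_eq ξ with h | h | h <;> simp [h]

lemma hasDerivAt_Hil (u : SchwartzMap ℝ ℂ) (x : ℝ) : HasDerivAt (Hil u) (Hil (dS u) x) x := by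
  unfold Hil
  refine HasDerivAt.const_mul _ ?_
  refine (hasDerivAt_integral_of_dominated_loc_of_deriv_le (F := fun (x ξ : ℝ) => Complex.exp (Complex.I * (x : ℂ) * (ξ : ℂ)) *
      (-Complex.I * ((Real.sign ξ : ℝ) : ℂ)) * FT1 u ξ) (F' := fun (x ξ : ℝ) => Complex.exp (Complex.I * (x : ℂ) * (ξ : ℂ)) *
      (-Complex.I * ((Real.sign ξ : ℝ) : ℂ)) * FT1 (dS u) ξ) (bound := fun ξ => ‖FT1 (dS u) ξ‖) (s := univ) univ_mem
      (Eventually.of_forall fun x => (integrable_Hil u x).aestronglyMeasurable)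
      (integrable_Hil u x) (integrable_Hil _ x).aestronglyMeasurable ?_ (integrable_FT1 _).norm ?_).2
  · refine Eventually.of_forall fun ξ x _ => ?_
    rw [norm_mul, norm_mul, norm_e]
    refine mul_le_of_le_one_left (norm_nonneg _) ?_
    rcases Real.sign_apply_eq ξ with h | h | h <;> simp [h]
  · refine Eventually.of_forall fun ξ x _ => ?_
    have h1 : HasDerivAt (fun x : ℝ => (Complex.I * (x : ℂ) * (ξ : ℂ))) (Complex.I * ξ) x := by
      have := (((Complex.ofRealCLM.hasDerivAt (x := x)).const_mul Complex.I).mul_const (ξ : ℂ))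
      simpa using this
    refine ((h1.cexp.mul_const _).mul_const _).congr_deriv ?_
    rw [FT1_dS]; ring

lemma contDiff_Hil (u : SchwartzMap ℝ ℂ) : ContDiff ℝ ((⊤ : ℕ∞) : WithTop ℕ∞) (Hil u) := by
  rw [contDiff_infty]
  intro n
  induction n generalizing u with
  | zero =>
    rw [Nat.cast_zero, contDiff_zero]
    exact continuous_iff_continuousAt.2 fun x => (hasDerivAt_Hil u x).continuousAt
  | succ n ih =>
    push_cast
    rw [contDiff_succ_iff_deriv]
    refine ⟨fun x => (hasDerivAt_Hil u x).differentiableAt, by simp, ?_⟩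
    rw [show deriv (Hil u) = Hil (dS u) from funext fun x => (hasDerivAt_Hil u x).deriv]
    exact ih _

/-- Antisymmetry. -/
lemma int_Hil_mul (u w : SchwartzMap ℝ ℂ) : ∫ x, Hil u x * w x =
    ((1 / (2 * Real.pi) : ℝ) : ℂ) * ∫ ξ, (-Complex.I * ((Real.sign ξ : ℝ) : ℂ)) * FT1 u ξ * FT1 w (-ξ) := by
  unfold Hil
  simp_rw [mul_assoc (((1 / (2 * Real.pi) : ℝ) : ℂ)), ← integral_mul_const]
  rw [integral_const_mul, integral_integral_swap]
  · congr 1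
    refine integral_congr_ae (Eventually.of_forall fun ξ => ?_)
    simp only
    have : FT1 w (-ξ) = ∫ x : ℝ, Complex.exp (Complex.I * (x : ℂ) * (ξ : ℂ)) * w x := by
      unfold FT1
      refine integral_congr_ae (Eventually.of_forall fun x => ?_)
      simp
    rw [this, ← integral_const_mul]
    refine integral_congr_ae (Eventually.of_forall fun x => ?_)
    simp only; ring
  · have h := ((w.integrable (μ := volume)).mul_prod (integrable_Hil u 0))
    have h2 := h.bdd_mul (c := 1) (f := fun z : ℝ × ℝ => Complex.exp (Complex.I * (z.1 : ℂ) * (z.2 : ℂ)))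
      (by fun_prop) (Eventually.of_forall fun z => (norm_e z.1 z.2).le)
    refine h2.congr (Eventually.of_forall fun z => ?_)
    simp [Function.uncurry]; ring

lemma Hil_antisymm (u w : SchwartzMap ℝ ℂ) : ∫ x, Hil u x * w x = - ∫ x, u x * Hil w x := by
  have e : ∫ x, u x * Hil w x = ∫ x, Hil w x * u x := by simp_rw [mul_comm]
  rw [e, int_Hil_mul, int_Hil_mul, ← mul_neg, ← integral_neg]
  congr 1
  rw [← integral_neg_eq_self]
  refine integral_congr_ae (Eventually.of_forall fun ξ => ?_)
  simp only [neg_neg]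
  have : Real.sign (-ξ) = - Real.sign ξ := Real.sign_neg
  rw [this]
  push_cast
  ring

end CC

namespace CC
open Set Filter Topology
open scoped ENNReal

noncomputable def PP (δ : ℝ) (u : SchwartzMap ℝ ℂ) (x : ℝ) : ℂ :=
  ((1 / (2 * Real.pi) : ℝ) : ℂ) * ∫ ξ in Ioi (0:ℝ), Complex.exp (Complex.I * ((x : ℂ) + δ * Complex.I) * (ξ : ℂ)) * FT1 u ξ

lemma norm_exp_le {δ : ℝ} (hδ : 0 ≤ δ) (x : ℝ) {ξ : ℝ} (hξ : 0 < ξ) :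
    ‖Complex.exp (Complex.I * ((x : ℂ) + δ * Complex.I) * (ξ : ℂ))‖ ≤ 1 := by
  rw [Complex.norm_exp]
  apply Real.exp_le_one_iff.2
  simp
  positivity

lemma PP_meas (δ : ℝ) (u : SchwartzMap ℝ ℂ) (x : ℝ) : Continuous
    (fun ξ : ℝ => Complex.exp (Complex.I * ((x : ℂ) + δ * Complex.I) * (ξ : ℂ)) * FT1 u ξ) := by
  have := continuous_FT1 u
  fun_prop

lemma ae_Ioi : ∀ᵐ ξ ∂(volume.restrict (Ioi (0:ℝ))), 0 < ξ := by
  filter_upwards [ae_restrict_mem measurableSet_Ioi] with ξ h using h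

lemma PP_bound {δ : ℝ} (hδ : 0 ≤ δ) (u : SchwartzMap ℝ ℂ) (x : ℝ) : ∀ᵐ ξ : ℝ ∂(volume.restrict (Ioi (0:ℝ))),
    ‖Complex.exp (Complex.I * ((x : ℂ) + δ * Complex.I) * (ξ : ℂ)) * FT1 u ξ‖ ≤ ‖FT1 u ξ‖ := by
  filter_upwards [ae_Ioi] with ξ hξ
  rw [norm_mul]
  exact mul_le_of_le_one_left (norm_nonneg _) (norm_exp_le hδ x hξ)

lemma norm_PP_le {δ : ℝ} (hδ : 0 ≤ δ) (u : SchwartzMap ℝ ℂ) (x : ℝ) :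
    ‖PP δ u x‖ ≤ (1 / (2 * Real.pi)) * ∫ ξ in Ioi (0:ℝ), ‖FT1 u ξ‖ := by
  unfold PP
  rw [norm_mul, Complex.norm_real, Real.norm_of_nonneg (by positivity)]
  gcongr
  exact norm_integral_le_of_norm_le (integrable_FT1 u).norm.integrableOn (PP_bound hδ u x)

lemma PP_tendsto (u : SchwartzMap ℝ ℂ) (x : ℝ) : Tendsto (fun δ => PP δ u x) (𝓝[>] 0) (𝓝 (PP 0 u x)) := by
  unfold PP
  refine Tendsto.const_mul _ ?_
  refine tendsto_integral_filter_of_dominated_convergence (fun ξ => ‖FT1 u ξ‖) ?_ ?_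
    (integrable_FT1 u).norm.integrableOn ?_
  · exact Eventually.of_forall fun δ => (PP_meas δ u x).aestronglyMeasurable
  · filter_upwards [self_mem_nhdsWithin] with δ hδ using PP_bound (le_of_lt hδ) u x
  · refine Eventually.of_forall fun ξ => ?_
    have : Continuous (fun δ : ℝ => Complex.exp (Complex.I * ((x : ℂ) + δ * Complex.I) * (ξ : ℂ)) * FT1 u ξ) := by
      fun_prop
    exact (this.tendsto 0).mono_left nhdsWithin_le_nhds

lemma continuous_PP {δ : ℝ} (hδ : 0 ≤ δ) (u : SchwartzMap ℝ ℂ) : Continuous (PP δ u) := by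
  unfold PP
  refine Continuous.mul continuous_const ?_
  refine continuous_of_dominated (bound := fun ξ => ‖FT1 u ξ‖) (fun x => (PP_meas δ u x).aestronglyMeasurable)
    (fun x => PP_bound hδ u x) (integrable_FT1 u).norm.integrableOn ?_
  refine Eventually.of_forall fun ξ => ?_
  fun_prop

lemma PP_eq_CT {δ : ℝ} (hδ : 0 < δ) (u : SchwartzMap ℝ ℂ) (x : ℝ) :
    CT u ⟨x, δ⟩ = (2 * Real.pi * Complex.I) * PP δ u x := by
  have hpi : (Real.pi : ℂ) ≠ 0 := by exact_mod_cast Real.pi_ne_zero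
  have e : ∫ ξ in Ioi (0:ℝ), Complex.exp (Complex.I * ((x : ℂ) + δ * Complex.I) * (ξ : ℂ)) * FT1 u ξ =
      -Complex.I * CT u ⟨x, δ⟩ := by
    unfold FT1 CT
    simp_rw [← integral_const_mul]
    rw [integral_integral_swap]
    · refine integral_congr_ae (Eventually.of_forall fun t => ?_)
      simp only
      have hre : (Complex.I * ((x : ℂ) - t + δ * Complex.I)).re < 0 := by simp; exact hδ
      have h := integral_exp_mul_complex_Ioi hre 0
      have h2 : ∀ ξ : ℝ, Complex.exp (Complex.I * ((x : ℂ) + δ * Complex.I) * (ξ : ℂ)) *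
          (Complex.exp (-(Complex.I * (t : ℂ) * (ξ : ℂ))) * u t) =
          Complex.exp (Complex.I * ((x : ℂ) - t + δ * Complex.I) * ξ) * u t := by
        intro ξ
        rw [← mul_assoc, ← Complex.exp_add]
        congr 2; ring
      simp_rw [h2]
      rw [integral_mul_const, h]
      have hz : (⟨x, δ⟩ : ℂ) = x + δ * Complex.I := by
        apply Complex.ext <;> simp
      have hne : (t : ℂ) - ⟨x, δ⟩ ≠ 0 := sub_ne (mem_Hp_mk hδ)
      rw [hz] at hne ⊢
      have hne2 : (Complex.I * ((x : ℂ) - t + δ * Complex.I)) ≠ 0 := by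
        intro h0; rw [h0] at hre; simp at hre
      simp only [Complex.ofReal_zero, mul_zero, Complex.exp_zero]
      rw [div_mul_eq_mul_div, mul_div_assoc', div_eq_div_iff hne2 hne]
      linear_combination (-((t : ℂ) - (x + δ * Complex.I)) * u t) * Complex.I_sq
    · have hi : Integrable (fun ξ : ℝ => Complex.exp (Complex.I * (δ * Complex.I) * ξ)) (volume.restrict (Ioi 0)) :=
        integrableOn_exp_mul_complex_Ioi (by simp; exact hδ) 0
      have h2 := (hi.mul_prod (u.integrable (μ := volume))).bdd_mul (c := 1)
        (f := fun z : ℝ × ℝ => Complex.exp (Complex.I * ((x - z.2 : ℝ) : ℂ) * (z.1 : ℂ)))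
        (by fun_prop) (Eventually.of_forall fun z => (norm_e (x - z.2) z.1).le)
      refine h2.congr (Eventually.of_forall fun z => ?_)
      simp only [Function.uncurry]
      rw [← mul_assoc, ← Complex.exp_add, ← mul_assoc (Complex.exp (Complex.I * (↑x + ↑δ * Complex.I) * ↑z.1)),
        ← Complex.exp_add]
      congr 2
      push_cast
      ring
  unfold PP
  rw [e]
  push_cast
  field_simp
  simp

lemma int_aPP_tendsto (a u w : SchwartzMap ℝ ℂ) : Tendsto (fun δ => ∫ x, a x * (PP δ u x * PP δ w x)) (𝓝[>] 0)
    (𝓝 (∫ x, a x * (PP 0 u x * PP 0 w x))) := by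
  set K := (1 / (2 * Real.pi)) * ∫ ξ in Ioi (0:ℝ), ‖FT1 u ξ‖ with hK
  set L := (1 / (2 * Real.pi)) * ∫ ξ in Ioi (0:ℝ), ‖FT1 w ξ‖ with hL
  have hK0 : 0 ≤ K := (norm_nonneg _).trans (norm_PP_le le_rfl u 0)
  refine tendsto_integral_filter_of_dominated_convergence (fun x => ‖a x‖ * (K * L)) ?_ ?_
    (a.integrable.norm.mul_const _) ?_
  · filter_upwards [self_mem_nhdsWithin] with δ hδ
    exact (a.continuous.mul ((continuous_PP (le_of_lt hδ) u).mul (continuous_PP (le_of_lt hδ) w))).aestronglyMeasurable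
  · filter_upwards [self_mem_nhdsWithin] with δ hδ
    refine Eventually.of_forall fun x => ?_
    rw [norm_mul, norm_mul]
    gcongr
    · exact norm_PP_le (le_of_lt hδ) u x
    · exact norm_PP_le (le_of_lt hδ) w x
  · exact Eventually.of_forall fun x => ((PP_tendsto u x).mul (PP_tendsto w x)).const_mul _

lemma plus_bound {p q : ℝ} (hpq : p.HolderConjugate q) (m l : ℕ) : ∃ C : ℝ, 0 < C ∧
    ∀ a f g : SchwartzMap ℝ ℂ, ∀ M : ℝ, (∀ t, ‖dS^[m + l] a t‖ ≤ M) →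
    ‖∫ x, a x * (PP 0 (dS^[m] f) x * PP 0 (dS^[l] g) x)‖ ≤ C * (M * NN p f * NN q g) := by
  obtain ⟨C, hC, H⟩ := claim hpq m l
  have hpi := Real.pi_pos
  refine ⟨C / (2 * Real.pi) ^ 2, by positivity, fun a f g M hM => ?_⟩
  refine le_of_tendsto (int_aPP_tendsto a (dS^[m] f) (dS^[l] g)).norm ?_
  filter_upwards [self_mem_nhdsWithin] with δ hδ
  have hδ : 0 < δ := hδ
  have h := H a f g δ hδ M hM
  have e : TT δ a (dS^[m] f) (dS^[l] g) = (2 * Real.pi * Complex.I) ^ 2 *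
      ∫ x, a x * (PP δ (dS^[m] f) x * PP δ (dS^[l] g) x) := by
    unfold TT PH
    rw [← integral_const_mul]
    refine integral_congr_ae (Eventually.of_forall fun x => ?_)
    simp only
    rw [PP_eq_CT hδ, PP_eq_CT hδ]; ring
  rw [e, norm_mul, norm_pow, norm_mul, norm_mul, Complex.norm_I, Complex.norm_real, Complex.norm_ofNat,
    Real.norm_of_nonneg hpi.le, mul_one] at h
  rw [div_mul_eq_mul_div, le_div_iff₀ (by positivity)]
  linarith

/-- Conjugation. -/
noncomputable def cj (u : SchwartzMap ℝ ℂ) : SchwartzMap ℝ ℂ :=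
  SchwartzMap.postcompCLM (𝕜 := ℝ) (Complex.conjCLE : ℂ →L[ℝ] ℂ) u

lemma cj_apply (u : SchwartzMap ℝ ℂ) (x : ℝ) : cj u x = (starRingEnd ℂ) (u x) := rfl

lemma cj_cj (u : SchwartzMap ℝ ℂ) : cj (cj u) = u := by ext x; simp [cj_apply]

lemma dS_cj (u : SchwartzMap ℝ ℂ) : dS (cj u) = cj (dS u) := by
  ext x
  have h := Complex.conjCLE.toContinuousLinearMap.hasFDerivAt.comp_hasDerivAt x (hasDerivAt_S u x)
  have h2 := hasDerivAt_S (cj u) x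
  exact h2.unique h

lemma dS_iter_cj (k : ℕ) (u : SchwartzMap ℝ ℂ) : dS^[k] (cj u) = cj (dS^[k] u) := by
  induction k with
  | zero => rfl
  | succ k ih => rw [Function.iterate_succ_apply', Function.iterate_succ_apply', ih, dS_cj]

lemma NN_cj (p : ℝ) (u : SchwartzMap ℝ ℂ) : NN p (cj u) = NN p u := by simp [NN, cj_apply]

lemma FT1_cj (u : SchwartzMap ℝ ℂ) (ξ : ℝ) : FT1 (cj u) ξ = (starRingEnd ℂ) (FT1 u (-ξ)) := by
  unfold FT1
  rw [← integral_conj]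
  refine integral_congr_ae (Eventually.of_forall fun x => ?_)
  simp [cj_apply, ← Complex.exp_conj]

noncomputable def PM (u : SchwartzMap ℝ ℂ) (x : ℝ) : ℂ :=
  ((1 / (2 * Real.pi) : ℝ) : ℂ) * ∫ ξ in Iio (0:ℝ), Complex.exp (Complex.I * (x : ℂ) * (ξ : ℂ)) * FT1 u ξ

lemma PM_eq (u : SchwartzMap ℝ ℂ) (x : ℝ) : PM u x = (starRingEnd ℂ) (PP 0 (cj u) x) := by
  unfold PM PP
  rw [map_mul, Complex.conj_ofReal, ← integral_conj]
  congr 1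
  rw [← integral_Iic_eq_integral_Iio, ← neg_zero, ← integral_comp_neg_Ioi, neg_zero]
  refine integral_congr_ae (Eventually.of_forall fun ξ => ?_)
  simp [FT1_cj, ← Complex.exp_conj]

lemma minus_bound {p q : ℝ} (hpq : p.HolderConjugate q) (m l : ℕ) : ∃ C : ℝ, 0 < C ∧
    ∀ a f g : SchwartzMap ℝ ℂ, ∀ M : ℝ, (∀ t, ‖dS^[m + l] a t‖ ≤ M) →
    ‖∫ x, a x * (PM (dS^[m] f) x * PM (dS^[l] g) x)‖ ≤ C * (M * NN p f * NN q g) := by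
  obtain ⟨C, hC, H⟩ := plus_bound hpq m l
  refine ⟨C, hC, fun a f g M hM => ?_⟩
  have h := H (cj a) (cj f) (cj g) M (fun t => by rw [dS_iter_cj, cj_apply]; simpa using hM t)
  rw [NN_cj, NN_cj] at h
  refine le_trans (le_of_eq ?_) h
  rw [← Complex.norm_conj, ← integral_conj]
  congr 2
  funext x
  simp [PM_eq, dS_iter_cj, cj_apply]

lemma integrable_e_FT1 (u : SchwartzMap ℝ ℂ) (x : ℝ) :
    Integrable (fun ξ : ℝ => Complex.exp (Complex.I * (x : ℂ) * (ξ : ℂ)) * FT1 u ξ) :=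
  (integrable_FT1 u).bdd_mul (c := 1) (by fun_prop) (Eventually.of_forall fun ξ => (norm_e x ξ).le)

lemma split_int {F : ℝ → ℂ} (h : Integrable F) : ∫ ξ, F ξ = (∫ ξ in Ioi (0:ℝ), F ξ) + ∫ ξ in Iio (0:ℝ), F ξ := by
  have := integral_add_compl (measurableSet_Ioi (a := (0:ℝ))) h
  rw [compl_Ioi, integral_Iic_eq_integral_Iio] at this
  exact this.symm

lemma u_eq (u : SchwartzMap ℝ ℂ) (x : ℝ) : u x = PP 0 u x + PM u x := by
  rw [inversion, split_int (integrable_e_FT1 u x), PP, PM, mul_add]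
  simp

lemma Hil_eq (u : SchwartzMap ℝ ℂ) (x : ℝ) : Hil u x = -Complex.I * (PP 0 u x - PM u x) := by
  rw [Hil, split_int (integrable_Hil u x), PP, PM]
  have e1 : ∫ ξ in Ioi (0:ℝ), Complex.exp (Complex.I * (x : ℂ) * (ξ : ℂ)) *
      (-Complex.I * ((Real.sign ξ : ℝ) : ℂ)) * FT1 u ξ = -Complex.I *
      ∫ ξ in Ioi (0:ℝ), Complex.exp (Complex.I * ((x : ℂ) + (0 : ℝ) * Complex.I) * (ξ : ℂ)) * FT1 u ξ := by
    rw [← integral_const_mul]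
    refine setIntegral_congr_fun measurableSet_Ioi fun ξ hξ => ?_
    simp [Real.sign_of_pos hξ]; ring
  have e2 : ∫ ξ in Iio (0:ℝ), Complex.exp (Complex.I * (x : ℂ) * (ξ : ℂ)) *
      (-Complex.I * ((Real.sign ξ : ℝ) : ℂ)) * FT1 u ξ = Complex.I *
      ∫ ξ in Iio (0:ℝ), Complex.exp (Complex.I * (x : ℂ) * (ξ : ℂ)) * FT1 u ξ := by
    rw [← integral_const_mul]
    refine setIntegral_congr_fun measurableSet_Iio fun ξ hξ => ?_
    simp [Real.sign_of_neg hξ]; ring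
  rw [e1, e2]; ring

lemma continuous_Hil (u : SchwartzMap ℝ ℂ) : Continuous (Hil u) := (contDiff_Hil u).continuous

lemma continuous_PM (u : SchwartzMap ℝ ℂ) : Continuous (PM u) := by
  rw [show PM u = _ from funext (PM_eq u)]
  exact Complex.continuous_conj.comp (continuous_PP le_rfl _)

lemma int_aPP (a u w : SchwartzMap ℝ ℂ) : Integrable (fun x => a x * (PP 0 u x * PP 0 w x)) := by
  have hK0 := (norm_nonneg _).trans (norm_PP_le le_rfl u 0)
  refine a.integrable.mul_bdd (c := ((1 / (2 * Real.pi)) * ∫ ξ in Ioi (0:ℝ), ‖FT1 u ξ‖) * ((1 / (2 * Real.pi)) * ∫ ξ in Ioi (0:ℝ), ‖FT1 w ξ‖)) ((continuous_PP le_rfl u).mul (continuous_PP le_rfl w)).aestronglyMeasurable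
    (Eventually.of_forall fun x => ?_)
  rw [norm_mul]
  exact mul_le_mul (norm_PP_le le_rfl u x) (norm_PP_le le_rfl w x) (norm_nonneg _) hK0

lemma int_aPM (a u w : SchwartzMap ℝ ℂ) : Integrable (fun x => a x * (PM u x * PM w x)) := by
  have h := (int_aPP (cj a) (cj u) (cj w))
  have h2 := (Complex.conjCLE.toContinuousLinearMap).integrable_comp h
  refine h2.congr (Eventually.of_forall fun x => ?_)
  simp [PM_eq, cj_apply]

/-- product of Schwartz functions -/
lemma exists_mul (a u : SchwartzMap ℝ ℂ) : ∃ b : SchwartzMap ℝ ℂ, ∀ x, b x = a x * u x :=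
  ⟨SchwartzMap.pairing (ContinuousLinearMap.mul ℂ ℂ) a u, fun x => by simp [SchwartzMap.pairing_apply_apply]⟩

lemma comm_pair (a u w : SchwartzMap ℝ ℂ) : ∫ x, (Hil (fun z => a z * u z) x - a x * Hil u x) * w x =
    2 * Complex.I * ((∫ x, a x * (PP 0 u x * PP 0 w x)) - ∫ x, a x * (PM u x * PM w x)) := by
  obtain ⟨b, hb⟩ := exists_mul a u
  rw [show (fun z => a z * u z) = ⇑b from (funext hb).symm]
  have hbd : ∀ v : SchwartzMap ℝ ℂ, ∃ c, ∀ x, ‖Hil v x‖ ≤ c := by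
    intro v
    refine ⟨((1 / (2 * Real.pi)) * ∫ ξ in Ioi (0:ℝ), ‖FT1 v ξ‖) +
      ((1 / (2 * Real.pi)) * ∫ ξ in Ioi (0:ℝ), ‖FT1 (cj v) ξ‖), fun x => ?_⟩
    rw [Hil_eq, norm_mul, norm_neg, Complex.norm_I, one_mul]
    refine (norm_sub_le _ _).trans (add_le_add (norm_PP_le le_rfl v x) ?_)
    rw [PM_eq, Complex.norm_conj]
    exact norm_PP_le le_rfl _ x
  obtain ⟨c1, h1⟩ := hbd b
  obtain ⟨c2, h2⟩ := hbd u
  obtain ⟨c3, h3⟩ := hbd w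
  obtain ⟨d, hd⟩ := exists_mul a w
  have i1 : Integrable (fun x => Hil b x * w x) := w.integrable.bdd_mul (c := c1)
    (continuous_Hil b).aestronglyMeasurable (Eventually.of_forall h1)
  have i2 : Integrable (fun x => a x * Hil u x * w x) := by
    refine (d.integrable.bdd_mul (c := c2) (continuous_Hil u).aestronglyMeasurable (Eventually.of_forall h2)).congr
      (Eventually.of_forall fun x => ?_)
    simp only [hd]; ring
  have i3 : Integrable (fun x => b x * Hil w x) := b.integrable.mul_bdd (c := c3)
    (continuous_Hil w).aestronglyMeasurable (Eventually.of_forall h3)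
  simp_rw [sub_mul]
  rw [integral_sub i1 i2, Hil_antisymm, ← integral_neg, ← integral_sub i3.fun_neg i2, ← integral_sub (int_aPP a u w) (int_aPM a u w),
    ← integral_const_mul]
  refine integral_congr_ae (Eventually.of_forall fun x => ?_)
  simp only [hb, Hil_eq]
  rw [u_eq u x, u_eq w x]
  ring

end CC

namespace CC
open Set Filter Topology
open scoped ENNReal

lemma cs_dS {g : SchwartzMap ℝ ℂ} (hg : HasCompactSupport (⇑g : ℝ → ℂ)) (l : ℕ) : HasCompactSupport (⇑(dS^[l] g) : ℝ → ℂ) := by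
  induction l with
  | zero => exact hg
  | succ l ih =>
    rw [Function.iterate_succ_apply', coe_dS]
    exact ih.deriv

lemma int_cs {c : ℝ → ℂ} (hc : Continuous c) {g : SchwartzMap ℝ ℂ} (hg : HasCompactSupport (⇑g : ℝ → ℂ)) :
    Integrable (fun x => c x * g x) :=
  (hc.mul g.continuous).integrable_of_hasCompactSupport hg.mul_left

lemma ibp (l : ℕ) {c : ℝ → ℂ} (hc : ContDiff ℝ ((⊤ : ℕ∞) : WithTop ℕ∞) c) {g : SchwartzMap ℝ ℂ}
    (hg : HasCompactSupport (⇑g : ℝ → ℂ)) :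
    ∫ x, deriv^[l] c x * g x = (-1) ^ l * ∫ x, c x * dS^[l] g x := by
  induction l generalizing c with
  | zero => simp
  | succ l ih =>
    have hd := contDiff_infty_iff_deriv.1 hc
    rw [Function.iterate_succ_apply, ih hd.2, pow_succ, mul_assoc]
    congr 1
    have h := integral_mul_deriv_eq_deriv_mul_of_integrable (u := c) (u' := deriv c) (v := dS^[l] g) (v' := dS^[l + 1] g)
      (fun x _ => (hd.1 x).hasDerivAt) (fun x _ => by rw [Function.iterate_succ_apply']; exact hasDerivAt_S _ x)
      (int_cs hc.continuous (cs_dS hg _)) (int_cs hd.2.continuous (cs_dS hg _)) (int_cs hc.continuous (cs_dS hg _))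
    rw [h]; ring

lemma contDiff_iter (l : ℕ) {c : ℝ → ℂ} (hc : ContDiff ℝ ((⊤ : ℕ∞) : WithTop ℕ∞) c) :
    ContDiff ℝ ((⊤ : ℕ∞) : WithTop ℕ∞) (deriv^[l] c) := by
  induction l generalizing c with
  | zero => exact hc
  | succ l ih =>
    rw [Function.iterate_succ_apply]
    exact ih (contDiff_infty_iff_deriv.1 hc).2

lemma memLp_of_int {h : ℝ → ℂ} {p : ℝ} (hp : 1 < p) (hm : AEStronglyMeasurable h) (hi : Integrable (fun x => ‖h x‖ ^ p)) :
    MemLp h (ENNReal.ofReal p) := by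
  rw [← integrable_norm_rpow_iff hm (by simp; linarith) ENNReal.ofReal_ne_top, ENNReal.toReal_ofReal (by linarith)]
  exact hi

lemma eLp_eq {h : ℝ → ℂ} {p : ℝ} (hp : 1 < p) (hm : MemLp h (ENNReal.ofReal p)) :
    eLpNorm h (ENNReal.ofReal p) volume = ENNReal.ofReal ((∫ x, ‖h x‖ ^ p) ^ (1 / p)) := by
  rw [hm.eLpNorm_eq_integral_rpow_norm (by simp; linarith) ENNReal.ofReal_ne_top, ENNReal.toReal_ofReal (by linarith), one_div]

lemma duality {p q : ℝ} (hpq : p.HolderConjugate q) {h : ℝ → ℂ} (hc : Continuous h) (hi : Integrable (fun x => ‖h x‖ ^ p))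
    {M : ℝ} (hM : 0 ≤ M) (H : ∀ g : SchwartzMap ℝ ℂ, HasCompactSupport (⇑g : ℝ → ℂ) → ‖∫ x, h x * g x‖ ≤ M * NN q g) :
    (∫ x, ‖h x‖ ^ p) ^ (1 / p) ≤ M := by
  have hp := hpq.lt
  have hq := hpq.symm.lt
  have hp0 := hpq.pos
  have hq0 := hpq.symm.pos
  set I := ∫ x, ‖h x‖ ^ p with hI
  have hI0 : 0 ≤ I := integral_nonneg fun x => by positivity
  let k : ℝ → ℂ := fun x => ((‖h x‖ ^ (p - 2) : ℝ) : ℂ) * (starRingEnd ℂ) (h x)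
  have hkm : Measurable k := by
    have := hc.measurable
    exact (Complex.measurable_ofReal.comp (this.norm.pow_const _)).mul (Complex.continuous_conj.measurable.comp this)
  have hkn : ∀ x, ‖k x‖ ^ q = ‖h x‖ ^ p := by
    intro x
    simp only [k]
    rw [norm_mul, Complex.norm_conj, Complex.norm_real, Real.norm_of_nonneg (by positivity)]
    rcases (norm_nonneg (h x)).eq_or_lt with h0 | h0
    · rw [← h0, mul_zero, Real.zero_rpow hq0.ne', Real.zero_rpow hp0.ne']
    · rw [← Real.rpow_add_one h0.ne', ← Real.rpow_mul h0.le]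
      congr 1
      have := hpq.sub_one_mul_conj
      linarith
  have hhk : ∀ x, h x * k x = ((‖h x‖ ^ p : ℝ) : ℂ) := by
    intro x
    simp only [k]
    rw [mul_left_comm, Complex.mul_conj, Complex.normSq_eq_norm_sq, ← Complex.ofReal_mul]
    congr 1
    rcases (norm_nonneg (h x)).eq_or_lt with h0 | h0
    · rw [← h0, Real.zero_rpow hp0.ne']; simp
    · rw [← Real.rpow_natCast, ← Real.rpow_add h0]; norm_num
  have hkL : MemLp k (ENNReal.ofReal q) := memLp_of_int hq hkm.aestronglyMeasurable (by simp_rw [hkn]; exact hi)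
  have hhL : MemLp h (ENNReal.ofReal p) := memLp_of_int hp hc.aestronglyMeasurable hi
  have i1 : Integrable (fun x => h x * k x) := by simp_rw [hhk]; exact hi.ofReal
  have e1 : ∫ x, h x * k x = (I : ℂ) := by simp_rw [hhk]; exact integral_complex_ofReal
  have key : ∀ ε > 0, I ≤ M * I ^ (1 / q) + ε * (I ^ (1 / p) + M) := by
    intro ε hε
    obtain ⟨g0, hg1, hg2, hg3⟩ := MemLp.exist_eLpNorm_sub_le ENNReal.ofReal_ne_top (by simpa using hq.le) hkL hε
    let g : SchwartzMap ℝ ℂ := hg1.toSchwartzMap hg2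
    have hgg : (⇑g : ℝ → ℂ) = g0 := rfl
    rw [← hgg] at hg1 hg3
    have hgL : MemLp (⇑g) (ENNReal.ofReal q) := g.memLp _ _
    have hdL := hkL.sub hgL
    have n1 : (∫ x, ‖(k - ⇑g) x‖ ^ q) ^ (1 / q) ≤ ε := by
      rwa [eLp_eq hq hdL, ENNReal.ofReal_le_ofReal_iff hε.le] at hg3
    have n2 : NN q g ≤ I ^ (1 / q) + ε := by
      have t := eLpNorm_sub_le (p := ENNReal.ofReal q) (μ := volume) hkL.1 hdL.1 (by simpa using hq.le)
      rw [sub_sub_cancel, eLp_eq hq hgL, eLp_eq hq hkL] at t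
      have t2 := t.trans (add_le_add le_rfl hg3)
      simp_rw [hkn] at t2
      rw [← ENNReal.ofReal_add (by positivity) hε.le, ENNReal.ofReal_le_ofReal_iff (by positivity)] at t2
      exact t2
    have i2 := int_cs hc hg1
    have e2 : (I : ℂ) = (∫ x, h x * (k - ⇑g) x) + ∫ x, h x * g x := by
      have i3 : Integrable (fun x => h x * (k - ⇑g) x) := by
        refine (i1.sub i2).congr (Eventually.of_forall fun x => ?_)
        simp; ring
      rw [← e1, ← integral_add i3 i2]
      congr 1; funext x; simp; ring
    have n3 : ‖∫ x, h x * (k - ⇑g) x‖ ≤ I ^ (1 / p) * ε := by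
      refine (norm_integral_le_integral_norm _).trans ?_
      simp_rw [norm_mul]
      refine (integral_mul_norm_le_Lp_mul_Lq hpq hhL hdL).trans ?_
      gcongr
    have n4 : I ≤ I ^ (1 / p) * ε + M * (I ^ (1 / q) + ε) := by
      calc I = ‖(I : ℂ)‖ := by rw [Complex.norm_real, Real.norm_of_nonneg hI0]
        _ ≤ _ := by
          rw [e2]
          refine (norm_add_le _ _).trans (add_le_add n3 ((H g hg1).trans ?_))
          gcongr
    linarith
  have fin : I ≤ M * I ^ (1 / q) := by
    have hcont : Continuous (fun ε : ℝ => M * I ^ (1 / q) + ε * (I ^ (1 / p) + M)) := by fun_prop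
    have ht := (hcont.tendsto 0).mono_left (nhdsWithin_le_nhds (s := Ioi 0))
    simp only [zero_mul, add_zero] at ht
    refine ge_of_tendsto ht ?_
    filter_upwards [self_mem_nhdsWithin] with ε hε using key ε hε
  rcases hI0.eq_or_lt with h0 | h0
  · rw [← h0, Real.zero_rpow (by positivity)]; exact hM
  · have e : I = I ^ (1 / p) * I ^ (1 / q) := by
      rw [← Real.rpow_add h0, one_div, one_div, hpq.inv_add_inv_eq_one, Real.rpow_one]
    have hpos : 0 < I ^ (1 / q) := by positivity
    rw [e] at fin
    refine le_of_mul_le_mul_right (le_trans (le_of_eq ?_) (fin.trans (le_of_eq ?_))) hpos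
    · rfl
    · rw [← e]

end CC

/-- Generalized Calderón commutator estimate: for `p ∈ (1,∞)` and integers `l, m ≥ 0`
with `l + m ≥ 1` there is `c = c(p,l,m) > 0` such that for all Schwartz `a, f`,
`‖∂ₓ^l [𝓗; a] ∂ₓ^m f‖_{L^p} ≤ c ‖∂ₓ^{l+m} a‖_∞ ‖f‖_{L^p}`. -/
theorem calderon_commutator_estimate (p : ℝ) (hp : 1 < p) (l m : ℕ) (hlm : 1 ≤ l + m) :
    ∃ c : ℝ, 0 < c ∧ ∀ a f : SchwartzMap ℝ ℂ,
      (∫ x : ℝ, ‖deriv^[l] (fun y : ℝ =>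
          Hil (fun z => a z * deriv^[m] (⇑f) z) y - a y * Hil (deriv^[m] (⇑f)) y) x‖ ^ p)
            ^ (1 / p)
        ≤ c * (⨆ x : ℝ, ‖deriv^[l + m] (⇑a) x‖) * (∫ x : ℝ, ‖f x‖ ^ p) ^ (1 / p) := by
  have hpq := Real.HolderConjugate.conjExponent hp
  set q := p.conjExponent
  obtain ⟨C, hC, H⟩ := CC.plus_bound hpq m l
  obtain ⟨D, hD, H1⟩ := CC.minus_bound hpq m l
  refine ⟨2 * (C + D), by positivity, fun a f => ?_⟩
  rw [← CC.coe_dS_iter m f, ← CC.coe_dS_iter (l + m) a]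
  set u := CC.dS^[m] f with hu
  set S := ⨆ x : ℝ, ‖(CC.dS^[l + m] a) x‖ with hS
  have hSle : ∀ t, ‖CC.dS^[m + l] a t‖ ≤ S := by
    intro t
    rw [add_comm m l]
    refine le_ciSup (f := fun x => ‖(CC.dS^[l + m] a) x‖) ?_ t
    obtain ⟨B, hB⟩ := (CC.dS^[l + m] a).decay 0 0
    refine ⟨B, ?_⟩
    rintro _ ⟨x, rfl⟩
    simpa using hB.2 x
  have hS0 : 0 ≤ S := (norm_nonneg _).trans (hSle 0)
  have hN := CC.NN_nonneg p f
  have hrhs : 0 ≤ 2 * (C + D) * S * (∫ x : ℝ, ‖f x‖ ^ p) ^ (1 / p) := by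
    have : 0 ≤ (∫ x : ℝ, ‖f x‖ ^ p) ^ (1 / p) := hN
    positivity
  obtain ⟨b, hb⟩ := CC.exists_mul a u
  have hcd : ContDiff ℝ ((⊤ : ℕ∞) : WithTop ℕ∞) (fun y : ℝ => Hil (fun z => a z * u z) y - a y * Hil u y) := by
    rw [show (fun z => a z * u z) = ⇑b from (funext hb).symm]
    exact (CC.contDiff_Hil b).sub ((a.smooth _).mul (CC.contDiff_Hil u))
  by_cases hi : Integrable (fun x => ‖deriv^[l] (fun y : ℝ => Hil (fun z => a z * u z) y - a y * Hil u y) x‖ ^ p)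
  swap
  · rw [integral_undef hi, Real.zero_rpow (by positivity)]
    exact hrhs
  refine CC.duality hpq (CC.contDiff_iter l hcd).continuous hi hrhs fun g hg => ?_
  rw [CC.ibp l hcd hg, CC.comm_pair, norm_mul, norm_pow, norm_neg, norm_one, one_pow, one_mul, norm_mul, norm_mul,
    Complex.norm_I, Complex.norm_ofNat, mul_one]
  have h1 := H a f g S hSle
  have h2 := H1 a f g S hSle
  have h3 := norm_sub_le (∫ x, a x * (CC.PP 0 u x * CC.PP 0 (CC.dS^[l] g) x))
    (∫ x, a x * (CC.PM u x * CC.PM (CC.dS^[l] g) x))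
  have e : (∫ x : ℝ, ‖f x‖ ^ p) ^ (1 / p) = CC.NN p f := rfl
  rw [e]
  linarith
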